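/- Assume the Generalized Riemann Hypothesis. Then there exists an absolute constant C such that the following holds for all reals x ≥ y ≥ 3. Let 𝒬 be the set of primes q ≤ y and π(y) = |𝒬|. For each sign vector s ∈ {−1,1}^𝒬, let N(s) be the number of primes p with y < p ≤ x such that (q/p) = s_q for every q ∈ 𝒬. Then Var_s N(s) := 2^{−π(y)} Σ_{s ∈ {−1,1}^𝒬} (N(s) − 2^{−π(y)}·P)² ≤ C·2^{−π(y)}·x·((log x)² + y²), where P is the total number of primes p with y < p ≤ x. -/

import Mathlib

/-- The Generalized Riemann Hypothesis: every zero of a Dirichlet L-function in the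
critical strip `0 < Re s < 1` has real part `1/2`. -/
def GRH : Prop :=
  ∀ (r : ℕ) [NeZero r] (χ : DirichletCharacter ℂ r) (s : ℂ),
    0 < s.re → s.re < 1 → DirichletCharacter.LFunction χ s = 0 → s.re = 1 / 2

/-- `signB b` is `1` if `b = true` and `-1` if `b = false`; it identifies `Bool` with `{-1,1}`. -/
def signB (b : Bool) : ℤ := if b then 1 else -1

namespace QRVar

open Complex Metric Set Filter Topology MeasureTheory
open scoped ComplexConjugate NumberTheorySymbols

/-- A holomorphic function without zeros on a disc has a holomorphic logarithm there. -/
lemma exists_log_on_ball {f : ℂ → ℂ} {c : ℂ} {R : ℝ} (hR : 0 < R)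
    (hf : DifferentiableOn ℂ f (ball c R)) (h0 : ∀ z ∈ ball c R, f z ≠ 0) :
    ∃ g : ℂ → ℂ, (∀ z ∈ ball c R, HasDerivAt g (deriv f z / f z) z) ∧ g c = 0 ∧
      ∀ z ∈ ball c R, f z = f c * exp (g z) := by
  have hd : DifferentiableOn ℂ (fun z => deriv f z / f z) (ball c R) :=
    (hf.deriv isOpen_ball).div hf h0
  obtain ⟨g, hgc, hg⟩ := hd.isExactOn_ball.with_val_at c 0
  refine ⟨g, hg, hgc, fun z hz => ?_⟩
  have hc : c ∈ ball c R := mem_ball_self hR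
  have key : ∀ w ∈ ball c R, HasDerivAt (fun w => f w * exp (-g w)) 0 w := by
    intro w hw
    have h1 := (hf.differentiableAt (isOpen_ball.mem_nhds hw)).hasDerivAt
    have h2 := (hg w hw).neg.cexp
    have h3 := h0 w hw
    refine (h1.mul h2).congr_deriv ?_
    simp only [Pi.neg_apply]
    field_simp
    ring
  have hconst : f z * exp (-g z) = f c * exp (-g c) := by
    refine (convex_ball c R).is_const_of_fderivWithin_eq_zero (𝕜 := ℂ)
      (f := fun w => f w * exp (-g w))
      (fun w hw => (key w hw).differentiableAt.differentiableWithinAt) ?_ hz hc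
    intro w hw
    rw [fderivWithin_of_isOpen isOpen_ball hw, (key w hw).hasFDerivAt.fderiv]
    ext; simp
  rw [hgc, neg_zero, exp_zero, mul_one] at hconst
  rw [← hconst, mul_assoc, ← exp_add]
  simp

/-- Borel–Carathéodory for the logarithm of a zero-free function. -/
lemma log_bound_of_zero_free {f : ℂ → ℂ} {c : ℂ} {r R M : ℝ} (hr : 0 ≤ r) (hrR : r < R)
    (hf : DifferentiableOn ℂ f (ball c R)) (h0 : ∀ z ∈ ball c R, f z ≠ 0) (hM : 1 < M)
    (hb : ∀ z ∈ ball c R, ‖f z‖ ≤ M * ‖f c‖) {z : ℂ} (hz : ‖z - c‖ ≤ r) :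
    ‖f c‖ ≤ ‖f z‖ * Real.exp (2 * Real.log M * r / (R - r)) ∧
      ‖deriv f z / f z‖ ≤ 8 * R / (R - r) ^ 2 * Real.log M := by
  have hR : 0 < R := hr.trans_lt hrR
  have hL : 0 < Real.log M := Real.log_pos hM
  obtain ⟨g, hg, hgc, hfg⟩ := exists_log_on_ball hR hf h0
  have hc : c ∈ ball c R := mem_ball_self hR
  have hfc : 0 < ‖f c‖ := norm_pos_iff.mpr (h0 c hc)
  have hre : ∀ w ∈ ball c R, (g w).re ≤ Real.log M := by
    intro w hw
    have h1 := hb w hw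
    rw [hfg w hw, norm_mul, norm_exp, mul_comm] at h1
    exact (Real.le_log_iff_exp_le (by linarith)).mpr (le_of_mul_le_mul_right h1 hfc)
  have hBC : ∀ w, ‖w - c‖ < R → ‖g w‖ ≤ 2 * Real.log M * ‖w - c‖ / (R - ‖w - c‖) := by
    intro w hw
    have hmem : ∀ u ∈ ball (0 : ℂ) R, c + u ∈ ball c R := by
      intro u hu; simpa using hu
    have := borelCaratheodory_zero (f := fun u => g (c + u)) (z := w - c) hL
      (fun u hu => ?_) (fun u hu => hre _ (hmem u hu)) hR (by simpa using hw) (by simpa using hgc)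
    · simpa using this
    · have h := (hg _ (hmem u hu)).differentiableAt
      exact (h.comp u (by fun_prop)).differentiableWithinAt
  have hzR : ‖z - c‖ < R := hz.trans_lt hrR
  have hzb : z ∈ ball c R := by simpa [dist_eq_norm] using hzR
  constructor
  · rw [hfg z hzb, norm_mul, norm_exp, mul_assoc, ← Real.exp_add]
    apply le_mul_of_one_le_right hfc.le
    apply Real.one_le_exp
    have h1 := hBC z hzR
    have h2 : 2 * Real.log M * ‖z - c‖ / (R - ‖z - c‖) ≤ 2 * Real.log M * r / (R - r) := by
      have : 0 < R - r := by linarith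
      gcongr
    have h3 := abs_le.mp (abs_re_le_norm (g z))
    linarith [h3.1]
  · set ρ := (R - r) / 2 with hρ
    have hρ0 : 0 < ρ := by rw [hρ]; linarith
    have hsub : ∀ w ∈ closedBall z ρ, ‖w - c‖ ≤ r + ρ := by
      intro w hw
      rw [mem_closedBall, dist_eq_norm] at hw
      calc ‖w - c‖ = ‖(w - z) + (z - c)‖ := by ring_nf
        _ ≤ _ := norm_add_le _ _
        _ ≤ r + ρ := by linarith
    have hin : ∀ w ∈ closedBall z ρ, w ∈ ball c R := by
      intro w hw
      have := hsub w hw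
      rw [mem_ball, dist_eq_norm]; linarith
    have hd := norm_deriv_le_of_forall_mem_sphere_norm_le (f := g) (c := z) (R := ρ)
      (C := 2 * Real.log M * R / ρ) hρ0 ?_ ?_
    · rw [(hg z hzb).deriv] at hd
      refine hd.trans (le_of_eq ?_)
      rw [hρ]
      have : R - r ≠ 0 := by linarith
      field_simp
      norm_num
    · apply DifferentiableOn.diffContOnCl
      rw [closure_ball _ hρ0.ne']
      exact fun w hw => (hg w (hin w hw)).differentiableAt.differentiableWithinAt
    · intro w hw
      have h1 := hsub w (sphere_subset_closedBall hw)
      have h2 : ‖w - c‖ < R := by linarith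
      refine (hBC w h2).trans ?_
      have h3 : ρ ≤ R - ‖w - c‖ := by linarith
      gcongr

lemma sum_range_dirichletCharacter_add_level {N : ℕ} [NeZero N] {χ : DirichletCharacter ℂ N}
    (hχ : χ ≠ 1) (n : ℕ) :
    ∑ k ∈ Finset.range (n + N), χ (k : ZMod N) = ∑ k ∈ Finset.range n, χ (k : ZMod N) := by
  induction n with
  | zero =>
    rw [zero_add, Finset.range_zero, Finset.sum_empty, ← MulChar.sum_eq_zero_of_ne_one hχ]
    refine Finset.sum_bij (fun k _ => (k : ZMod N)) (by simp) ?_ ?_ (by simp)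
    · intro a ha b hb h
      rw [Finset.mem_range] at ha hb
      rw [ZMod.natCast_eq_natCast_iff'] at h
      rwa [Nat.mod_eq_of_lt ha, Nat.mod_eq_of_lt hb] at h
    · intro b _
      exact ⟨b.val, Finset.mem_range.mpr (ZMod.val_lt b), ZMod.natCast_zmod_val b⟩
  | succ n ih =>
    rw [show n + 1 + N = (n + N) + 1 by ring, Finset.sum_range_succ, ih, Finset.sum_range_succ]
    simp

lemma norm_sum_Icc_dirichletCharacter_le {N : ℕ} [NeZero N] {χ : DirichletCharacter ℂ N}
    (hχ : χ ≠ 1) (n : ℕ) :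
    ‖∑ k ∈ Finset.Icc 1 n, χ (k : ZMod N)‖ ≤ N + 1 := by
  have h1 : ∀ n : ℕ, ‖∑ k ∈ Finset.range n, χ (k : ZMod N)‖ ≤ N := by
    intro n
    induction n using Nat.strong_induction_on with
    | _ n ih =>
      by_cases hn : n < N
      · calc _ ≤ ∑ k ∈ Finset.range n, (1 : ℝ) := norm_sum_le_of_le _ fun k _ => χ.norm_le_one _
          _ ≤ N := by simpa using hn.le
      · obtain ⟨m, rfl⟩ := Nat.exists_eq_add_of_le' (not_lt.mp hn)
        rw [sum_range_dirichletCharacter_add_level hχ]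
        exact ih m (by have := NeZero.pos N; omega)
  have h2 : ∑ k ∈ Finset.Icc 1 n, χ (k : ZMod N) =
      ∑ k ∈ Finset.range (n + 1), χ (k : ZMod N) - χ ((0 : ℕ) : ZMod N) := by
    rw [Finset.range_eq_Ico, ← Finset.insert_Ico_add_one_left_eq_Ico (Nat.succ_pos n),
      Finset.sum_insert (by simp)]
    simp only [add_sub_cancel_left]
    rfl
  rw [h2]
  exact (norm_sub_le _ _).trans (add_le_add (h1 _) (χ.norm_le_one _))

lemma exists_norm_LFunction_le {N : ℕ} [NeZero N] {χ : DirichletCharacter ℂ N} (hχ : χ ≠ 1) :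
    ∃ A : ℝ, 0 < A ∧ ∀ s : ℂ, 1 / 10 ≤ s.re → ‖DirichletCharacter.LFunction χ s‖ ≤ A * ‖s‖ := by
  classical
  set f : ℝ → ℂ := indicator (Ioi 1) fun t => ∑ k ∈ Finset.Icc 1 ⌊t⌋₊, χ (k : ZMod N) with hf
  have hfb : ∀ t, ‖f t‖ ≤ N + 1 := by
    intro t
    rw [hf, indicator_apply]
    split_ifs
    · exact norm_sum_Icc_dirichletCharacter_le hχ _
    · simp; positivity
  have hmeas : Measurable f := by
    refine Measurable.indicator ?_ measurableSet_Ioi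
    exact (measurable_from_nat (f := fun n : ℕ => ∑ k ∈ Finset.Icc 1 n, χ (k : ZMod N))).comp
      Nat.measurable_floor
  have hloc : MeasureTheory.LocallyIntegrableOn f (Ioi 0) := by
    apply MeasureTheory.LocallyIntegrable.locallyIntegrableOn
    refine (MeasureTheory.locallyIntegrable_const ((N : ℝ) + 1)).mono
      hmeas.aestronglyMeasurable (.of_forall fun t => ?_)
    rw [Real.norm_of_nonneg (by positivity)]; exact hfb t
  have hdiff : ∀ s : ℂ, 0 < s.re → DifferentiableAt ℂ (mellin f) (-s) := by
    intro s hs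
    refine mellin_differentiableAt_of_isBigO_rpow (a := 0) (b := -s.re - 1) hloc ?_ (by simpa) ?_
      (by simp)
    · simp only [neg_zero, Real.rpow_zero]
      exact Asymptotics.IsBigO.of_bound (N + 1) (.of_forall fun t => by simpa using hfb t)
    · refine Asymptotics.IsBigO.of_bound 0 ?_
      filter_upwards [mem_nhdsWithin_of_mem_nhds (Iio_mem_nhds one_pos)] with t ht
      simp [hf, not_lt.mpr (le_of_lt (mem_Iio.mp ht))]
  have hmel : ∀ s : ℂ, mellin f (-s) =
      ∫ t in Ioi (1 : ℝ), (∑ k ∈ Finset.Icc 1 ⌊t⌋₊, χ (k : ZMod N)) * (t : ℂ) ^ (-(s + 1)) := by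
    intro s
    rw [mellin]
    have : ∀ t : ℝ, (t : ℂ) ^ (-s - 1) • f t = indicator (Ioi 1) (fun t : ℝ =>
        (∑ k ∈ Finset.Icc 1 ⌊t⌋₊, χ (k : ZMod N)) * (t : ℂ) ^ (-(s + 1))) t := by
      intro t
      by_cases ht : t ∈ Ioi (1 : ℝ)
      · rw [hf, indicator_of_mem ht, indicator_of_mem ht, smul_eq_mul, mul_comm]
        congr 2; ring
      · rw [hf, indicator_of_notMem ht, indicator_of_notMem ht, smul_zero]
    simp_rw [this]
    rw [MeasureTheory.integral_indicator measurableSet_Ioi,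
      MeasureTheory.Measure.restrict_restrict measurableSet_Ioi,
      inter_eq_left.mpr (Ioi_subset_Ioi zero_le_one)]
  have hLs : ∀ s : ℂ, 1 < s.re → DirichletCharacter.LFunction χ s = s * mellin f (-s) := by
    intro s hs
    rw [DirichletCharacter.LFunction_eq_LSeries χ hs, hmel]
    refine LSeries_eq_mul_integral (r := 0) _ le_rfl (by linarith)
      (DirichletCharacter.LSeriesSummable_of_one_lt_re χ hs) ?_
    simp only [Real.rpow_zero]
    exact Asymptotics.IsBigO.of_bound (N + 1) (.of_forall fun n => by
      simpa using norm_sum_Icc_dirichletCharacter_le hχ n)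
  have hL : ∀ s : ℂ, 0 < s.re → DirichletCharacter.LFunction χ s = s * mellin f (-s) := by
    have hop : IsOpen {s : ℂ | 0 < s.re} := isOpen_lt continuous_const continuous_re
    have h1 : AnalyticOnNhd ℂ (DirichletCharacter.LFunction χ) {s : ℂ | 0 < s.re} :=
      (DirichletCharacter.differentiable_LFunction hχ).differentiableOn.analyticOnNhd hop
    have h2 : AnalyticOnNhd ℂ (fun s => s * mellin f (-s)) {s : ℂ | 0 < s.re} := by
      refine DifferentiableOn.analyticOnNhd (fun s hs => ?_) hop
      exact (differentiableAt_id.mul ((hdiff s hs).comp s differentiableAt_id.neg)).differentiableWithinAt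
    have h3 : IsPreconnected {s : ℂ | 0 < s.re} := (convex_halfSpace_re_gt 0).isPreconnected
    refine h1.eqOn_of_preconnected_of_eventuallyEq h2 h3 (z₀ := 2) (by simp) ?_
    filter_upwards [(isOpen_lt continuous_const continuous_re).mem_nhds
      (show (1 : ℝ) < (2 : ℂ).re by norm_num)] with s hs
    exact hLs s hs
  refine ⟨10 * (N + 1), by positivity, fun s hs => ?_⟩
  rw [hL s (by linarith), norm_mul, mul_comm, hmel]
  gcongr
  have hint : MeasureTheory.IntegrableOn (fun t : ℝ => ((N : ℝ) + 1) * t ^ (-(s.re + 1))) (Ioi 1) :=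
    (integrableOn_Ioi_rpow_of_lt (by linarith) one_pos).const_mul _
  refine (MeasureTheory.norm_integral_le_of_norm_le hint ?_).trans ?_
  · filter_upwards [MeasureTheory.ae_restrict_mem measurableSet_Ioi] with t ht
    rw [norm_mul, norm_cpow_eq_rpow_re_of_pos (one_pos.trans ht)]
    simp only [neg_re, add_re, one_re]
    gcongr
    · exact (Real.rpow_pos_of_pos (one_pos.trans ht) _).le
    · exact norm_sum_Icc_dirichletCharacter_le hχ _
  · rw [MeasureTheory.integral_const_mul, integral_Ioi_rpow_of_lt (by linarith) one_pos]
    simp only [Real.one_rpow]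
    rw [show -(s.re + 1) + 1 = -s.re by ring, neg_div_neg_eq, mul_comm]
    gcongr
    rw [div_le_iff₀ (by linarith)]; linarith

lemma norm_LFunction_sub_one_le {N : ℕ} [NeZero N] (χ : DirichletCharacter ℂ N) {s : ℂ}
    (hs : 2 ≤ s.re) : ‖DirichletCharacter.LFunction χ s - 1‖ ≤ 7 / 10 := by
  have hs1 : 1 < s.re := by linarith
  rw [DirichletCharacter.LFunction_eq_LSeries χ hs1]
  have hS := DirichletCharacter.LSeriesSummable_of_one_lt_re χ hs1
  have h2 := hasSum_zeta_two
  have h3 : LSeries (fun n => χ (n : ZMod N)) s - 1 =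
      ∑' n, LSeries.term (fun n => χ (n : ZMod N)) s (n + 2) := by
    have := hS.sum_add_tsum_nat_add 2
    rw [LSeries, ← this]
    simp [Finset.sum_range_succ, LSeries.term]
  have h4 : HasSum (fun n : ℕ => 1 / ((n + 2 : ℕ) : ℝ) ^ 2) (Real.pi ^ 2 / 6 - 1) := by
    have := (hasSum_nat_add_iff' 2).mpr h2
    simpa [Finset.sum_range_succ] using this
  rw [h3]
  have h5 := tsum_of_norm_bounded (f := fun n => LSeries.term (fun n => χ (n : ZMod N)) s (n + 2))
    h4 ?_
  · refine h5.trans ?_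
    have := Real.pi_lt_d2
    nlinarith [Real.pi_pos]
  · intro n
    rw [LSeries.norm_term_eq, if_neg (by omega)]
    have h1 : (1 : ℝ) ≤ ((n + 2 : ℕ) : ℝ) := by push_cast; linarith [(Nat.cast_nonneg n : (0:ℝ) ≤ n)]
    rw [← Real.rpow_natCast]
    gcongr
    · exact χ.norm_le_one _
    · exact_mod_cast hs

lemma norm_LFunction_ge_of_two_le_re {N : ℕ} [NeZero N] (χ : DirichletCharacter ℂ N) {s : ℂ}
    (hs : 2 ≤ s.re) : 1 / 4 ≤ ‖DirichletCharacter.LFunction χ s‖ := by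
  have h := norm_LFunction_sub_one_le χ hs
  have h2 := norm_sub_norm_le (1 : ℂ) (1 - DirichletCharacter.LFunction χ s)
  rw [norm_sub_rev] at h
  rw [sub_sub_cancel, norm_one] at h2
  linarith

lemma norm_LFunction_le_of_two_le_re {N : ℕ} [NeZero N] (χ : DirichletCharacter ℂ N) {s : ℂ}
    (hs : 2 ≤ s.re) : ‖DirichletCharacter.LFunction χ s‖ ≤ 2 := by
  have h := norm_LFunction_sub_one_le χ hs
  have h2 := norm_add_le (1 : ℂ) (DirichletCharacter.LFunction χ s - 1)
  rw [add_sub_cancel, norm_one] at h2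
  linarith

lemma zero_free_strip_bounds {N : ℕ} [NeZero N] {χ : DirichletCharacter ℂ N} (hχ : χ ≠ 1)
    (hz : ∀ s : ℂ, 1 / 2 < s.re → DirichletCharacter.LFunction χ s ≠ 0) {σ : ℝ}
    (hσ : 1 / 2 < σ) (hσ2 : σ ≤ 2) :
    ∃ A κ B : ℝ, 1 ≤ A ∧ 0 ≤ κ ∧ 0 ≤ B ∧ ∀ s : ℂ, σ ≤ s.re → s.re ≤ 2 →
      1 / 4 ≤ ‖DirichletCharacter.LFunction χ s‖ * (A * (1 + |s.im|)) ^ κ ∧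
      ‖deriv (DirichletCharacter.LFunction χ) s / DirichletCharacter.LFunction χ s‖ ≤
        B * Real.log (A * (1 + |s.im|)) := by
  obtain ⟨A₀, hA₀, hA⟩ := exists_norm_LFunction_le hχ
  set r := 2 - σ with hr
  refine ⟨16 * A₀ + 2, 2 * r / (3 / 2 - r), 8 * (3 / 2) / (3 / 2 - r) ^ 2, by linarith, ?_, ?_, ?_⟩
  · apply div_nonneg <;> linarith
  · positivity
  intro s hs1 hs2
  set c : ℂ := ⟨2, s.im⟩ with hc
  set M := (16 * A₀ + 2) * (1 + |s.im|) with hM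
  have hM1 : 1 < M := by rw [hM]; nlinarith [abs_nonneg s.im]
  have hcb := norm_LFunction_ge_of_two_le_re χ (s := c) le_rfl
  have hball : ∀ z ∈ ball c (3 / 2), 1 / 2 < z.re ∧ ‖z‖ ≤ 4 * (1 + |s.im|) := by
    intro z hz
    rw [mem_ball, dist_eq_norm] at hz
    constructor
    · have := (abs_le.mp (abs_re_le_norm (z - c))).1
      simp [hc] at this; linarith
    · have h1 : ‖z‖ ≤ ‖z - c‖ + ‖c‖ := by simpa using norm_add_le (z - c) c
      have h2 : ‖c‖ ≤ 2 + |s.im| := by simpa [hc] using norm_le_abs_re_add_abs_im c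
      linarith [abs_nonneg s.im]
  have := log_bound_of_zero_free (f := DirichletCharacter.LFunction χ) (c := c) (r := r)
    (R := 3 / 2) (M := M) (by linarith) (by linarith)
    (DirichletCharacter.differentiable_LFunction hχ).differentiableOn
    (fun z hzb => hz z (hball z hzb).1) hM1 (fun z hzb => ?_) (z := s) ?_
  · refine ⟨hcb.trans ?_, this.2⟩
    refine this.1.trans_eq ?_
    rw [Real.rpow_def_of_pos (by linarith)]
    congr 2; ring
  · obtain ⟨h1, h2⟩ := hball z hzb
    calc _ ≤ A₀ * ‖z‖ := hA z (by linarith)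
      _ ≤ A₀ * (4 * (1 + |s.im|)) := by gcongr
      _ ≤ M * (1 / 4) := by rw [hM]; nlinarith [abs_nonneg s.im]
      _ ≤ _ := by gcongr
  · have : s - c = ((s.re - 2 : ℝ) : ℂ) := by
      apply Complex.ext <;> simp [hc]
    rw [this, norm_real, Real.norm_eq_abs, abs_le]
    constructor <;> linarith

/-- Polynomial lower bound for a zero-free `L`-function to the right of `1 / 2`. -/
lemma exists_inv_norm_LFunction_le {N : ℕ} [NeZero N] {χ : DirichletCharacter ℂ N} (hχ : χ ≠ 1)
    (hz : ∀ s : ℂ, 1 / 2 < s.re → DirichletCharacter.LFunction χ s ≠ 0) {σ : ℝ}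
    (hσ : 1 / 2 < σ) (hσ2 : σ ≤ 2) :
    ∃ (A : ℝ) (k : ℕ), 0 < A ∧ ∀ s : ℂ, σ ≤ s.re →
      ‖DirichletCharacter.LFunction χ s‖⁻¹ ≤ A * (1 + ‖s‖) ^ k := by
  obtain ⟨A, κ, B, hA, hκ, hB, h⟩ := zero_free_strip_bounds hχ hz hσ hσ2
  have hA0 : 0 < A := by linarith
  refine ⟨4 * A ^ κ, ⌈κ⌉₊, by positivity, fun s hs => ?_⟩
  have h1 : (1 : ℝ) ≤ 1 + ‖s‖ := by linarith [norm_nonneg s]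
  by_cases h2 : s.re ≤ 2
  · have h3 := (h s hs h2).1
    have hLpos : 0 < ‖DirichletCharacter.LFunction χ s‖ := norm_pos_iff.mpr (hz s (by linarith))
    have h4 : (A * (1 + |s.im|)) ^ κ ≤ A ^ κ * (1 + ‖s‖) ^ ⌈κ⌉₊ := by
      rw [Real.mul_rpow hA0.le (by positivity)]
      gcongr
      calc (1 + |s.im|) ^ κ ≤ (1 + ‖s‖) ^ κ := by gcongr; exact abs_im_le_norm s
        _ ≤ (1 + ‖s‖) ^ (⌈κ⌉₊ : ℝ) := Real.rpow_le_rpow_of_exponent_le h1 (Nat.le_ceil κ)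
        _ = _ := Real.rpow_natCast _ _
    rw [inv_le_iff_one_le_mul₀ hLpos]
    have := mul_le_mul_of_nonneg_left h4 hLpos.le
    nlinarith
  · have h3 := norm_LFunction_ge_of_two_le_re χ (not_le.mp h2).le
    have h4 : ‖DirichletCharacter.LFunction χ s‖⁻¹ ≤ 4 := by
      rw [inv_le_comm₀ (by linarith) (by norm_num)]; linarith
    have h5 : 1 ≤ A ^ κ := Real.one_le_rpow hA hκ
    have h6 : 1 ≤ (1 + ‖s‖) ^ ⌈κ⌉₊ := one_le_pow₀ h1
    nlinarith

/-- Sub-polynomial bound for the logarithmic derivative of a zero-free `L`-function. -/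
lemma exists_norm_logDeriv_LFunction_le {N : ℕ} [NeZero N] {χ : DirichletCharacter ℂ N}
    (hχ : χ ≠ 1) (hz : ∀ s : ℂ, 1 / 2 < s.re → DirichletCharacter.LFunction χ s ≠ 0) {σ : ℝ}
    (hσ : 1 / 2 < σ) (hσ2 : σ ≤ 2) :
    ∃ A : ℝ, 0 < A ∧ ∀ s : ℂ, σ ≤ s.re → s.re ≤ 2 →
      ‖deriv (DirichletCharacter.LFunction χ) s / DirichletCharacter.LFunction χ s‖ ≤
        A * √(1 + |s.im|) := by
  obtain ⟨A, κ, B, hA, hκ, hB, h⟩ := zero_free_strip_bounds hχ hz hσ hσ2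
  refine ⟨B * (2 * √A) + 1, by positivity, fun s hs hs2 => (h s hs hs2).2.trans ?_⟩
  have h1 : Real.log (A * (1 + |s.im|)) ≤ 2 * √A * √(1 + |s.im|) := by
    have := Real.log_le_rpow_div (x := A * (1 + |s.im|)) (ε := 1 / 2) (by positivity) (by norm_num)
    rw [← Real.sqrt_eq_rpow, Real.sqrt_mul (by linarith)] at this
    linarith
  have := mul_le_mul_of_nonneg_left h1 hB
  nlinarith [Real.sqrt_nonneg (1 + |s.im|)]

lemma exists_norm_Gamma_le_mul_norm_Gamma_add {b : ℝ} (hb : 0 < b) {a : ℝ} (ha : 0 < a) :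
    ∃ K : ℝ, 0 < K ∧ ∀ u : ℂ, b ≤ u.re → ‖Gamma u‖ ≤ K * ‖Gamma (u + a)‖ := by
  have hG : 0 < Real.Gamma a := Real.Gamma_pos_of_pos ha
  have hint := (betaIntegral_convergent (u := b) (v := a) (by simpa) (by simpa)).norm
  set J := ∫ x in (0 : ℝ)..1, ‖(x : ℂ) ^ ((b : ℂ) - 1) * (1 - (x : ℂ)) ^ ((a : ℂ) - 1)‖
  have hJ : 0 ≤ J := intervalIntegral.integral_nonneg zero_le_one fun _ _ => norm_nonneg _
  refine ⟨(J + 1) / Real.Gamma a, by positivity, fun u hu => ?_⟩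
  have h1 := Complex.Gamma_mul_Gamma_eq_betaIntegral (s := u) (t := a) (by linarith) (by simpa)
  have h2 : ‖betaIntegral u a‖ ≤ J := by
    rw [betaIntegral]
    refine intervalIntegral.norm_integral_le_of_norm_le zero_le_one ?_ hint
    filter_upwards [MeasureTheory.Measure.ae_ne MeasureTheory.volume (1 : ℝ)] with x hx1 hx
    rw [norm_mul, norm_mul, norm_cpow_eq_rpow_re_of_pos hx.1, norm_cpow_eq_rpow_re_of_pos hx.1]
    gcongr ?_ * _
    exact Real.rpow_le_rpow_of_exponent_ge hx.1 hx.2 (by simpa using hu)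
  have h3 := congrArg norm h1
  rw [norm_mul, norm_mul, Gamma_ofReal, norm_real, Real.norm_of_nonneg hG.le] at h3
  have h4 : ‖Gamma u‖ = ‖Gamma (u + a)‖ * ‖betaIntegral u a‖ / Real.Gamma a := by
    rw [← h3]; field_simp
  rw [h4, div_mul_eq_mul_div, mul_comm]
  gcongr
  linarith

lemma exists_norm_Gammaℝ_le {b : ℝ} (hb : 0 < b) {a : ℝ} (ha : 0 < a) :
    ∃ K : ℝ, 0 < K ∧ ∀ u : ℂ, b ≤ u.re → ‖Gammaℝ u‖ ≤ K * ‖Gammaℝ (u + a)‖ := by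
  obtain ⟨K, hK, h⟩ := exists_norm_Gamma_le_mul_norm_Gamma_add (half_pos hb) (half_pos ha)
  refine ⟨K * Real.pi ^ (a / 2), by positivity, fun u hu => ?_⟩
  have h1 := h (u / 2) (by rw [div_ofNat_re]; linarith)
  rw [Gammaℝ_def, Gammaℝ_def, norm_mul, norm_mul, norm_cpow_eq_rpow_re_of_pos Real.pi_pos,
    norm_cpow_eq_rpow_re_of_pos Real.pi_pos]
  have h2 : (u + a) / 2 = u / 2 + ((a / 2 : ℝ) : ℂ) := by push_cast; ring
  have h3 : Real.pi ^ ((-u / 2).re) = Real.pi ^ (a / 2) * Real.pi ^ ((-(u + a) / 2).re) := by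
    rw [← Real.rpow_add Real.pi_pos]; congr 1; simp; ring
  rw [h2, h3]
  calc _ ≤ Real.pi ^ (a / 2) * Real.pi ^ ((-(u + a) / 2).re) * (K * ‖Gamma (u / 2 + ((a / 2 : ℝ) : ℂ))‖) := by
        gcongr
    _ = _ := by ring

lemma exists_norm_gammaFactor_le {N : ℕ} (χ : DirichletCharacter ℂ N) {b : ℝ} (hb : 0 < b) {a : ℝ}
    (ha : 0 < a) :
    ∃ K : ℝ, 0 < K ∧ ∀ u : ℂ, b ≤ u.re →
      ‖χ.gammaFactor u‖ ≤ K * ‖χ.gammaFactor (u + a)‖ := by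
  obtain ⟨K, hK, h⟩ := exists_norm_Gammaℝ_le hb ha
  refine ⟨K, hK, fun u hu => ?_⟩
  rcases χ.even_or_odd with hχ | hχ
  · rw [hχ.gammaFactor_def, hχ.gammaFactor_def]; exact h u hu
  · rw [hχ.gammaFactor_def, hχ.gammaFactor_def, add_right_comm]
    exact h _ (by simp; linarith)

lemma gammaFactor_ne_zero {N : ℕ} (χ : DirichletCharacter ℂ N) {s : ℂ} (hs : 0 < s.re) :
    χ.gammaFactor s ≠ 0 := by
  rcases χ.even_or_odd with hχ | hχ <;> rw [hχ.gammaFactor_def]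
  · exact Gammaℝ_ne_zero_of_re_pos hs
  · exact Gammaℝ_ne_zero_of_re_pos (by simp; linarith)

lemma completedLFunction_eq_mul {N : ℕ} [NeZero N] (χ : DirichletCharacter ℂ N) {s : ℂ}
    (hs : 0 < s.re) : χ.completedLFunction s = χ.LFunction s * χ.gammaFactor s := by
  rw [χ.LFunction_eq_completed_div_gammaFactor s (.inl (by rintro rfl; simp at hs)),
    div_mul_cancel₀ _ (gammaFactor_ne_zero χ hs)]

lemma Gammaℝ_conj (s : ℂ) : Gammaℝ (conj s) = conj (Gammaℝ s) := by
  rw [Gammaℝ_def, Gammaℝ_def, map_mul, ← Gamma_conj]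
  have hpi : ((Real.pi : ℝ) : ℂ).arg ≠ Real.pi := by
    rw [arg_ofReal_of_nonneg Real.pi_pos.le]; exact Real.pi_pos.ne
  have h := cpow_conj (Real.pi : ℂ) (-s / 2) hpi
  rw [conj_ofReal] at h
  rw [← h]
  simp [conj_ofNat]

lemma gammaFactor_conj {N : ℕ} (χ : DirichletCharacter ℂ N) (s : ℂ) :
    χ.gammaFactor (conj s) = conj (χ.gammaFactor s) := by
  rcases χ.even_or_odd with hχ | hχ <;> rw [hχ.gammaFactor_def, hχ.gammaFactor_def]
  · exact Gammaℝ_conj s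
  · rw [← Gammaℝ_conj, map_add, map_one]

/-- A character with `χ⁻¹ = χ` has real values. -/
lemma conj_apply_of_inv_eq {N : ℕ} [NeZero N] {χ : DirichletCharacter ℂ N} (hinv : χ⁻¹ = χ)
    (a : ZMod N) : conj (χ a) = χ a := by
  conv_rhs => rw [← hinv]
  rw [← MulChar.star_eq_inv]
  rfl

lemma LSeries_conj_of_inv_eq {N : ℕ} [NeZero N] {χ : DirichletCharacter ℂ N} (hinv : χ⁻¹ = χ)
    (s : ℂ) : LSeries (fun n => χ (n : ZMod N)) (conj s) =
      conj (LSeries (fun n => χ (n : ZMod N)) s) := by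
  rw [LSeries, LSeries, conj_tsum]
  congr 1 with n
  rw [LSeries.term_def, LSeries.term_def]
  split_ifs with hn
  · simp
  · rw [map_div₀, conj_apply_of_inv_eq hinv]
    congr 1
    have := cpow_conj (n : ℂ) s (by rw [natCast_arg]; exact Real.pi_pos.ne)
    rwa [conj_natCast] at this

lemma completedLFunction_conj {N : ℕ} [NeZero N] {χ : DirichletCharacter ℂ N} (hχ : χ ≠ 1)
    (hinv : χ⁻¹ = χ) (s : ℂ) :
    χ.completedLFunction (conj s) = conj (χ.completedLFunction s) := by
  have h1 := DirichletCharacter.differentiable_completedLFunction hχ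
  have h2 : Differentiable ℂ (fun s => conj (χ.completedLFunction (conj s))) := by
    intro s
    have := (h1 (conj s)).star_star
    rw [show star (conj s) = s from conj_conj s] at this
    exact this
  have h3 : (fun s => conj (χ.completedLFunction (conj s))) = χ.completedLFunction := by
    refine AnalyticOnNhd.eq_of_eventuallyEq (z₀ := 2) (fun s _ => h2.analyticAt s)
      (fun s _ => h1.analyticAt s) ?_
    filter_upwards [(isOpen_lt continuous_const continuous_re).mem_nhds
      (show (1 : ℝ) < (2 : ℂ).re by norm_num)] with s hs
    have hs : 1 < s.re := hs
    have hs' : 1 < (conj s).re := by simpa using hs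
    rw [completedLFunction_eq_mul χ (by linarith), completedLFunction_eq_mul χ (by linarith),
      χ.LFunction_eq_LSeries hs, χ.LFunction_eq_LSeries hs', gammaFactor_conj,
      LSeries_conj_of_inv_eq hinv]
    simp
  have := congrFun h3 (conj s)
  simp only [conj_conj] at this
  exact this.symm

/-- The completed L-function, normalised so that its modulus is symmetric about `Re s = 1 / 2`. -/
noncomputable def xi {N : ℕ} [NeZero N] (χ : DirichletCharacter ℂ N) (s : ℂ) : ℂ :=
  (N : ℂ) ^ (s / 2) * χ.completedLFunction s

section xi

variable {N : ℕ} [NeZero N] {χ : DirichletCharacter ℂ N}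

lemma differentiable_xi (hχ : χ ≠ 1) : Differentiable ℂ (xi χ) := by
  have hN : (N : ℂ) ≠ 0 := NeZero.ne _
  refine Differentiable.mul ?_ (DirichletCharacter.differentiable_completedLFunction hχ)
  exact fun s => (differentiableAt_id.div_const 2).const_cpow (.inl hN)

lemma norm_natCast_cpow' (s : ℂ) : ‖(N : ℂ) ^ s‖ = (N : ℝ) ^ s.re :=
  norm_natCast_cpow_of_pos (NeZero.pos N) s

lemma xi_eq_mul (s : ℂ) (hs : 0 < s.re) :
    xi χ s = (N : ℂ) ^ (s / 2) * (χ.LFunction s * χ.gammaFactor s) := by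
  rw [xi, completedLFunction_eq_mul χ hs]

lemma norm_xi (s : ℂ) (hs : 0 < s.re) :
    ‖xi χ s‖ = (N : ℝ) ^ (s.re / 2) * (‖χ.LFunction s‖ * ‖χ.gammaFactor s‖) := by
  rw [xi_eq_mul s hs, norm_mul, norm_mul, norm_natCast_cpow', div_ofNat_re]

lemma norm_rootNumber (hp : χ.IsPrimitive) (hinv : χ⁻¹ = χ) : ‖χ.rootNumber‖ = 1 := by
  have hN : (N : ℂ) ≠ 0 := NeZero.ne _
  have h1 := hp.completedLFunction_one_sub 2
  have h2 := hp.completedLFunction_one_sub (1 - 2)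
  rw [sub_sub_cancel, hinv, h1, hinv] at h2
  have h3 : χ.completedLFunction 2 ≠ 0 := by
    rw [completedLFunction_eq_mul χ (by norm_num)]
    refine mul_ne_zero (fun h => ?_) (gammaFactor_ne_zero χ (by norm_num))
    have := norm_LFunction_ge_of_two_le_re χ (s := 2) (by norm_num)
    rw [h] at this
    norm_num at this
  have h4 : (N : ℂ) ^ (1 - 2 - 1 / 2 : ℂ) * (N : ℂ) ^ (2 - 1 / 2 : ℂ) = 1 := by
    rw [← cpow_add _ _ hN]; norm_num
  have h5 : χ.rootNumber ^ 2 = 1 := by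
    apply mul_right_cancel₀ h3
    calc _ = ((N : ℂ) ^ (1 - 2 - 1 / 2 : ℂ) * (N : ℂ) ^ (2 - 1 / 2 : ℂ)) *
            (χ.rootNumber ^ 2 * χ.completedLFunction 2) := by rw [h4, one_mul]
      _ = _ := by rw [one_mul]; conv_rhs => rw [h2]
                  ring
  have h6 : ‖χ.rootNumber‖ ^ 2 = 1 := by rw [← norm_pow, h5, norm_one]
  exact (pow_eq_one_iff_of_nonneg (norm_nonneg _) two_ne_zero).mp h6

lemma norm_xi_one_sub (hp : χ.IsPrimitive) (hinv : χ⁻¹ = χ) (s : ℂ) :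
    ‖xi χ (1 - s)‖ = ‖xi χ s‖ := by
  have hN : (0 : ℝ) < N := Nat.cast_pos.mpr (NeZero.pos N)
  rw [xi, xi, hp.completedLFunction_one_sub, hinv, norm_mul, norm_mul, norm_mul, norm_mul,
    norm_rootNumber hp hinv, norm_natCast_cpow', norm_natCast_cpow', norm_natCast_cpow', mul_one,
    ← mul_assoc, ← Real.rpow_add hN]
  congr 2
  simp
  ring

lemma norm_xi_conj (hχ : χ ≠ 1) (hinv : χ⁻¹ = χ) (s : ℂ) : ‖xi χ (conj s)‖ = ‖xi χ s‖ := by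
  rw [xi, xi, completedLFunction_conj hχ hinv, norm_mul, norm_mul, norm_natCast_cpow',
    norm_natCast_cpow', norm_conj]
  simp

lemma xi_ne_zero (hz : ∀ s : ℂ, 1 / 2 < s.re → DirichletCharacter.LFunction χ s ≠ 0) {s : ℂ}
    (hs : 1 / 2 < s.re) : xi χ s ≠ 0 := by
  have hN : (N : ℂ) ≠ 0 := NeZero.ne _
  have hs0 : 0 < s.re := by linarith
  rw [xi_eq_mul s hs0]
  exact mul_ne_zero (by simp [cpow_eq_zero_iff, hN])
    (mul_ne_zero (hz s hs) (gammaFactor_ne_zero χ hs0))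

/-- Moving away from the critical line horizontally does not decrease the completed L-function. -/
lemma norm_xi_sub_le (hχ : χ ≠ 1) (hp : χ.IsPrimitive) (hinv : χ⁻¹ = χ)
    (hz : ∀ s : ℂ, 1 / 2 < s.re → DirichletCharacter.LFunction χ s ≠ 0) {a : ℝ} (ha : 0 < a)
    (ha4 : a < 1 / 4) {s : ℂ} (hs : 1 / 2 ≤ s.re) :
    ‖xi χ (s - a)‖ ≤ ‖xi χ (s + a)‖ := by
  have hN : (1 : ℝ) ≤ N := Nat.one_le_cast.mpr (NeZero.pos N)
  obtain ⟨A, hA, hL⟩ := exists_norm_LFunction_le hχ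
  obtain ⟨A', k, hA', hL'⟩ := exists_inv_norm_LFunction_le hχ hz (σ := 1 / 2 + a) (by linarith)
    (by linarith)
  obtain ⟨K, hK, hγ⟩ := exists_norm_gammaFactor_le χ (b := 1 / 4) (by norm_num)
    (a := 2 * a) (by linarith)
  set F : ℂ → ℂ := fun z => xi χ (1 / 2 + z - a) / xi χ (1 / 2 + z + a)
  have hne : ∀ z : ℂ, 0 ≤ z.re → xi χ (1 / 2 + z + a) ≠ 0 := fun z h =>
    xi_ne_zero hz (by simp; linarith)
  have hratio : ∀ z : ℂ, 0 ≤ z.re → ‖F z‖ ≤ K *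
      (‖χ.LFunction (1 / 2 + z - a)‖ * ‖χ.LFunction (1 / 2 + z + a)‖⁻¹) := by
    intro z h
    have h1 : 0 < (1 / 2 + z - a).re := by simp; linarith
    have h2 : 1 / 2 < (1 / 2 + z + a).re := by simp; linarith
    have h3 := hγ (1 / 2 + z - a) (by simp; linarith)
    have h4 : 1 / 2 + z - a + ((2 * a : ℝ) : ℂ) = 1 / 2 + z + a := by push_cast; ring
    rw [h4] at h3
    have hg : 0 < ‖χ.gammaFactor (1 / 2 + z + a)‖ :=
      norm_pos_iff.mpr (gammaFactor_ne_zero χ (by linarith))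
    have hl : 0 < ‖χ.LFunction (1 / 2 + z + a)‖ := norm_pos_iff.mpr (hz _ h2)
    simp only [F]
    rw [norm_div, norm_xi _ h1, norm_xi _ (by linarith), div_le_iff₀ (by positivity)]
    have h5 : (N : ℝ) ^ ((1 / 2 + z - a).re / 2) ≤ (N : ℝ) ^ ((1 / 2 + z + a).re / 2) := by
      apply Real.rpow_le_rpow_of_exponent_le hN
      simp; linarith
    calc _ ≤ (N : ℝ) ^ ((1 / 2 + z + a).re / 2) * (‖χ.LFunction (1 / 2 + z - a)‖ *
          (K * ‖χ.gammaFactor (1 / 2 + z + a)‖)) := by gcongr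
      _ = _ := by
        linear_combination (-(K * ‖χ.LFunction (1 / 2 + z - a)‖ *
          (N : ℝ) ^ ((1 / 2 + z + a).re / 2) * ‖χ.gammaFactor (1 / 2 + z + a)‖)) *
            inv_mul_cancel₀ hl.ne'
  have key := PhragmenLindelof.right_half_plane_of_bounded_on_real (f := F) (C := 1) (z := s - 1 / 2)
    ?_ ?_ ?_ ?_ (by simp; linarith)
  · have h0 : (1 / 2 : ℂ) + (s - 1 / 2) = s := by ring
    have h1 := hne (s - 1 / 2) (by simp; linarith)
    simp only [F] at key
    rw [h0] at key h1
    rw [norm_div, div_le_one (norm_pos_iff.mpr h1)] at key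
    exact key
  · apply DifferentiableOn.diffContOnCl
    have hcl : closure {z : ℂ | 0 < z.re} = {z | 0 ≤ z.re} := Complex.closure_setOfPred_lt_re 0
    rw [hcl]
    intro z h
    have hd := differentiable_xi hχ
    refine DifferentiableAt.differentiableWithinAt ?_
    refine DifferentiableAt.div ?_ ?_ (hne z h)
    · exact (hd _).comp z (by fun_prop)
    · exact (hd _).comp z (by fun_prop)
  · refine ⟨1, by norm_num, k + 1, ?_⟩
    refine Asymptotics.IsBigO.of_bound (K * (A * A') * Real.exp (k + 1)) ?_
    filter_upwards [mem_inf_of_right (mem_principal_self _)] with z hzr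
    have hzr : 0 < z.re := hzr
    refine (hratio z hzr.le).trans ?_
    have h1 := hL (1 / 2 + z - a) (by simp; linarith)
    have h2 := hL' (1 / 2 + z + a) (by simp; linarith)
    have ha' : ‖(a : ℂ)‖ ≤ 1 / 4 := by rw [norm_real, Real.norm_of_nonneg ha.le]; exact ha4.le
    have hh : ‖(1 / 2 : ℂ)‖ = 1 / 2 := by norm_num
    have h3 : ‖1 / 2 + z - a‖ ≤ 2 + ‖z‖ := by
      have := norm_sub_le (1 / 2 + z) (a : ℂ)
      have := norm_add_le (1 / 2) z
      linarith
    have h4 : 1 + ‖1 / 2 + z + a‖ ≤ 2 + ‖z‖ := by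
      have := norm_add_le (1 / 2 + z) (a : ℂ)
      have := norm_add_le (1 / 2) z
      linarith
    have h5 : 2 + ‖z‖ ≤ Real.exp (1 + ‖z‖) := by
      have := Real.add_one_le_exp (1 + ‖z‖); linarith
    have h6 : (2 + ‖z‖) ^ (k + 1) ≤ Real.exp (k + 1) * Real.exp ((k + 1) * ‖z‖) := by
      calc _ ≤ (Real.exp (1 + ‖z‖)) ^ (k + 1) := by gcongr
        _ = _ := by rw [← Real.exp_nat_mul, ← Real.exp_add]; congr 1; push_cast; ring
    rw [Real.norm_of_nonneg (Real.exp_pos _).le, Real.rpow_one]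
    calc K * (‖χ.LFunction (1 / 2 + z - a)‖ * ‖χ.LFunction (1 / 2 + z + a)‖⁻¹)
        ≤ K * ((A * (2 + ‖z‖)) * (A' * (2 + ‖z‖) ^ k)) := by
          gcongr
          · exact h1.trans (by gcongr)
          · exact h2.trans (by gcongr)
      _ = K * (A * A') * (2 + ‖z‖) ^ (k + 1) := by ring
      _ ≤ K * (A * A') * (Real.exp (k + 1) * Real.exp ((k + 1) * ‖z‖)) := by gcongr
      _ = _ := by ring
  · refine ⟨K * (2 * 4), ?_⟩
    rw [eventually_map]
    filter_upwards [eventually_ge_atTop 2] with x hx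
    refine (hratio x (by simpa using by linarith)).trans ?_
    gcongr
    · exact norm_LFunction_le_of_two_le_re χ (by simp; linarith)
    · have := norm_LFunction_ge_of_two_le_re χ (s := 1 / 2 + x + a) (by simp; linarith)
      rw [show (4 : ℝ) = (1 / 4)⁻¹ by norm_num]
      gcongr
  · intro t
    have h1 := hne (t * I) (by simp)
    simp only [F]
    rw [norm_div, div_le_one (norm_pos_iff.mpr h1), ← norm_xi_one_sub hp hinv,
      ← norm_xi_conj hχ hinv]
    refine le_of_eq (congrArg (fun w => ‖xi χ w‖) ?_)
    simp [map_ofNat]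
    ring

lemma nonneg_of_hasDerivAt_of_nonneg {φ : ℝ → ℝ} {d δ : ℝ} (hδ : 0 < δ) (h : HasDerivAt φ d 0)
    (h0 : φ 0 = 0) (hφ : ∀ a, 0 < a → a < δ → 0 ≤ φ a) : 0 ≤ d := by
  have h1 := (hasDerivAt_iff_tendsto_slope.mp h).mono_left
    (nhdsWithin_mono 0 (fun x (hx : x ∈ Ioi 0) => (ne_of_gt hx : x ≠ 0)))
  refine ge_of_tendsto h1 ?_
  filter_upwards [Ioo_mem_nhdsGT hδ] with a ha
  rw [slope_def_field, h0, sub_zero, sub_zero]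
  exact div_nonneg (hφ a ha.1 ha.2) ha.1.le

lemma re_logDeriv_xi_nonneg (hχ : χ ≠ 1) (hp : χ.IsPrimitive) (hinv : χ⁻¹ = χ)
    (hz : ∀ s : ℂ, 1 / 2 < s.re → DirichletCharacter.LFunction χ s ≠ 0) {s : ℂ}
    (hs : 1 / 2 < s.re) : 0 ≤ (logDeriv (xi χ) s).re := by
  have hd := differentiable_xi hχ
  have hpos : HasDerivAt (fun u : ℝ => xi χ (s + u)) (deriv (xi χ) s) 0 := by
    have := HasDerivAt.comp_const_add s 0 (by simpa only [add_zero] using (hd s).hasDerivAt)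
    exact HasDerivAt.comp_ofReal (z := 0) (by simpa using this)
  have hneg : HasDerivAt (fun u : ℝ => xi χ (s - u)) (-deriv (xi χ) s) 0 := by
    have := HasDerivAt.comp_const_sub s 0 (by simpa only [sub_zero] using (hd s).hasDerivAt)
    exact HasDerivAt.comp_ofReal (z := 0) (by simpa only [ofReal_zero] using this)
  have h1 := hpos.norm_sq
  have h2 := hneg.norm_sq
  have h3 := h1.sub h2
  have key := nonneg_of_hasDerivAt_of_nonneg (δ := 1 / 4) (by norm_num) h3 (by simp) ?_
  · have hne := xi_ne_zero hz hs
    rw [logDeriv_apply, div_re, ← add_div]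
    apply div_nonneg _ (normSq_nonneg _)
    simp [Complex.inner] at key
    nlinarith
  · intro a h0 h4
    have := norm_xi_sub_le hχ hp hinv hz h0 h4 hs.le
    simp only [Pi.sub_apply, sub_nonneg]
    gcongr

lemma differentiableAt_gammaFactor {N : ℕ} {χ : DirichletCharacter ℂ N} (s : ℂ) (hs : 0 < s.re) :
    DifferentiableAt ℂ χ.gammaFactor s := by
  have h : ∀ u : ℂ, 0 < u.re → DifferentiableAt ℂ Gammaℝ u := by
    intro u hu
    have h1 : DifferentiableAt ℂ Gamma (u / 2) := differentiableAt_Gamma _ (fun m hm => by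
      have := congrArg re hm
      simp at this
      have : (0 : ℝ) ≤ m := Nat.cast_nonneg m
      linarith)
    have h2 : Gammaℝ = fun u : ℂ => (Real.pi : ℂ) ^ (-u / 2) * Gamma (u / 2) := by
      ext; rw [Gammaℝ_def]
    rw [h2]
    refine DifferentiableAt.mul ?_ (h1.comp u (by fun_prop))
    exact DifferentiableAt.const_cpow (by fun_prop) (.inl (by exact_mod_cast Real.pi_ne_zero))
  rcases χ.even_or_odd with hχ | hχ
  · rw [show χ.gammaFactor = Gammaℝ from funext fun s => hχ.gammaFactor_def s]
    exact h s hs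
  · rw [show χ.gammaFactor = fun s => Gammaℝ (s + 1) from funext fun s => hχ.gammaFactor_def s]
    have h1 := h (s + 1) (by simp; linarith)
    exact h1.comp s (f := fun s => s + 1) (by fun_prop)

lemma logDeriv_xi (hχ : χ ≠ 1)
    (hz : ∀ s : ℂ, 1 / 2 < s.re → DirichletCharacter.LFunction χ s ≠ 0) {s : ℂ}
    (hs : 1 / 2 < s.re) : logDeriv (xi χ) s =
      Real.log N / 2 + (logDeriv χ.LFunction s + logDeriv χ.gammaFactor s) := by
  have hN : (N : ℂ) ≠ 0 := NeZero.ne _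
  have hs0 : 0 < s.re := by linarith
  have hev : xi χ =ᶠ[𝓝 s] fun s => (N : ℂ) ^ (s / 2) * (χ.LFunction s * χ.gammaFactor s) := by
    filter_upwards [(isOpen_lt continuous_const continuous_re).mem_nhds hs0] with u hu
    exact xi_eq_mul u hu
  have h1 : HasDerivAt (fun s : ℂ => (N : ℂ) ^ (s / 2)) ((N : ℂ) ^ (s / 2) * log N * (1 / 2)) s :=
    ((hasDerivAt_id s).div_const 2).const_cpow (.inl hN)
  have h2 : (N : ℂ) ^ (s / 2) ≠ 0 := by simp [cpow_eq_zero_iff, hN]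
  have hg := gammaFactor_ne_zero χ hs0
  have hdL := (DirichletCharacter.differentiable_LFunction hχ) s
  have hdg := differentiableAt_gammaFactor (χ := χ) s hs0
  have h3 : logDeriv (xi χ) s = logDeriv (fun s => (N : ℂ) ^ (s / 2) *
      (χ.LFunction s * χ.gammaFactor s)) s := by
    rw [logDeriv_apply, logDeriv_apply, hev.deriv_eq, hev.eq_of_nhds]
  rw [h3, logDeriv_mul (g := fun s => χ.LFunction s * χ.gammaFactor s) s h2
    (mul_ne_zero (hz s hs) hg) h1.differentiableAt (hdL.mul hdg),
    logDeriv_mul s (hz s hs) hg hdL hdg]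
  congr 1
  rw [logDeriv_apply, h1.deriv, natCast_log]
  field_simp

end xi

lemma exists_norm_Gamma_le_mul_norm_Gamma_add_near_one :
    ∃ K : ℝ, 1 ≤ K ∧ ∀ z u : ℂ, 1 / 4 ≤ z.re → ‖u - 1‖ ≤ 1 / 2 →
      ‖Gamma z‖ ≤ K * ‖Gamma (z + u)‖ := by
  obtain ⟨G, hG⟩ := (isCompact_closedBall (1 : ℂ) (1 / 2)).exists_bound_of_continuousOn
    differentiable_one_div_Gamma.continuous.continuousOn
  have hint := (betaIntegral_convergent (u := (1 / 4 : ℝ)) (v := (1 / 2 : ℝ))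
    (by rw [ofReal_re]; norm_num) (by rw [ofReal_re]; norm_num)).norm
  set J := ∫ x in (0 : ℝ)..1, ‖(x : ℂ) ^ (((1 / 4 : ℝ) : ℂ) - 1) *
    (1 - (x : ℂ)) ^ (((1 / 2 : ℝ) : ℂ) - 1)‖
  have hJ : 0 ≤ J := intervalIntegral.integral_nonneg zero_le_one fun _ _ => norm_nonneg _
  have hG0 : 0 ≤ G := (norm_nonneg _).trans (hG 1 (by simp))
  refine ⟨J * G + 1, by nlinarith [mul_nonneg hJ hG0], fun z u hz hu => ?_⟩
  have hure : 1 / 2 ≤ u.re := by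
    have := (abs_re_le_norm (u - 1)).trans hu
    rw [sub_re, one_re, abs_le] at this
    linarith
  have h1 := Complex.Gamma_mul_Gamma_eq_betaIntegral (s := z) (t := u) (by linarith) (by linarith)
  have h2 : ‖betaIntegral z u‖ ≤ J := by
    rw [betaIntegral]
    refine intervalIntegral.norm_integral_le_of_norm_le zero_le_one ?_ hint
    filter_upwards [MeasureTheory.Measure.ae_ne MeasureTheory.volume (1 : ℝ)] with x hx1 hx
    have hx2 : 0 < 1 - x := by
      have := hx.2
      rw [sub_pos]
      exact lt_of_le_of_ne this hx1
    have e : (1 : ℂ) - x = ((1 - x : ℝ) : ℂ) := by push_cast; rfl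
    rw [norm_mul, norm_mul, norm_cpow_eq_rpow_re_of_pos hx.1, norm_cpow_eq_rpow_re_of_pos hx.1, e,
      norm_cpow_eq_rpow_re_of_pos hx2, norm_cpow_eq_rpow_re_of_pos hx2]
    refine mul_le_mul ?_ ?_ (by positivity) (Real.rpow_nonneg hx.1.le _)
    · exact Real.rpow_le_rpow_of_exponent_ge hx.1 hx.2 (by simpa using hz)
    · exact Real.rpow_le_rpow_of_exponent_ge hx2 (by linarith [hx.1]) (by simpa using hure)
  have h3 : Gamma u ≠ 0 := Gamma_ne_zero_of_re_pos (by linarith)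
  have h4 : ‖Gamma z‖ = ‖Gamma (z + u)‖ * ‖betaIntegral z u‖ * ‖(Gamma u)⁻¹‖ := by
    rw [← norm_mul, ← norm_mul, ← h1, mul_assoc, mul_inv_cancel₀ h3, mul_one]
  have h5 : ‖(Gamma u)⁻¹‖ ≤ G := hG u (by simpa [dist_eq] using hu)
  calc ‖Gamma z‖ ≤ ‖Gamma (z + u)‖ * J * G := by rw [h4]; gcongr
    _ ≤ _ := by nlinarith [norm_nonneg (Gamma (z + u))]

/-- The digamma function grows at most logarithmically in the strip `1 / 4 ≤ Re z ≤ 1`. -/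
lemma exists_norm_digamma_le :
    ∃ C : ℝ, 0 < C ∧ ∀ z : ℂ, 1 / 4 ≤ z.re → z.re ≤ 1 →
      ‖digamma z‖ ≤ C * Real.log (2 + |z.im|) := by
  obtain ⟨K, hK, h⟩ := exists_norm_Gamma_le_mul_norm_Gamma_add_near_one
  have hl2 : 0 < Real.log 2 := Real.log_pos one_lt_two
  have hlK : 0 ≤ Real.log K := Real.log_nonneg hK
  refine ⟨16 * (Real.log K / Real.log 2 + 1) + 4 / Real.log 2, by positivity,
    fun z hz hz1 => ?_⟩
  have hz0 : z ≠ 0 := by rintro rfl; norm_num at hz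
  have hre : ∀ w ∈ ball (z + 1) (1 / 2), 0 < w.re := by
    intro w hw
    rw [mem_ball, dist_eq] at hw
    have := (abs_re_le_norm _).trans hw.le
    rw [sub_re, add_re, one_re, abs_le] at this
    linarith
  have hM : 1 < K * (2 + |z.im|) := by nlinarith [abs_nonneg z.im]
  have key := (log_bound_of_zero_free (f := fun w => (Gamma w)⁻¹) (c := z + 1) (r := 0)
    (R := 1 / 2) (M := K * (2 + |z.im|)) le_rfl (by norm_num)
    differentiable_one_div_Gamma.differentiableOn
    (fun w hw => inv_ne_zero (Gamma_ne_zero_of_re_pos (hre w hw))) hM ?_ (z := z + 1)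
    (by simp)).2
  · have hd : DifferentiableAt ℂ Gamma (z + 1) := differentiableAt_Gamma _ (fun m hm => by
      have := congrArg re hm
      simp at this
      have : (0 : ℝ) ≤ m := Nat.cast_nonneg m
      linarith)
    have hg1 : Gamma (z + 1) ≠ 0 := Gamma_ne_zero_of_re_pos (by simp; linarith)
    have e : deriv (fun w => (Gamma w)⁻¹) (z + 1) / (Gamma (z + 1))⁻¹ = -digamma (z + 1) := by
      rw [digamma_def, logDeriv_apply, (hd.hasDerivAt.fun_inv hg1).deriv]
      field_simp
    rw [e, norm_neg, digamma_apply_add_one] at key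
    · have h1 : ‖digamma z‖ ≤ ‖digamma z + z⁻¹‖ + ‖z⁻¹‖ := by
        have := norm_sub_le (digamma z + z⁻¹) z⁻¹
        rwa [add_sub_cancel_right] at this
      have h2 : ‖z⁻¹‖ ≤ 4 := by
        rw [norm_inv, inv_le_comm₀ (norm_pos_iff.mpr hz0) (by norm_num)]
        have := re_le_norm z
        linarith
      have h3 : Real.log 2 ≤ Real.log (2 + |z.im|) :=
        Real.log_le_log two_pos (by linarith [abs_nonneg z.im])
      rw [Real.log_mul (by positivity) (by positivity)] at key
      have h4 : Real.log K ≤ Real.log K / Real.log 2 * Real.log (2 + |z.im|) := by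
        rw [div_mul_eq_mul_div, le_div_iff₀ hl2]
        gcongr
      have h5 : 4 ≤ 4 / Real.log 2 * Real.log (2 + |z.im|) := by
        rw [div_mul_eq_mul_div, le_div_iff₀ hl2]
        gcongr
      calc _ ≤ 16 * (Real.log K + Real.log (2 + |z.im|)) + 4 := by
            refine h1.trans (add_le_add (key.trans (le_of_eq ?_)) h2)
            norm_num
        _ ≤ _ := by linarith
    · intro m hm
      have := congrArg re hm
      simp at this
      have : (0 : ℝ) ≤ m := Nat.cast_nonneg m
      linarith
  · intro w hw
    have h1 := h z (w - z) hz (by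
      rw [mem_ball, dist_eq] at hw
      rw [sub_sub]; exact hw.le)
    rw [add_sub_cancel] at h1
    have hw0 := norm_pos_iff.mpr (Gamma_ne_zero_of_re_pos (hre w hw))
    have hz1 : 0 < ‖Gamma (z + 1)‖ := norm_pos_iff.mpr
      (Gamma_ne_zero_of_re_pos (by simp; linarith))
    rw [norm_inv, norm_inv, ← div_eq_mul_inv, inv_eq_one_div, div_le_div_iff₀ hw0 hz1, one_mul,
      Gamma_add_one z hz0, norm_mul]
    have h2 : ‖z‖ ≤ 2 + |z.im| := by
      have := norm_le_abs_re_add_abs_im z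
      rw [abs_of_nonneg (by linarith : 0 ≤ z.re)] at this
      linarith
    calc _ ≤ (2 + |z.im|) * (K * ‖Gamma w‖) := by gcongr
      _ = _ := by ring

lemma logDeriv_Gammaℝ (s : ℂ) (hs : 0 < s.re) :
    logDeriv Gammaℝ s = -(Real.log Real.pi : ℂ) / 2 + digamma (s / 2) / 2 := by
  have hpi : (Real.pi : ℂ) ≠ 0 := by exact_mod_cast Real.pi_ne_zero
  have hd : DifferentiableAt ℂ Gamma (s / 2) := differentiableAt_Gamma _ (fun m hm => by
    have := congrArg re hm
    simp at this
    have : (0 : ℝ) ≤ m := Nat.cast_nonneg m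
    linarith)
  have h2 : Gammaℝ = fun u : ℂ => (Real.pi : ℂ) ^ (-u / 2) * Gamma (u / 2) := by
    ext; rw [Gammaℝ_def]
  have h3 : HasDerivAt (fun u : ℂ => (Real.pi : ℂ) ^ (-u / 2))
      ((Real.pi : ℂ) ^ (-s / 2) * log Real.pi * (-1 / 2)) s :=
    ((hasDerivAt_id s).neg.div_const 2).const_cpow (.inl hpi)
  have h4 : HasDerivAt (fun u : ℂ => Gamma (u / 2)) (deriv Gamma (s / 2) * (1 / 2)) s :=
    HasDerivAt.comp s hd.hasDerivAt ((hasDerivAt_id s).div_const 2)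
  have h5 : (Real.pi : ℂ) ^ (-s / 2) ≠ 0 := by simp [cpow_eq_zero_iff, hpi]
  have h6 : Gamma (s / 2) ≠ 0 := Gamma_ne_zero_of_re_pos (by simp; linarith)
  rw [h2, logDeriv_mul s h5 h6 h3.differentiableAt h4.differentiableAt, logDeriv_apply,
    logDeriv_apply, h3.deriv, h4.deriv, digamma_def, logDeriv_apply, ofReal_log Real.pi_pos.le]
  field_simp

lemma exists_norm_logDeriv_gammaFactor_le :
    ∃ C : ℝ, 0 < C ∧ ∀ (N : ℕ) (χ : DirichletCharacter ℂ N) (s : ℂ), 1 / 2 ≤ s.re → s.re ≤ 1 →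
      ‖logDeriv χ.gammaFactor s‖ ≤ C * Real.log (2 + |s.im|) := by
  obtain ⟨C, hC, h⟩ := exists_norm_digamma_le
  have hl2 : 0 < Real.log 2 := Real.log_pos one_lt_two
  have hlpi : 0 < Real.log Real.pi := Real.log_pos (by linarith [Real.pi_gt_three])
  have key : ∀ s : ℂ, 1 / 2 ≤ s.re → s.re ≤ 2 →
      ‖logDeriv Gammaℝ s‖ ≤ (Real.log Real.pi / Real.log 2 + C) * Real.log (2 + |s.im|) := by
    intro s h1 h2
    rw [logDeriv_Gammaℝ s (by linarith)]
    have h3 := h (s / 2) (by simp; linarith) (by simp; linarith)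
    have h4 : Real.log (2 + |(s / 2).im|) ≤ Real.log (2 + |s.im|) := by
      apply Real.log_le_log (by positivity)
      rw [div_ofNat_im, abs_div]
      norm_num
    have h5 : Real.log 2 ≤ Real.log (2 + |s.im|) :=
        Real.log_le_log two_pos (by linarith [abs_nonneg s.im])
    have h6 : Real.log Real.pi ≤ Real.log Real.pi / Real.log 2 * Real.log (2 + |s.im|) := by
      rw [div_mul_eq_mul_div, le_div_iff₀ hl2]
      gcongr
    have h7 : ‖-(Real.log Real.pi : ℂ) / 2‖ = Real.log Real.pi / 2 := by
      rw [norm_div, norm_neg, norm_real, Real.norm_of_nonneg hlpi.le]; norm_num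
    have h8 : ‖digamma (s / 2) / 2‖ ≤ C * Real.log (2 + |s.im|) / 2 := by
      rw [norm_div]
      norm_num
      have := mul_le_mul_of_nonneg_left h4 hC.le
      linarith
    refine (norm_add_le _ _).trans ?_
    have : 0 ≤ C * Real.log (2 + |s.im|) := mul_nonneg hC.le (hl2.le.trans h5)
    rw [h7]
    linarith
  refine ⟨Real.log Real.pi / Real.log 2 + C, by have := div_pos hlpi hl2; linarith, fun N χ s h1 h2 => ?_⟩
  rcases χ.even_or_odd with hχ | hχ
  · rw [show χ.gammaFactor = Gammaℝ from funext fun s => hχ.gammaFactor_def s]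
    exact key s h1 (by linarith)
  · rw [show χ.gammaFactor = fun s => Gammaℝ (s + 1) from funext fun s => hχ.gammaFactor_def s]
    have e : logDeriv (fun s => Gammaℝ (s + 1)) s = logDeriv Gammaℝ (s + 1) := by
      rw [logDeriv_apply, logDeriv_apply, deriv_comp_add_const]
    rw [e]
    simpa using key (s + 1) (by simp; linarith) (by simp; linarith)

lemma integrable_one_add_sq_rpow : Integrable (fun t : ℝ => (1 + t ^ 2) ^ (-(3 / 4) : ℝ)) := by
  have := integrable_rpow_neg_one_add_norm_sq (E := ℝ) (μ := volume) (r := 3 / 2) (by norm_num)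
  convert this using 2 with t
  rw [Real.norm_eq_abs, sq_abs]
  norm_num

lemma continuous_vertical {G : ℂ → ℂ} {a : ℝ}
    (hd : ∀ s : ℂ, s.re = a → DifferentiableAt ℂ G s) : Continuous (fun t : ℝ => G (a + t * I)) := by
  rw [continuous_iff_continuousAt]
  intro t
  exact ContinuousAt.comp (f := fun t : ℝ => (a + t * I : ℂ)) (hd _ (by simp)).continuousAt
    (by fun_prop)

lemma integrable_vertical {G : ℂ → ℂ} {a C : ℝ}
    (hd : ∀ s : ℂ, s.re = a → DifferentiableAt ℂ G s)
    (hb : ∀ s : ℂ, s.re = a → ‖G s‖ ≤ C * (1 + s.im ^ 2) ^ (-(3 / 4) : ℝ)) :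
    Integrable (fun t : ℝ => G (a + t * I)) := by
  refine (integrable_one_add_sq_rpow.const_mul C).mono'
    (continuous_vertical hd).aestronglyMeasurable (Eventually.of_forall fun t => ?_)
  simpa using hb (a + t * I) (by simp)

/-- Shifting a vertical line of integration. -/
lemma integral_vertical_eq {G : ℂ → ℂ} {a b C : ℝ} (hab : a ≤ b)
    (hd : ∀ s : ℂ, a ≤ s.re → s.re ≤ b → DifferentiableAt ℂ G s)
    (hb : ∀ s : ℂ, a ≤ s.re → s.re ≤ b → ‖G s‖ ≤ C * (1 + s.im ^ 2) ^ (-(3 / 4) : ℝ)) :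
    ∫ t : ℝ, G (a + t * I) = ∫ t : ℝ, G (b + t * I) := by
  have ha' : Integrable (fun t : ℝ => G (a + t * I)) :=
    integrable_vertical (fun s hs => hd s hs.ge (hs.trans_le hab))
      (fun s hs => hb s hs.ge (hs.trans_le hab))
  have hb' : Integrable (fun t : ℝ => G (b + t * I)) :=
    integrable_vertical (fun s hs => hd s (hab.trans hs.ge) hs.le)
      (fun s hs => hb s (hab.trans hs.ge) hs.le)
  have hlim := (intervalIntegral_tendsto_integral hb' tendsto_neg_atTop_atBot tendsto_id).sub
    (intervalIntegral_tendsto_integral ha' tendsto_neg_atTop_atBot tendsto_id)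
  have hhor : ∀ T : ℝ, ‖∫ x : ℝ in a..b, G (x + T * I)‖ ≤
      C * (1 + T ^ 2) ^ (-(3 / 4) : ℝ) * |b - a| := by
    intro T
    refine intervalIntegral.norm_integral_le_of_norm_le_const fun x hx => ?_
    rw [uIoc_of_le hab] at hx
    simpa using hb (x + T * I) (by simpa using hx.1.le) (by simpa using hx.2)
  have hzero : Tendsto (fun T : ℝ => C * (1 + T ^ 2) ^ (-(3 / 4) : ℝ) * |b - a| +
      C * (1 + T ^ 2) ^ (-(3 / 4) : ℝ) * |b - a|) atTop (𝓝 0) := by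
    have h1 : Tendsto (fun T : ℝ => (1 + T ^ 2) ^ (-(3 / 4) : ℝ)) atTop (𝓝 0) :=
      (tendsto_rpow_neg_atTop (by norm_num)).comp
        (tendsto_atTop_add_const_left _ _ (tendsto_pow_atTop two_ne_zero))
    have h2 := (h1.const_mul C).mul_const |b - a|
    simpa using h2.add h2
  have heq : ∀ T : ℝ, ‖(∫ t in (-T)..T, G (b + t * I)) - ∫ t in (-T)..T, G (a + t * I)‖ ≤
      C * (1 + T ^ 2) ^ (-(3 / 4) : ℝ) * |b - a| + C * (1 + T ^ 2) ^ (-(3 / 4) : ℝ) * |b - a| := by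
    intro T
    have h := integral_boundary_rect_eq_zero_of_differentiableOn G (a + (-T : ℝ) * I) (b + T * I) ?_
    · simp only [add_re, ofReal_re, mul_re, I_re, mul_zero, ofReal_im, I_im, mul_one, sub_self,
        add_zero, add_im, mul_im, zero_add] at h
      have h1 : I • ((∫ t in (-T)..T, G (b + t * I)) - ∫ t in (-T)..T, G (a + t * I)) =
          (∫ x : ℝ in a..b, G (x + T * I)) - ∫ x : ℝ in a..b, G (x + (-T : ℝ) * I) := by
        rw [smul_sub]
        linear_combination h
      have h2 := congrArg norm h1
      rw [norm_smul, norm_I, one_mul] at h2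
      rw [h2]
      refine (norm_sub_le _ _).trans (add_le_add (hhor T) ?_)
      simpa using hhor (-T)
    · intro s hs
      simp only [add_re, ofReal_re, mul_re, I_re, mul_zero, ofReal_im, I_im, mul_one, sub_self,
        add_zero, add_im, mul_im, zero_add, mem_reProdIm, uIcc_of_le hab] at hs
      exact (hd s hs.1.1 hs.1.2).differentiableWithinAt
  have h0 := squeeze_zero_norm heq hzero
  have := tendsto_nhds_unique hlim h0
  exact (sub_eq_zero.mp this).symm

section explicit

variable {N : ℕ} [NeZero N] {χ : DirichletCharacter ℂ N}

lemma neg_logDeriv_LFunction_hasSum {s : ℂ} (hs : 1 < s.re) :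
    HasSum (fun n : ℕ => χ (n : ZMod N) * (ArithmeticFunction.vonMangoldt n : ℂ) * (n : ℂ) ^ (-s))
      (-logDeriv χ.LFunction s) := by
  have h1 := (DirichletCharacter.LSeriesSummable_twist_vonMangoldt χ hs).hasSum
  have h2 := DirichletCharacter.LSeries_twist_vonMangoldt_eq χ hs
  rw [LSeries] at h2
  rw [h2] at h1
  rw [logDeriv_apply, χ.LFunction_eq_LSeries hs, χ.deriv_LFunction_eq_deriv_LSeries hs, ← neg_div]
  convert h1 using 2 with n
  rw [LSeries.term_def]
  split_ifs with hn
  · simp [hn]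
  · rw [cpow_neg, Pi.mul_apply, div_eq_mul_inv]

lemma differentiableAt_logDeriv_LFunction (hχ : χ ≠ 1) {s : ℂ} (hs : χ.LFunction s ≠ 0) :
    DifferentiableAt ℂ (logDeriv χ.LFunction) s := by
  have h1 := DirichletCharacter.differentiable_LFunction hχ
  have h2 : Differentiable ℂ (deriv χ.LFunction) := fun s =>
    (h1.analyticAt s).deriv.differentiableAt
  exact (h2 s).div (h1 s) hs

lemma sqrt_mul_le (t : ℝ) :
    √(1 + |t|) * (1 + t ^ 2)⁻¹ ≤ 2 * (1 + t ^ 2) ^ (-(3 / 4) : ℝ) := by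
  have h0 : 0 < 1 + t ^ 2 := by positivity
  have h1 : √(1 + |t|) ≤ 2 * (1 + t ^ 2) ^ (1 / 4 : ℝ) := by
    have h2 : 1 + |t| ≤ 2 * (1 + t ^ 2) ^ (1 / 2 : ℝ) := by
      rw [← Real.sqrt_eq_rpow]
      have h3 : 1 ≤ √(1 + t ^ 2) := by rw [Real.one_le_sqrt]; nlinarith
      have h4 : |t| ≤ √(1 + t ^ 2) := Real.abs_le_sqrt (by linarith)
      linarith
    rw [Real.sqrt_le_left (by positivity), mul_pow, ← Real.rpow_natCast, ← Real.rpow_natCast,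
      ← Real.rpow_mul h0.le]
    norm_num at h2 ⊢
    have : 0 ≤ (1 + t ^ 2) ^ (1 / 2 : ℝ) := by positivity
    linarith
  calc _ ≤ 2 * (1 + t ^ 2) ^ (1 / 4 : ℝ) * (1 + t ^ 2)⁻¹ := by gcongr
    _ = _ := by
      rw [← Real.rpow_neg_one (1 + t ^ 2), mul_assoc, ← Real.rpow_add h0]
      norm_num

lemma exists_norm_mul_logDeriv_le (hχ : χ ≠ 1)
    (hz : ∀ s : ℂ, 1 / 2 < s.re → DirichletCharacter.LFunction χ s ≠ 0) {σ σ' C : ℝ}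
    (hσ : 1 / 2 < σ) (hσσ' : σ ≤ σ') (hσ'2 : σ' ≤ 2) {M : ℂ → ℂ}
    (hMb : ∀ s : ℂ, σ ≤ s.re → s.re ≤ σ' → ‖M s‖ ≤ C * (1 + s.im ^ 2)⁻¹) :
    ∃ D : ℝ, ∀ s : ℂ, σ ≤ s.re → s.re ≤ σ' →
      ‖M s * -logDeriv χ.LFunction s‖ ≤ D * (1 + s.im ^ 2) ^ (-(3 / 4) : ℝ) := by
  obtain ⟨A, hA, hL⟩ := exists_norm_logDeriv_LFunction_le hχ hz hσ (hσσ'.trans hσ'2)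
  have hC : 0 ≤ C := by
    have := (norm_nonneg _).trans (hMb σ (by simp) (by simpa using hσσ'))
    simpa using this
  refine ⟨2 * C * A, fun s h1 h2 => ?_⟩
  rw [norm_mul, norm_neg]
  calc _ ≤ (C * (1 + s.im ^ 2)⁻¹) * (A * √(1 + |s.im|)) := by
        gcongr
        · exact hMb s h1 h2
        · exact hL s h1 (h2.trans hσ'2)
    _ = C * A * (√(1 + |s.im|) * (1 + s.im ^ 2)⁻¹) := by ring
    _ ≤ C * A * (2 * (1 + s.im ^ 2) ^ (-(3 / 4) : ℝ)) := by
        exact mul_le_mul_of_nonneg_left (sqrt_mul_le _) (by positivity)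
    _ = _ := by ring

/-- A smoothed sum over prime powers as an integral over a vertical line in the zero-free
half-plane. -/
lemma hasSum_vonMangoldt_mul (hχ : χ ≠ 1)
    (hz : ∀ s : ℂ, 1 / 2 < s.re → DirichletCharacter.LFunction χ s ≠ 0) {σ σ' C : ℝ}
    (hσ : 1 / 2 < σ) (hσσ' : σ ≤ σ') (h1σ' : 1 < σ') (hσ'2 : σ' ≤ 2) {W : ℝ → ℂ} {M : ℂ → ℂ}
    (hW : ContinuousOn W (Ioi 0)) (hM : ∀ s : ℂ, s.re = σ' → HasMellin W s (M s))
    (hMd : ∀ s : ℂ, σ ≤ s.re → s.re ≤ σ' → DifferentiableAt ℂ M s)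
    (hMb : ∀ s : ℂ, σ ≤ s.re → s.re ≤ σ' → ‖M s‖ ≤ C * (1 + s.im ^ 2)⁻¹) :
    HasSum (fun n : ℕ => χ (n : ZMod N) * (ArithmeticFunction.vonMangoldt n : ℂ) * W n)
      ((1 / (2 * Real.pi)) • ∫ t : ℝ, M (σ + t * I) * -logDeriv χ.LFunction (σ + t * I)) := by
  obtain ⟨D, hGb⟩ := exists_norm_mul_logDeriv_le hχ hz hσ hσσ' hσ'2 hMb
  have hGd : ∀ s : ℂ, σ ≤ s.re → s.re ≤ σ' →
      DifferentiableAt ℂ (fun s => M s * -logDeriv χ.LFunction s) s := fun s h1 h2 =>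
    (hMd s h1 h2).mul (differentiableAt_logDeriv_LFunction hχ (hz s (by linarith))).neg
  rw [integral_vertical_eq hσσ' hGd hGb]
  have hMi : Integrable (fun t : ℝ => M (σ' + t * I)) := by
    refine (integrable_inv_one_add_sq.const_mul C).mono' (continuous_vertical
      fun s hs => hMd s (hσσ'.trans hs.ge) hs.le).aestronglyMeasurable
      (Eventually.of_forall fun t => ?_)
    simpa using hMb (σ' + t * I) (by simpa using hσσ') (by simp)
  have hsum := (neg_logDeriv_LFunction_hasSum (χ := χ) (s := σ') (by simpa using h1σ'))
  have hpt : ∀ n : ℕ, ∀ t : ℝ, ‖M (σ' + t * I) * (χ (n : ZMod N) *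
      (ArithmeticFunction.vonMangoldt n : ℂ) * (n : ℂ) ^ (-(σ' + t * I)))‖ =
      ‖χ (n : ZMod N) * (ArithmeticFunction.vonMangoldt n : ℂ) * (n : ℂ) ^ (-(σ' : ℂ))‖ *
        ‖M (σ' + t * I)‖ := by
    intro n t
    rcases Nat.eq_zero_or_pos n with rfl | hn
    · simp
    · rw [norm_mul, norm_mul, norm_mul, norm_mul, norm_natCast_cpow_of_pos hn,
        norm_natCast_cpow_of_pos hn, mul_comm]
      simp
  have hcont : ∀ n : ℕ, n ≠ 0 → Continuous (fun t : ℝ => (n : ℂ) ^ (-(σ' + t * I : ℂ))) := by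
    intro n hn
    exact Continuous.const_cpow (by fun_prop) (.inl (by exact_mod_cast hn))
  have hswap := hasSum_integral_of_summable_integral_norm (μ := volume)
    (F := fun (n : ℕ) (t : ℝ) => M (σ' + t * I) * (χ (n : ZMod N) *
      (ArithmeticFunction.vonMangoldt n : ℂ) * (n : ℂ) ^ (-(σ' + t * I : ℂ)))) ?_ ?_
  · have e1 : ∀ t : ℝ, ∑' n : ℕ, M (σ' + t * I) * (χ (n : ZMod N) *
        (ArithmeticFunction.vonMangoldt n : ℂ) * (n : ℂ) ^ (-(σ' + t * I : ℂ))) =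
        M (σ' + t * I) * -logDeriv χ.LFunction (σ' + t * I) := by
      intro t
      rw [tsum_mul_left, (neg_logDeriv_LFunction_hasSum (s := σ' + t * I)
        (by simpa using h1σ')).tsum_eq]
    simp_rw [e1] at hswap
    have h2 := hswap.const_smul (1 / (2 * Real.pi))
    refine (congrArg (fun f => HasSum f _) (funext fun n => ?_)).mpr h2
    rcases Nat.eq_zero_or_pos n with rfl | hn
    · simp
    have hn' : (0 : ℝ) < n := Nat.cast_pos.mpr hn
    have e2 : ∀ t : ℝ, mellin W (σ' + t * I) = M (σ' + t * I) := fun t =>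
      (hM _ (by simp)).2
    have h3 := mellinInv_mellin_eq σ' W hn' (hM σ' (by simp)).1
      (by unfold VerticalIntegrable; simp_rw [e2]; exact hMi)
      (hW.continuousAt (Ioi_mem_nhds hn'))
    rw [mellinInv] at h3
    simp_rw [e2] at h3
    rw [← h3]
    rw [mul_smul_comm, ← integral_const_mul]
    congr 2 with t
    rw [smul_eq_mul]
    push_cast
    ring
  · intro n
    rcases Nat.eq_zero_or_pos n with rfl | hn
    · simp
    refine (hMi.norm.const_mul ‖χ (n : ZMod N) * (ArithmeticFunction.vonMangoldt n : ℂ) *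
      (n : ℂ) ^ (-(σ' : ℂ))‖).mono' ?_ (Eventually.of_forall fun t => (hpt n t).le)
    exact hMi.aestronglyMeasurable.mul
      (continuous_const.mul (hcont n hn.ne')).aestronglyMeasurable
  · simp_rw [hpt, integral_const_mul]
    exact hsum.summable.norm.mul_right _

end explicit

section symm

variable {N : ℕ} [NeZero N] {χ : DirichletCharacter ℂ N}

lemma LFunction_conj (hχ : χ ≠ 1) (hinv : χ⁻¹ = χ) {s : ℂ} (hs : 0 < s.re) :
    χ.LFunction (conj s) = conj (χ.LFunction s) := by
  have h1 := completedLFunction_conj hχ hinv s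
  rw [completedLFunction_eq_mul χ hs, completedLFunction_eq_mul χ (by simpa using hs),
    gammaFactor_conj, map_mul] at h1
  exact mul_right_cancel₀ (by simpa using gammaFactor_ne_zero χ hs) h1

lemma logDeriv_LFunction_conj (hχ : χ ≠ 1) (hinv : χ⁻¹ = χ) {s : ℂ} (hs : 0 < s.re) :
    logDeriv χ.LFunction (conj s) = conj (logDeriv χ.LFunction s) := by
  have h1 := ((DirichletCharacter.differentiable_LFunction hχ) s).hasDerivAt.conj_conj
  have h2 : (conj ∘ χ.LFunction ∘ conj) =ᶠ[𝓝 (conj s)] χ.LFunction := by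
    filter_upwards [(isOpen_lt continuous_const continuous_re).mem_nhds
      (show (0 : ℝ) < (conj s).re by simpa using hs)] with u hu
    have hu : 0 < u.re := hu
    have := LFunction_conj hχ hinv (s := conj u) (by simpa using hu)
    rw [conj_conj] at this
    exact this.symm
  have h3 := (h1.congr_of_eventuallyEq h2.symm).deriv
  rw [logDeriv_apply, logDeriv_apply, LFunction_conj hχ hinv hs, map_div₀]
  congr 1

/-- The symmetrised explicit formula, which only involves the real part of the logarithmic
derivative. -/
lemma hasSum_vonMangoldt_mul_symm (hχ : χ ≠ 1) (hinv : χ⁻¹ = χ)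
    (hz : ∀ s : ℂ, 1 / 2 < s.re → DirichletCharacter.LFunction χ s ≠ 0) {σ σ' C : ℝ}
    (hσ : 1 / 2 < σ) (hσσ' : σ ≤ σ') (h1σ' : 1 < σ') (hσ'2 : σ' ≤ 2) {W V : ℝ → ℂ} {M : ℂ → ℂ}
    (hW : ContinuousOn W (Ioi 0)) (hV : ContinuousOn V (Ioi 0))
    (hMW : ∀ s : ℂ, s.re = σ' → HasMellin W s (M s))
    (hMV : ∀ s : ℂ, s.re = σ' → HasMellin V s (M (2 * σ - s)))
    (hMd : ∀ s : ℂ, 2 * σ - σ' ≤ s.re → s.re ≤ σ' → DifferentiableAt ℂ M s)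
    (hMb : ∀ s : ℂ, 2 * σ - σ' ≤ s.re → s.re ≤ σ' → ‖M s‖ ≤ C * (1 + s.im ^ 2)⁻¹) :
    HasSum (fun n : ℕ => χ (n : ZMod N) * (ArithmeticFunction.vonMangoldt n : ℂ) * (W n + V n))
      ((1 / Real.pi) • ∫ t : ℝ, M (σ + t * I) *
        ((-logDeriv χ.LFunction (σ + t * I)).re : ℂ)) := by
  have hMb1 : ∀ s : ℂ, σ ≤ s.re → s.re ≤ σ' → ‖M s‖ ≤ C * (1 + s.im ^ 2)⁻¹ :=
    fun s h1 h2 => hMb s (by linarith) h2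
  have hMb2 : ∀ s : ℂ, σ ≤ s.re → s.re ≤ σ' → ‖M (2 * σ - s)‖ ≤ C * (1 + s.im ^ 2)⁻¹ := by
    intro s h1 h2
    have := hMb (2 * σ - s) (by simp; linarith) (by simp; linarith)
    simpa using this
  have hMd1 : ∀ s : ℂ, σ ≤ s.re → s.re ≤ σ' → DifferentiableAt ℂ M s :=
    fun s h1 h2 => hMd s (by linarith) h2
  have hMd2 : ∀ s : ℂ, σ ≤ s.re → s.re ≤ σ' → DifferentiableAt ℂ (fun s => M (2 * σ - s)) s := by
    intro s h1 h2
    exact (hMd (2 * σ - s) (by simp; linarith) (by simp; linarith)).comp s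
      (f := fun s : ℂ => 2 * σ - s) (by fun_prop)
  have hWs := hasSum_vonMangoldt_mul hχ hz hσ hσσ' h1σ' hσ'2 hW hMW hMd1 hMb1
  have hVs := hasSum_vonMangoldt_mul hχ hz hσ hσσ' h1σ' hσ'2 hV hMV hMd2 hMb2
  obtain ⟨D1, hD1⟩ := exists_norm_mul_logDeriv_le hχ hz hσ hσσ' hσ'2 hMb1
  obtain ⟨D2, hD2⟩ := exists_norm_mul_logDeriv_le hχ hz hσ hσσ' hσ'2 hMb2
  have hint1 : Integrable (fun t : ℝ => M (σ + t * I) * -logDeriv χ.LFunction (σ + t * I)) :=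
    integrable_vertical (G := fun s => M s * -logDeriv χ.LFunction s)
      (fun s h => (hMd1 s h.ge (h.trans_le hσσ')).mul
        (differentiableAt_logDeriv_LFunction hχ (hz s (by linarith))).neg)
      (fun s h => hD1 s h.ge (h.trans_le hσσ'))
  have hint2 : Integrable (fun t : ℝ => M (2 * σ - (σ + t * I)) *
      -logDeriv χ.LFunction (σ + t * I)) :=
    integrable_vertical (G := fun s => M (2 * σ - s) * -logDeriv χ.LFunction s)
      (fun s h => (hMd2 s h.ge (h.trans_le hσσ')).mul
        (differentiableAt_logDeriv_LFunction hχ (hz s (by linarith))).neg)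
      (fun s h => hD2 s h.ge (h.trans_le hσσ'))
  have hflip : ∫ t : ℝ, M (2 * σ - (σ + t * I)) * -logDeriv χ.LFunction (σ + t * I) =
      ∫ t : ℝ, M (σ + t * I) * conj (-logDeriv χ.LFunction (σ + t * I)) := by
    rw [← integral_neg_eq_self]
    congr 1 with t
    have e1 : (2 * σ - (σ + ((-t : ℝ) : ℂ) * I) : ℂ) = σ + t * I := by push_cast; ring
    have e2 : (σ + ((-t : ℝ) : ℂ) * I : ℂ) = conj (σ + t * I : ℂ) := by simp
    rw [e1, e2, logDeriv_LFunction_conj hχ hinv (by simp; linarith), map_neg]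
  have hint2' := hint2.comp_neg
  have h := hWs.add hVs
  simp_rw [← mul_add] at h
  convert h using 1
  rw [hflip, ← smul_add, ← integral_add hint1]
  · have e : ∀ t : ℝ, M (σ + t * I) * -logDeriv χ.LFunction (σ + t * I) +
        M (σ + t * I) * conj (-logDeriv χ.LFunction (σ + t * I)) =
        2 * (M (σ + t * I) * ((-logDeriv χ.LFunction (σ + t * I)).re : ℂ)) := by
      intro t
      rw [← mul_add, add_conj]
      push_cast
      ring
    simp_rw [e]
    rw [integral_const_mul]
    generalize (∫ t : ℝ, M (σ + t * I) * ((-logDeriv χ.LFunction (σ + t * I)).re : ℂ)) = X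
    rw [real_smul, real_smul]
    push_cast
    field_simp
  · refine hint2'.congr (Eventually.of_forall fun t => ?_)
    have e1 : (2 * σ - (σ + ((-t : ℝ) : ℂ) * I) : ℂ) = σ + t * I := by push_cast; ring
    have e2 : (σ + ((-t : ℝ) : ℂ) * I : ℂ) = conj (σ + t * I : ℂ) := by simp
    simp only
    rw [e1, e2, logDeriv_LFunction_conj hχ hinv (by simp; linarith), map_neg]

end symm

lemma hasMellin_cpow_Ioi {a s : ℂ} (hs : s.re + a.re < 0) :
    HasMellin (indicator (Ioi 1) (fun t => (t : ℂ) ^ a : ℝ → ℂ)) s (-1 / (s + a)) := by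
  have h1 : (s - 1 + a).re < -1 := by simp; linarith
  have e : ∀ t : ℝ, (t : ℂ) ^ (s - 1) • indicator (Ioi 1) (fun t => (t : ℂ) ^ a : ℝ → ℂ) t =
      indicator (Ioi 1) (fun t : ℝ => (t : ℂ) ^ (s - 1 + a)) t := by
    intro t
    by_cases ht : t ∈ Ioi (1 : ℝ)
    · rw [indicator_of_mem ht, indicator_of_mem ht, smul_eq_mul, cpow_add]
      have : (1 : ℝ) < t := ht
      exact ofReal_ne_zero.mpr (by linarith)
    · rw [indicator_of_notMem ht, indicator_of_notMem ht, smul_zero]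
  have hsub : Ioi (1 : ℝ) ⊆ Ioi 0 := Ioi_subset_Ioi zero_le_one
  constructor
  · rw [MellinConvergent]
    simp_rw [e]
    exact ((integrableOn_Ioi_cpow_of_lt h1 one_pos).integrable_indicator
      measurableSet_Ioi).integrableOn
  · rw [mellin]
    simp_rw [e]
    rw [setIntegral_indicator measurableSet_Ioi, inter_eq_right.mpr hsub,
      integral_Ioi_cpow_of_lt h1 one_pos, ofReal_one, one_cpow]
    congr 1
    ring

/-- The weight whose Mellin transform on the line `Re s = σ` is a Poisson kernel. -/
noncomputable def poissonWeight (σ P : ℝ) (u : ℝ) : ℂ :=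
  ((u ^ (-σ) * min (u ^ P) (u ^ (-P)) : ℝ) : ℂ)

lemma continuousOn_poissonWeight (σ P : ℝ) : ContinuousOn (poissonWeight σ P) (Ioi 0) := by
  have h : ∀ a : ℝ, ContinuousOn (fun u : ℝ => u ^ a) (Ioi 0) := fun a u hu =>
    (Real.continuousAt_rpow_const u a (.inl (ne_of_gt hu))).continuousWithinAt
  exact continuous_ofReal.comp_continuousOn ((h (-σ)).mul (ContinuousOn.inf (h P) (h (-P))))

lemma poissonWeight_eq {σ P : ℝ} (hP : 0 ≤ P) {u : ℝ} (hu : 0 < u) :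
    poissonWeight σ P u = indicator (Ioc 0 1) (fun t => (t : ℂ) ^ ((P - σ : ℝ) : ℂ) : ℝ → ℂ) u +
      indicator (Ioi 1) (fun t => (t : ℂ) ^ ((-P - σ : ℝ) : ℂ) : ℝ → ℂ) u := by
  rcases le_or_gt u 1 with h | h
  · rw [indicator_of_mem (show u ∈ Ioc 0 1 from ⟨hu, h⟩),
      indicator_of_notMem (show u ∉ Ioi 1 from not_lt.mpr h), add_zero, poissonWeight,
      min_eq_left (Real.rpow_le_rpow_of_exponent_ge hu h (by linarith)), ← Real.rpow_add hu,
      ← ofReal_cpow hu.le]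
    congr 2
    ring
  · rw [indicator_of_notMem (show u ∉ Ioc 0 1 from fun h' => not_lt.mpr h'.2 h),
      indicator_of_mem (show u ∈ Ioi 1 from h), zero_add, poissonWeight,
      min_eq_right (Real.rpow_le_rpow_of_exponent_le h.le (by linarith)), ← Real.rpow_add hu,
      ← ofReal_cpow hu.le]
    congr 2
    ring

lemma hasMellin_poissonWeight {σ P : ℝ} {s : ℂ} (hs : |s.re - σ| < P) :
    HasMellin (poissonWeight σ P) s (2 * P / (P ^ 2 - (s - σ) ^ 2)) := by
  have hP : 0 < P := (abs_nonneg _).trans_lt hs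
  rw [abs_lt] at hs
  have h1 := hasMellin_cpow_Ioc ((P - σ : ℝ) : ℂ) (s := s) (by rw [ofReal_re]; linarith)
  have h2 := hasMellin_cpow_Ioi (a := ((-P - σ : ℝ) : ℂ)) (s := s) (by rw [ofReal_re]; linarith)
  have h3 := hasMellin_add h1.1 h2.1
  rw [h1.2, h2.2] at h3
  have hne1 : s + (P - σ) ≠ 0 := by
    intro h
    have := congrArg re h
    simp at this
    linarith
  have hne2 : s + (-P - σ) ≠ 0 := by
    intro h
    have := congrArg re h
    simp at this
    linarith
  have e : (P : ℂ) ^ 2 - (s - σ) ^ 2 = -((s + (P - σ)) * (s + (-P - σ))) := by ring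
  have e2 : 2 * P / ((P : ℂ) ^ 2 - (s - σ) ^ 2) = 1 / (s + ((P - σ : ℝ) : ℂ)) +
      -1 / (s + ((-P - σ : ℝ) : ℂ)) := by
    rw [e]
    push_cast
    field_simp
    ring
  rw [e2]
  refine ⟨?_, ?_⟩
  · refine (integrableOn_congr_fun (fun t ht => ?_) measurableSet_Ioi).mpr h3.1
    simp only [poissonWeight_eq hP.le ht]
  · rw [← h3.2]
    refine setIntegral_congr_fun measurableSet_Ioi fun t ht => ?_
    simp only [poissonWeight_eq hP.le ht]

lemma poisson_denominator_ne_zero {σ P : ℝ} {s : ℂ} (hs : |s.re - σ| < P) :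
    (P : ℂ) ^ 2 - (s - σ) ^ 2 ≠ 0 := by
  rw [abs_lt] at hs
  have e : (P : ℂ) ^ 2 - (s - σ) ^ 2 = (P - (s - σ)) * (P + (s - σ)) := by ring
  rw [e]
  refine mul_ne_zero (fun h => ?_) (fun h => ?_)
  · have := congrArg re h
    simp at this
    linarith
  · have := congrArg re h
    simp at this
    linarith

lemma norm_poisson_kernel_le {σ P : ℝ} {s : ℂ} (hP : 2 ≤ P) (hs : |s.re - σ| ≤ 3 / 2) :
    ‖2 * P / ((P : ℂ) ^ 2 - (s - σ) ^ 2)‖ ≤ 8 * P * (1 + s.im ^ 2)⁻¹ := by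
  rw [abs_le] at hs
  have hw : ∀ w : ℂ, 1 / 2 ≤ w.re → |w.im| = |s.im| → 1 / 2 * √(1 + s.im ^ 2) ≤ ‖w‖ := by
    intro w h1 h2
    rw [← sq_abs, ← h2, sq_abs, ← Real.sqrt_sq (by norm_num : (0 : ℝ) ≤ 1 / 2),
      ← Real.sqrt_mul (by norm_num), Complex.norm_eq_sqrt_sq_add_sq]
    apply Real.sqrt_le_sqrt
    nlinarith [sq_nonneg w.im]
  have e : (P : ℂ) ^ 2 - (s - σ) ^ 2 = (P - (s - σ)) * (P + (s - σ)) := by ring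
  have h1 := hw (P - (s - σ)) (by simp; linarith) (by simp)
  have h2 := hw (P + (s - σ)) (by simp; linarith) (by simp)
  have h0 : 0 < 1 + s.im ^ 2 := by positivity
  have h3 : 1 / 4 * (1 + s.im ^ 2) ≤ ‖(P : ℂ) ^ 2 - (s - σ) ^ 2‖ := by
    rw [e, norm_mul]
    calc _ = (1 / 2 * √(1 + s.im ^ 2)) * (1 / 2 * √(1 + s.im ^ 2)) := by
          rw [mul_mul_mul_comm, Real.mul_self_sqrt h0.le]; norm_num
      _ ≤ _ := by gcongr
  have h4 : ‖(2 * P : ℂ)‖ = 2 * P := by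
    rw [norm_mul, norm_real, Real.norm_of_nonneg (by linarith)]; norm_num
  rw [norm_div, h4, div_le_iff₀ (by linarith), mul_assoc]
  have h5 : 1 / 4 ≤ (1 + s.im ^ 2)⁻¹ * ‖(P : ℂ) ^ 2 - (s - σ) ^ 2‖ := by
    rw [inv_mul_eq_div, le_div_iff₀ h0]; exact h3
  nlinarith

section poisson

variable {N : ℕ} [NeZero N] {χ : DirichletCharacter ℂ N}

/-- The Poisson integral formula for the logarithmic derivative. -/
lemma integral_poisson_mul_re_logDeriv (hχ : χ ≠ 1) (hinv : χ⁻¹ = χ)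
    (hz : ∀ s : ℂ, 1 / 2 < s.re → DirichletCharacter.LFunction χ s ≠ 0) {σ P : ℝ}
    (hσ : 1 / 2 < σ) (hσ1 : σ ≤ 1) (hP : 2 ≤ P) :
    ∫ t : ℝ, P / (P ^ 2 + t ^ 2) * (-logDeriv χ.LFunction (σ + t * I)).re =
      Real.pi * (-logDeriv χ.LFunction (σ + P : ℝ)).re := by
  have h := hasSum_vonMangoldt_mul_symm (σ' := 2) (C := 8 * P) hχ hinv hz hσ (by linarith)
    one_lt_two le_rfl (W := poissonWeight σ P) (V := poissonWeight σ P)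
    (M := fun s => 2 * P / ((P : ℂ) ^ 2 - (s - σ) ^ 2)) (continuousOn_poissonWeight σ P)
    (continuousOn_poissonWeight σ P)
    (fun s hs => hasMellin_poissonWeight (by rw [hs, abs_lt]; constructor <;> linarith))
    (fun s hs => by
      have e : (2 * σ - s - σ : ℂ) ^ 2 = (s - σ) ^ 2 := by ring
      simp only [e]
      exact hasMellin_poissonWeight (by rw [hs, abs_lt]; constructor <;> linarith))
    (fun s h1 h2 => by
      refine DifferentiableAt.div (by fun_prop) (by fun_prop) (poisson_denominator_ne_zero ?_)
      rw [abs_lt]; constructor <;> linarith)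
    (fun s h1 h2 => norm_poisson_kernel_le hP (by rw [abs_le]; constructor <;> linarith))
  have h2 := (neg_logDeriv_LFunction_hasSum (χ := χ) (s := (σ + P : ℝ))
    (by rw [ofReal_re]; linarith)).mul_left 2
  have h3 : ∀ n : ℕ, χ (n : ZMod N) * (ArithmeticFunction.vonMangoldt n : ℂ) *
      (poissonWeight σ P n + poissonWeight σ P n) = 2 * (χ (n : ZMod N) *
        (ArithmeticFunction.vonMangoldt n : ℂ) * (n : ℂ) ^ (-((σ + P : ℝ) : ℂ))) := by
    intro n
    rcases Nat.eq_zero_or_pos n with rfl | hn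
    · simp
    have h4 : poissonWeight σ P n = (n : ℂ) ^ (-((σ + P : ℝ) : ℂ)) := by
      have hn1 : (1 : ℝ) ≤ n := Nat.one_le_cast.mpr hn
      rw [poissonWeight, min_eq_right (Real.rpow_le_rpow_of_exponent_le hn1 (by linarith)),
        ← Real.rpow_add (by linarith), ofReal_cpow (by linarith)]
      push_cast
      ring_nf
    rw [h4]
    ring
  simp_rw [h3] at h
  have h5 := h.unique h2
  have e : ∀ t : ℝ, 2 * (P : ℂ) / ((P : ℂ) ^ 2 - ((σ + t * I : ℂ) - σ) ^ 2) *
      ((-logDeriv χ.LFunction (σ + t * I)).re : ℂ) =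
      ((2 * (P / (P ^ 2 + t ^ 2) * (-logDeriv χ.LFunction (σ + t * I)).re) : ℝ) : ℂ) := by
    intro t
    rw [add_sub_cancel_left, mul_pow, I_sq]
    push_cast
    ring_nf
  simp_rw [e] at h5
  rw [integral_complex_ofReal, integral_const_mul, real_smul] at h5
  have h6 := congrArg re h5
  rw [← ofReal_mul, ofReal_re, show (2 : ℂ) = ((2 : ℝ) : ℂ) by norm_num, re_ofReal_mul] at h6
  have hpi := Real.pi_pos
  rw [one_div, inv_mul_eq_iff_eq_mul₀ hpi.ne'] at h6
  linarith

lemma norm_logDeriv_LFunction_le {s : ℂ} (hs : 2 ≤ s.re) :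
    ‖-logDeriv χ.LFunction s‖ ≤
      ∑' n : ℕ, ‖(ArithmeticFunction.vonMangoldt n : ℂ) * (n : ℂ) ^ (-2 : ℂ)‖ := by
  have h1 := neg_logDeriv_LFunction_hasSum (χ := χ) (s := s) (by linarith)
  have hsum : Summable fun n : ℕ =>
      ‖(ArithmeticFunction.vonMangoldt n : ℂ) * (n : ℂ) ^ (-2 : ℂ)‖ := by
    have h := (ArithmeticFunction.LSeriesSummable_vonMangoldt (s := 2) (by norm_num)).norm
    refine h.congr fun n => ?_
    rw [LSeries.term_def]
    split_ifs with hn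
    · simp [hn]
    · rw [cpow_neg, div_eq_mul_inv]
  rw [← h1.tsum_eq]
  refine tsum_of_norm_bounded hsum.hasSum fun n => ?_
  rcases Nat.eq_zero_or_pos n with rfl | hn
  · simp
  have hn1 : (1 : ℝ) ≤ n := Nat.one_le_cast.mpr hn
  rw [norm_mul, norm_mul, norm_mul, norm_natCast_cpow_of_pos hn, norm_natCast_cpow_of_pos hn]
  have h3 := χ.norm_le_one (n : ZMod N)
  have h4 : (n : ℝ) ^ (-s).re ≤ (n : ℝ) ^ (-2 : ℂ).re :=
    Real.rpow_le_rpow_of_exponent_le hn1 (by simp; linarith)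
  calc _ ≤ 1 * ‖(ArithmeticFunction.vonMangoldt n : ℂ)‖ * (n : ℝ) ^ (-2 : ℂ).re := by gcongr
    _ = _ := by ring

end poisson

lemma log_two_add_abs_le (u : ℝ) : Real.log (2 + |u|) ≤ 4 * √(1 + |u|) := by
  have h0 := abs_nonneg u
  have h1 : 0 < √(2 + |u|) := Real.sqrt_pos.mpr (by linarith)
  have h2 : Real.log (2 + |u|) = 2 * Real.log √(2 + |u|) := by
    rw [Real.log_sqrt (by linarith)]; ring
  have h3 := Real.log_le_sub_one_of_pos h1
  have h4 : √(2 + |u|) ≤ 2 * √(1 + |u|) := by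
    rw [Real.sqrt_le_left (by positivity), mul_pow, Real.sq_sqrt (by linarith)]
    linarith
  linarith

lemma integrable_inv_mul_log :
    Integrable (fun u : ℝ => (1 + u ^ 2)⁻¹ * Real.log (2 + |u|)) := by
  refine (integrable_one_add_sq_rpow.const_mul 8).mono' ?_ (Eventually.of_forall fun u => ?_)
  · refine Continuous.aestronglyMeasurable ?_
    refine Continuous.mul (Continuous.inv₀ (by fun_prop) fun u => by positivity)
      (Continuous.log (by fun_prop) fun u => by positivity)
  · have h1 : 0 ≤ Real.log (2 + |u|) := Real.log_nonneg (by linarith [abs_nonneg u])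
    have h0 : 0 < 1 + u ^ 2 := by positivity
    rw [Real.norm_of_nonneg (by positivity)]
    have h2 := sqrt_mul_le u
    have h3 := log_two_add_abs_le u
    have h4 : 0 < (1 + u ^ 2)⁻¹ := by positivity
    nlinarith

lemma poisson_kernel_eq {P : ℝ} (hP : 0 < P) (t : ℝ) :
    P / (P ^ 2 + t ^ 2) = P⁻¹ * (1 + (t / P) ^ 2)⁻¹ := by
  field_simp

lemma integrable_poisson_kernel {P : ℝ} (hP : 0 < P) :
    Integrable (fun t : ℝ => P / (P ^ 2 + t ^ 2)) := by
  simp_rw [poisson_kernel_eq hP]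
  exact (integrable_inv_one_add_sq.comp_div hP.ne').const_mul _

lemma integral_poisson_kernel {P : ℝ} (hP : 0 < P) :
    ∫ t : ℝ, P / (P ^ 2 + t ^ 2) = Real.pi := by
  simp_rw [poisson_kernel_eq hP]
  rw [integral_const_mul, Measure.integral_comp_div (fun t : ℝ => (1 + t ^ 2)⁻¹) P,
    integral_univ_inv_one_add_sq, abs_of_pos hP, smul_eq_mul, inv_mul_cancel_left₀ hP.ne']

lemma poisson_kernel_mul_log {P : ℝ} (hP : 1 ≤ P) (t : ℝ) :
    P / (P ^ 2 + t ^ 2) * Real.log (2 + |t|) ≤ P / (P ^ 2 + t ^ 2) * Real.log P +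
      P⁻¹ * ((1 + (t / P) ^ 2)⁻¹ * Real.log (2 + |t / P|)) := by
  have hP0 : 0 < P := by linarith
  have h0 := abs_nonneg t
  rw [← mul_assoc, ← poisson_kernel_eq hP0, ← mul_add, ← Real.log_mul hP0.ne' (by positivity)]
  have h1 : 2 + |t| ≤ P * (2 + |t / P|) := by
    rw [abs_div, abs_of_pos hP0]
    field_simp
    linarith
  gcongr

section poisson

variable {N : ℕ} [NeZero N] {χ : DirichletCharacter ℂ N}

lemma integrable_poisson_mul_re_logDeriv (hχ : χ ≠ 1)
    (hz : ∀ s : ℂ, 1 / 2 < s.re → DirichletCharacter.LFunction χ s ≠ 0) {σ P : ℝ}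
    (hσ : 1 / 2 < σ) (hσ1 : σ ≤ 1) (hP : 2 ≤ P) :
    Integrable fun t : ℝ => P / (P ^ 2 + t ^ 2) * (-logDeriv χ.LFunction (σ + t * I)).re := by
  obtain ⟨D, hD⟩ := exists_norm_mul_logDeriv_le (σ' := σ) (C := 8 * P) hχ hz hσ le_rfl
    (by linarith) (M := fun s => 2 * P / ((P : ℂ) ^ 2 - (s - σ) ^ 2))
    (fun s h1 h2 => norm_poisson_kernel_le hP (by rw [abs_le]; constructor <;> linarith))
  have h := integrable_vertical (a := σ) (G := fun s => 2 * P / ((P : ℂ) ^ 2 - (s - σ) ^ 2) *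
    -logDeriv χ.LFunction s) (fun s hs => by
      refine DifferentiableAt.mul (DifferentiableAt.div (by fun_prop) (by fun_prop)
        (poisson_denominator_ne_zero ?_))
        (differentiableAt_logDeriv_LFunction hχ (hz s (by linarith))).neg
      rw [abs_lt]; constructor <;> linarith)
    (fun s hs => hD s hs.ge hs.le)
  refine (h.re.const_mul (1 / 2)).congr (Eventually.of_forall fun t => ?_)
  have e : 2 * (P : ℂ) / ((P : ℂ) ^ 2 - ((σ + t * I : ℂ) - σ) ^ 2) =
      ((2 * (P / (P ^ 2 + t ^ 2)) : ℝ) : ℂ) := by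
    rw [add_sub_cancel_left, mul_pow, I_sq]
    push_cast
    ring_nf
  simp only [e, RCLike.re_to_complex, re_ofReal_mul]
  ring

end poisson

lemma exists_integral_poisson_abs_le : ∃ C : ℝ, 0 < C ∧
    ∀ {N : ℕ} [NeZero N] {χ : DirichletCharacter ℂ N}, χ ≠ 1 → χ.IsPrimitive → χ⁻¹ = χ →
    (∀ s : ℂ, 1 / 2 < s.re → DirichletCharacter.LFunction χ s ≠ 0) →
    ∀ σ P : ℝ, 1 / 2 < σ → σ ≤ 1 → 2 ≤ P →
    ∫ t : ℝ, P / (P ^ 2 + t ^ 2) * |(-logDeriv χ.LFunction (σ + t * I)).re| ≤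
      C * (Real.log N + Real.log P + 1) := by
  obtain ⟨G, hG, hgam⟩ := exists_norm_logDeriv_gammaFactor_le
  set B := ∑' n : ℕ, ‖(ArithmeticFunction.vonMangoldt n : ℂ) * (n : ℂ) ^ (-2 : ℂ)‖ with hB
  have hB0 : 0 ≤ B := tsum_nonneg fun n => norm_nonneg _
  set D := ∫ u : ℝ, (1 + u ^ 2)⁻¹ * Real.log (2 + |u|) with hD
  have hD0 : 0 ≤ D := integral_nonneg fun u => by
    have h1 : 0 ≤ Real.log (2 + |u|) := Real.log_nonneg (by linarith [abs_nonneg u])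
    show 0 ≤ (1 + u ^ 2)⁻¹ * Real.log (2 + |u|)
    positivity
  have hpi := Real.pi_pos
  refine ⟨Real.pi + 2 * G * Real.pi + 2 * G * D + Real.pi * B, by positivity, ?_⟩
  intro N _ χ hχ hp hinv hz σ P hσ hσ1 hP
  have hP0 : 0 < P := by linarith
  have hN : 0 ≤ Real.log N := Real.log_natCast_nonneg N
  have hlP : 0 ≤ Real.log P := Real.log_nonneg (by linarith)
  have hI1 := integrable_poisson_mul_re_logDeriv hχ hz hσ hσ1 hP
  have hI2 := integrable_poisson_kernel hP0
  have hI3 := (integrable_inv_mul_log.comp_div hP0.ne').const_mul P⁻¹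
  have hpt : ∀ t : ℝ, P / (P ^ 2 + t ^ 2) * |(-logDeriv χ.LFunction (σ + t * I)).re| ≤
      (P / (P ^ 2 + t ^ 2) * (Real.log N + 2 * G * Real.log P) +
        2 * G * (P⁻¹ * ((1 + (t / P) ^ 2)⁻¹ * Real.log (2 + |t / P|)))) -
        P / (P ^ 2 + t ^ 2) * (-logDeriv χ.LFunction (σ + t * I)).re := by
    intro t
    have hs : 1 / 2 < (σ + t * I : ℂ).re := by simpa using hσ
    have h1 := re_logDeriv_xi_nonneg hχ hp hinv hz hs
    rw [logDeriv_xi hχ hz hs] at h1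
    have h2 := hgam N χ (σ + t * I) hs.le (by simpa using hσ1)
    have h3 := (abs_le.mp ((Complex.abs_re_le_norm _).trans h2)).2
    have h4 : (Real.log N / 2 : ℂ).re = Real.log N / 2 := by
      rw [show (Real.log N / 2 : ℂ) = ((Real.log N / 2 : ℝ) : ℂ) by push_cast; rfl, ofReal_re]
    rw [add_re, add_re, h4] at h1
    have him : (σ + t * I : ℂ).im = t := by simp
    rw [him] at h3
    have h5 : |(-logDeriv χ.LFunction (σ + t * I)).re| ≤ Real.log N +
        2 * G * Real.log (2 + |t|) - (-logDeriv χ.LFunction (σ + t * I)).re := by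
      rw [neg_re, abs_le]
      have : 0 ≤ G * Real.log (2 + |t|) :=
        mul_nonneg hG.le (Real.log_nonneg (by linarith [abs_nonneg t]))
      constructor <;> linarith
    have h6 := poisson_kernel_mul_log (show 1 ≤ P by linarith) t
    have h7 : 0 ≤ P / (P ^ 2 + t ^ 2) := by positivity
    have h8 := mul_le_mul_of_nonneg_left h5 h7
    have h9 := mul_le_mul_of_nonneg_left h6 (show 0 ≤ 2 * G by linarith)
    linarith
  have hI4 := (hI2.mul_const (Real.log N + 2 * G * Real.log P)).add (hI3.const_mul (2 * G))
  have hI5 : Integrable fun t : ℝ =>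
      P / (P ^ 2 + t ^ 2) * |(-logDeriv χ.LFunction (σ + t * I)).re| := by
    refine hI1.abs.congr (Eventually.of_forall fun t => ?_)
    show |_| = _
    rw [abs_mul, abs_of_nonneg (show 0 ≤ P / (P ^ 2 + t ^ 2) by positivity)]
  refine (integral_mono hI5 (hI4.sub hI1) hpt).trans ?_
  have e1 := integral_sub hI4 hI1
  have e2 := integral_add (hI2.mul_const (Real.log N + 2 * G * Real.log P))
    (hI3.const_mul (2 * G))
  simp only [Pi.add_apply, Pi.sub_apply] at e1 e2 ⊢
  rw [e1, e2, integral_mul_const, integral_poisson_kernel hP0, integral_const_mul,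
    integral_const_mul, Measure.integral_comp_div
      (fun u : ℝ => (1 + u ^ 2)⁻¹ * Real.log (2 + |u|)) P, ← hD, abs_of_pos hP0, smul_eq_mul,
    inv_mul_cancel_left₀ hP0.ne', integral_poisson_mul_re_logDeriv hχ hinv hz hσ hσ1 hP]
  have h1 := norm_logDeriv_LFunction_le (χ := χ) (s := (σ + P : ℝ)) (by rw [ofReal_re]; linarith)
  have h2 := (abs_le.mp ((Complex.abs_re_le_norm _).trans h1)).1
  rw [← hB] at h2
  have h3 := mul_le_mul_of_nonneg_left h2 hpi.le
  have h4 : 0 ≤ G * Real.pi := by positivity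
  have h5 : 0 ≤ G * D := by positivity
  have h6 : 0 ≤ Real.pi * B := by positivity
  have h7 := mul_nonneg hpi.le hlP
  have h8 := mul_nonneg h4 hN
  have h9 := mul_nonneg h5 hN
  have h10 := mul_nonneg h6 hN
  have h11 := mul_nonneg h5 hlP
  have h12 := mul_nonneg h6 hlP
  linarith

/-- The positive part of `v - u`, as a complex number. -/
noncomputable def ramp (v u : ℝ) : ℂ := ((max 0 (v - u) : ℝ) : ℂ)

lemma continuous_ramp (v : ℝ) : Continuous (ramp v) := by
  unfold ramp
  fun_prop

lemma hasMellin_ramp {v : ℝ} (hv : 0 < v) {s : ℂ} (hs : 0 < s.re) :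
    HasMellin (ramp v) s ((v : ℂ) ^ (s + 1) / (s * (s + 1))) := by
  have hv' : 0 < v⁻¹ := inv_pos.mpr hv
  have h1 := hasMellin_one_Ioc hs
  have h2 := hasMellin_cpow_Ioc 1 (s := s) (by rw [one_re]; linarith)
  have h3 := hasMellin_sub h1.1 h2.1
  rw [h1.2, h2.2] at h3
  have hs0 : s ≠ 0 := by
    rintro rfl
    simp at hs
  have hs1 : s + 1 ≠ 0 := by
    intro h
    have := congrArg re h
    simp at this
    linarith
  have hv0 : (v : ℂ) ≠ 0 := ofReal_ne_zero.mpr hv.ne'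
  set g : ℝ → ℂ := fun t => indicator (Ioc 0 1) (fun _ => 1 : ℝ → ℂ) t -
    indicator (Ioc 0 1) (fun t => (t : ℂ) ^ (1 : ℂ) : ℝ → ℂ) t with hg
  have e : ∀ u ∈ Ioi (0 : ℝ), ramp v u = (v : ℂ) • g (v⁻¹ * u) := by
    intro u hu
    have hu0 : (0 : ℝ) < u := hu
    simp only [hg]
    by_cases h : u ≤ v
    · have hm : v⁻¹ * u ∈ Ioc (0 : ℝ) 1 :=
        ⟨by positivity, by rw [inv_mul_le_iff₀ hv, mul_one]; exact h⟩
      rw [indicator_of_mem hm, indicator_of_mem hm, ramp, max_eq_right (by linarith), cpow_one,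
        smul_eq_mul]
      push_cast
      field_simp
    · have hm : v⁻¹ * u ∉ Ioc (0 : ℝ) 1 := by
        intro hm
        have := hm.2
        rw [inv_mul_le_iff₀ hv, mul_one] at this
        exact h this
      rw [indicator_of_notMem hm, indicator_of_notMem hm, ramp, max_eq_left (by linarith)]
      simp
  have h4 := hasMellin_const_smul ((MellinConvergent.comp_mul_left hv').mpr h3.1) (v : ℂ)
  refine ⟨(integrableOn_congr_fun (fun t ht => ?_) measurableSet_Ioi).mpr h4.1, ?_⟩
  · simp only [e t ht]
  · have h5 : mellin (ramp v) s = mellin (fun t => (v : ℂ) • g (v⁻¹ * t)) s :=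
      setIntegral_congr_fun measurableSet_Ioi fun t ht => by simp only [e t ht]
    rw [h5, h4.2, mellin_comp_mul_left _ _ hv', h3.2, ofReal_inv, inv_cpow, cpow_neg, inv_inv,
      cpow_add _ _ hv0, cpow_one, smul_eq_mul, smul_eq_mul]
    · field_simp
      ring
    · rw [arg_ofReal_of_nonneg hv.le]
      exact Real.pi_pos.ne

/-- A trapezoidal weight equal to `1` on `[2, x]` and supported in `[1, x + h]`. -/
noncomputable def trapezoid (x h u : ℝ) : ℂ :=
  (ramp (x + h) u - ramp x u) / h - (ramp 2 u - ramp 1 u)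

/-- The Mellin transform of `trapezoid`. -/
noncomputable def trapezoidMellin (x h : ℝ) (s : ℂ) : ℂ :=
  ((((x + h : ℝ) : ℂ) ^ (s + 1) - (x : ℂ) ^ (s + 1)) / h - ((2 : ℂ) ^ (s + 1) - 1)) /
    (s * (s + 1))

lemma continuous_trapezoid (x h : ℝ) : Continuous (trapezoid x h) := by
  have := continuous_ramp
  unfold trapezoid
  fun_prop

lemma hasMellin_trapezoid {x h : ℝ} (hx : 0 < x) (hh : 0 < h) {s : ℂ} (hs : 0 < s.re) :
    HasMellin (trapezoid x h) s (trapezoidMellin x h s) := by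
  have h1 := hasMellin_ramp (show 0 < x + h by linarith) hs
  have h2 := hasMellin_ramp hx hs
  have h3 := hasMellin_ramp two_pos hs
  have h4 := hasMellin_ramp one_pos hs
  have h5 := hasMellin_sub h1.1 h2.1
  have h6 := hasMellin_sub h3.1 h4.1
  have h7 := hasMellin_sub (h5.1.div_const h) h6.1
  rw [mellin_div_const, h5.2, h6.2, h1.2, h2.2, h3.2, h4.2] at h7
  refine ⟨h7.1, h7.2.trans ?_⟩
  rw [trapezoidMellin, ofReal_one, one_cpow, ofReal_ofNat]
  ring

lemma trapezoid_eq_zero_of_le {x h u : ℝ} (hx : 1 ≤ x) (hh : 0 < h) (hu : u ≤ 1) :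
    trapezoid x h u = 0 := by
  have : (h : ℂ) ≠ 0 := ofReal_ne_zero.mpr hh.ne'
  rw [trapezoid, ramp, ramp, ramp, ramp, max_eq_right (by linarith), max_eq_right (by linarith),
    max_eq_right (by linarith), max_eq_right (by linarith)]
  push_cast
  field_simp
  ring

lemma trapezoid_eq_zero_of_ge {x h u : ℝ} (hx : 2 ≤ x) (hh : 0 < h) (hu : x + h ≤ u) :
    trapezoid x h u = 0 := by
  rw [trapezoid, ramp, ramp, ramp, ramp, max_eq_left (by linarith), max_eq_left (by linarith),
    max_eq_left (by linarith), max_eq_left (by linarith)]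
  simp

lemma trapezoid_eq_one {x h u : ℝ} (hh : 0 < h) (hu : 2 ≤ u) (hux : u ≤ x) :
    trapezoid x h u = 1 := by
  have : (h : ℂ) ≠ 0 := ofReal_ne_zero.mpr hh.ne'
  rw [trapezoid, ramp, ramp, ramp, ramp, max_eq_right (by linarith), max_eq_right (by linarith),
    max_eq_left (by linarith), max_eq_left (by linarith)]
  push_cast
  field_simp
  ring

lemma norm_trapezoid_le {x h u : ℝ} (hx : 2 ≤ x) (hh : 0 < h) (hu : x ≤ u) :
    ‖trapezoid x h u‖ ≤ 1 := by
  rw [trapezoid, ramp, ramp, ramp, ramp, max_eq_left (by linarith : x - u ≤ 0),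
    max_eq_left (by linarith : 2 - u ≤ 0), max_eq_left (by linarith : 1 - u ≤ 0), ofReal_zero,
    sub_zero, sub_zero, sub_zero, ← ofReal_div, norm_real, Real.norm_of_nonneg (by positivity),
    div_le_one hh]
  exact max_le hh.le (by linarith)

lemma hasMellin_cpow_smul_trapezoid_inv {x h σ : ℝ} (hx : 0 < x) (hh : 0 < h) {s : ℂ}
    (hs : s.re < 2 * σ) :
    HasMellin (fun u : ℝ => (u : ℂ) ^ (-(2 * σ) : ℂ) • trapezoid x h u⁻¹) s
      (trapezoidMellin x h (2 * σ - s)) := by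
  have h1 := hasMellin_trapezoid hx hh (s := 2 * σ - s) (by simpa using hs)
  have e : -(s + -(2 * σ) : ℂ) = 2 * σ - s := by ring
  refine ⟨?_, ?_⟩
  · rw [MellinConvergent.cpow_smul]
    have h2 := (MellinConvergent.comp_rpow (f := trapezoid x h) (s := s + -(2 * σ))
      (a := -1) (by norm_num)).mpr (by
        rw [ofReal_neg, ofReal_one, div_neg, div_one, e]; exact h1.1)
    simpa only [Real.rpow_neg_one] using h2
  · rw [mellin_cpow_smul, mellin_comp_inv, e, h1.2]

lemma differentiableAt_trapezoidMellin {x h : ℝ} (hx : 0 < x) (hh : 0 < h) {s : ℂ}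
    (hs : 0 < s.re) : DifferentiableAt ℂ (trapezoidMellin x h) s := by
  have hs0 : s ≠ 0 := by
    rintro rfl
    simp at hs
  have hs1 : s + 1 ≠ 0 := by
    intro h
    have := congrArg re h
    simp at this
    linarith
  have hc : ∀ c : ℂ, c ≠ 0 → DifferentiableAt ℂ (fun s : ℂ => c ^ (s + 1)) s := fun c hc =>
    DifferentiableAt.const_cpow (by fun_prop) (.inl hc)
  have h1 := hc ((x + h : ℝ) : ℂ) (ofReal_ne_zero.mpr (by linarith))
  have h2 := hc (x : ℂ) (ofReal_ne_zero.mpr (by linarith))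
  have h3 := hc 2 two_ne_zero
  unfold trapezoidMellin
  exact (((h1.sub h2).div_const _).sub (h3.sub_const 1)).div (by fun_prop)
    (mul_ne_zero hs0 hs1)

lemma norm_ofReal_cpow_add_one {v : ℝ} (hv : 0 < v) (s : ℂ) :
    ‖(v : ℂ) ^ (s + 1)‖ = v ^ (s.re + 1) := by
  rw [norm_cpow_eq_rpow_re_of_pos hv, add_re, one_re]

lemma norm_le_norm_add_one {s : ℂ} (hs : 0 ≤ s.re) : ‖s‖ ≤ ‖s + 1‖ := by
  rw [Complex.norm_eq_sqrt_sq_add_sq, Complex.norm_eq_sqrt_sq_add_sq]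
  apply Real.sqrt_le_sqrt
  simp
  nlinarith

lemma one_le_norm_add_one {s : ℂ} (hs : 0 ≤ s.re) : 1 ≤ ‖s + 1‖ := by
  have h := Complex.re_le_norm (s + 1)
  rw [add_re, one_re] at h
  linarith

lemma exists_norm_trapezoidMellin_le {x h a b : ℝ} (hx : 1 ≤ x) (hh : 0 < h) (ha : 0 < a) :
    ∃ C : ℝ, ∀ s : ℂ, a ≤ s.re → s.re ≤ b →
      ‖trapezoidMellin x h s‖ ≤ C * (1 + s.im ^ 2)⁻¹ := by
  set K := ((x + h) ^ (b + 1) + x ^ (b + 1)) / h + ((2 : ℝ) ^ (b + 1) + 1) with hK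
  have hK0 : 0 ≤ K := by
    have := Real.rpow_nonneg (show 0 ≤ x + h by linarith) (b + 1)
    positivity
  set c := min 1 a ^ 2 with hc
  have hc0 : 0 < c := by positivity
  refine ⟨K / c, fun s h1 h2 => ?_⟩
  have hnum : ‖(((x + h : ℝ) : ℂ) ^ (s + 1) - (x : ℂ) ^ (s + 1)) / h - ((2 : ℂ) ^ (s + 1) - 1)‖
      ≤ K := by
    refine (norm_sub_le _ _).trans ?_
    rw [norm_div, norm_real, Real.norm_of_nonneg hh.le]
    have h3 : ∀ v : ℝ, 1 ≤ v → ‖(v : ℂ) ^ (s + 1)‖ ≤ v ^ (b + 1) := fun v hv => by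
      rw [norm_ofReal_cpow_add_one (by linarith)]
      exact Real.rpow_le_rpow_of_exponent_le hv (by linarith)
    have h4 := h3 (x + h) (by linarith)
    have h5 := h3 x hx
    have h6 := h3 2 one_le_two
    rw [ofReal_ofNat] at h6
    rw [hK]
    gcongr
    · exact (norm_sub_le _ _).trans (by gcongr)
    · exact (norm_sub_le _ _).trans (by rw [norm_one]; gcongr)
  have hs0 : 0 < s.re := by linarith
  have hden : c * (1 + s.im ^ 2) ≤ ‖s * (s + 1)‖ := by
    rw [norm_mul]
    calc c * (1 + s.im ^ 2) ≤ ‖s‖ * ‖s‖ := by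
          rw [← sq, ← Complex.normSq_eq_norm_sq, normSq_apply]
          have h7 : c ≤ 1 := pow_le_one₀ (by positivity) (min_le_left _ _)
          have h8 : c ≤ a ^ 2 := pow_le_pow_left₀ (by positivity) (min_le_right _ _) 2
          nlinarith [sq_nonneg s.im]
      _ ≤ _ := by
          gcongr
          exact norm_le_norm_add_one hs0.le
  have h0 : 0 < 1 + s.im ^ 2 := by positivity
  rw [trapezoidMellin, norm_div]
  calc _ ≤ K / (c * (1 + s.im ^ 2)) := by gcongr
    _ = _ := by rw [div_mul_eq_div_div, div_eq_mul_inv]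

lemma norm_cpow_sub_cpow_le {x h : ℝ} (hx : 0 < x) (hh : 0 ≤ h) {s : ℂ} (hs : 0 < s.re) :
    ‖((x + h : ℝ) : ℂ) ^ (s + 1) - (x : ℂ) ^ (s + 1)‖ ≤ ‖s + 1‖ * (x + h) ^ s.re * h := by
  have key := Convex.norm_image_sub_le_of_norm_hasDerivWithin_le
    (f := fun u : ℝ => (u : ℂ) ^ (s + 1)) (f' := fun u : ℝ => (s + 1) * (u : ℂ) ^ s)
    (s := Icc x (x + h)) (x := x) (y := x + h) (C := ‖s + 1‖ * (x + h) ^ s.re)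
    (fun u hu => ?_) (fun u hu => ?_) (convex_Icc _ _) (left_mem_Icc.mpr (by linarith))
    (right_mem_Icc.mpr (by linarith))
  · simpa [abs_of_nonneg hh] using key
  · have hu0 : 0 < u := hx.trans_le hu.1
    have hs1 : s + 1 ≠ 0 := by
      intro h
      have := congrArg re h
      simp at this
      linarith
    have := hasDerivAt_ofReal_cpow_const hu0.ne' hs1
    rw [add_sub_cancel_right] at this
    exact this.hasDerivWithinAt
  · have hu0 : 0 < u := hx.trans_le hu.1
    rw [norm_mul, norm_cpow_eq_rpow_re_of_pos hu0]
    gcongr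
    exact hu.2

lemma two_le_log {x : ℝ} (hx : 8 ≤ x) : 2 ≤ Real.log x := by
  rw [Real.le_log_iff_exp_le (by linarith)]
  have h1 := Real.exp_one_lt_d9
  have h2 := Real.exp_pos 1
  have h3 : Real.exp 2 = Real.exp 1 * Real.exp 1 := by rw [← Real.exp_add]; norm_num
  nlinarith

lemma sqrt_le_self {x : ℝ} (hx : 1 ≤ x) : √x ≤ x := by
  rw [Real.sqrt_le_left (by linarith)]
  nlinarith

lemma rpow_half_add_inv_log {x : ℝ} (hx : 8 ≤ x) :
    x ^ (1 / 2 + 1 / Real.log x) = √x * Real.exp 1 := by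
  have hx0 : 0 < x := by linarith
  have h := two_le_log hx
  rw [Real.rpow_add hx0, ← Real.sqrt_eq_rpow, Real.rpow_def_of_pos hx0 (1 / Real.log x),
    mul_one_div_cancel (by linarith)]

lemma norm_trapezoidMellin_le {x : ℝ} (hx : 8 ≤ x) {s : ℂ}
    (hs : s.re = 1 / 2 + 1 / Real.log x) :
    ‖trapezoidMellin x √x s‖ ≤ 27 * √x / ‖s‖ ∧ ‖trapezoidMellin x √x s‖ ≤ 27 * x / ‖s‖ ^ 2 := by
  have hx0 : 0 < x := by linarith
  have hl := two_le_log hx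
  have hq : 1 ≤ √x := Real.one_le_sqrt.mpr (by linarith)
  have hqx := sqrt_le_self (show 1 ≤ x by linarith)
  have hqq : √x * √x = x := Real.mul_self_sqrt hx0.le
  have hδ : 0 < 1 / Real.log x := by positivity
  have hδ2 : 1 / Real.log x ≤ 1 / 2 := one_div_le_one_div_of_le two_pos hl
  have hre : 0 < s.re := by linarith
  have hs0 : 0 < ‖s‖ := norm_pos_iff.mpr (by rintro rfl; simp at hre)
  have hs1 := one_le_norm_add_one hre.le
  have hs2 := norm_le_norm_add_one hre.le
  have he := Real.exp_one_lt_d9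
  have hxs : x ^ s.re = √x * Real.exp 1 := by rw [hs, rpow_half_add_inv_log hx]
  have hxh : (x + √x) ^ s.re ≤ 2 * (√x * Real.exp 1) := by
    calc (x + √x) ^ s.re ≤ (2 * x) ^ s.re := by gcongr; linarith
      _ = 2 ^ s.re * x ^ s.re := Real.mul_rpow (by norm_num) hx0.le
      _ ≤ 2 ^ (1 : ℝ) * x ^ s.re := by gcongr; norm_num; linarith
      _ = _ := by rw [hxs, Real.rpow_one]
  have h2 : ‖(2 : ℂ) ^ (s + 1) - 1‖ ≤ 5 := by
    have h := norm_ofReal_cpow_add_one two_pos s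
    rw [ofReal_ofNat] at h
    refine (norm_sub_le _ _).trans ?_
    rw [h, norm_one]
    have : (2 : ℝ) ^ (s.re + 1) ≤ 2 ^ (2 : ℝ) :=
      Real.rpow_le_rpow_of_exponent_le one_le_two (by linarith)
    norm_num at this
    linarith
  have hqpos : 0 < √x := by linarith
  have hq0 : ‖((√x : ℝ) : ℂ)‖ = √x := by rw [norm_real, Real.norm_of_nonneg hqpos.le]
  constructor
  · have h3 := norm_cpow_sub_cpow_le hx0 hqpos.le hre
    have h4 : ‖(((x + √x : ℝ) : ℂ) ^ (s + 1) - (x : ℂ) ^ (s + 1)) / (√x : ℝ) -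
        ((2 : ℂ) ^ (s + 1) - 1)‖ ≤ 27 * √x * ‖s + 1‖ := by
      refine (norm_sub_le _ _).trans ?_
      rw [norm_div, hq0]
      have h5 : ‖((x + √x : ℝ) : ℂ) ^ (s + 1) - (x : ℂ) ^ (s + 1)‖ / √x ≤
          ‖s + 1‖ * (2 * (√x * 2.72)) := by
        rw [div_le_iff₀ hqpos]
        refine h3.trans ?_
        gcongr
        refine hxh.trans ?_
        gcongr
        linarith
      have h6 : 5 ≤ 5 * (√x * ‖s + 1‖) := by nlinarith
      linarith
    rw [trapezoidMellin, norm_div, norm_mul, div_le_div_iff₀ (by positivity) hs0]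
    nlinarith
  · have h3 : ‖((x + √x : ℝ) : ℂ) ^ (s + 1)‖ ≤ 4 * x * (√x * 2.72) := by
      rw [norm_ofReal_cpow_add_one (by linarith), Real.rpow_add (by linarith), Real.rpow_one]
      calc _ ≤ 2 * (√x * 2.72) * (2 * x) := by
            gcongr
            · refine hxh.trans ?_
              gcongr
              linarith
            · linarith
        _ = _ := by ring
    have h3' : ‖(x : ℂ) ^ (s + 1)‖ ≤ x * (√x * 2.72) := by
      rw [norm_ofReal_cpow_add_one hx0, Real.rpow_add hx0, Real.rpow_one, hxs, mul_comm]
      gcongr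
      linarith
    have h4 : ‖(((x + √x : ℝ) : ℂ) ^ (s + 1) - (x : ℂ) ^ (s + 1)) / (√x : ℝ) -
        ((2 : ℂ) ^ (s + 1) - 1)‖ ≤ 27 * x := by
      refine (norm_sub_le _ _).trans ?_
      rw [norm_div, hq0]
      have h5 : ‖((x + √x : ℝ) : ℂ) ^ (s + 1) - (x : ℂ) ^ (s + 1)‖ / √x ≤ 5 * x * 2.72 := by
        rw [div_le_iff₀ hqpos]
        refine (norm_sub_le _ _).trans ?_
        linarith
      linarith
    rw [trapezoidMellin, norm_div, norm_mul, sq]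
    gcongr

lemma inv_max_le_sum_poisson {J : ℕ} (hJ : 1 ≤ J) {t : ℝ} (ht : |t| ≤ 2 ^ J) :
    1 / max 1 |t| ≤ 4 * ∑ j ∈ Finset.range J, (2 : ℝ) ^ (j + 1) / ((2 ^ (j + 1)) ^ 2 + t ^ 2) := by
  induction J, hJ using Nat.le_induction with
  | base =>
    have h1 : t ^ 2 ≤ 4 := by rw [← sq_abs]; nlinarith [abs_nonneg t]
    have h2 : 1 / max 1 |t| ≤ 1 := by
      rw [div_le_one (by positivity)]
      exact le_max_left _ _
    rw [Finset.sum_range_one]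
    refine h2.trans ?_
    rw [← mul_div_assoc, le_div_iff₀ (by positivity)]
    norm_num
    linarith
  | succ J hJ ih =>
    rw [Finset.sum_range_succ, mul_add]
    by_cases h : |t| ≤ 2 ^ J
    · have : 0 ≤ (2 : ℝ) ^ (J + 1) / ((2 ^ (J + 1)) ^ 2 + t ^ 2) := by positivity
      linarith [ih h]
    · push Not at h
      have h0 : 0 ≤ ∑ j ∈ Finset.range J, (2 : ℝ) ^ (j + 1) / ((2 ^ (j + 1)) ^ 2 + t ^ 2) :=
        Finset.sum_nonneg fun j _ => by positivity
      have hp : (0 : ℝ) < 2 ^ J := by positivity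
      have h1 : 1 / max 1 |t| ≤ 4 * (2 ^ (J + 1) / ((2 ^ (J + 1)) ^ 2 + t ^ 2)) := by
        calc 1 / max 1 |t| ≤ 1 / 2 ^ J := by
              gcongr
              exact h.le.trans (le_max_right _ _)
          _ ≤ _ := by
            rw [← mul_div_assoc, div_le_div_iff₀ hp (by positivity), ← sq_abs t]
            have h2 : (2 : ℝ) ^ (J + 1) = 2 ^ J * 2 := pow_succ _ _
            rw [h2] at ht ⊢
            nlinarith [abs_nonneg t]
      linarith

lemma norm_trapezoidMellin_le_sum {x : ℝ} (hx : 8 ≤ x) {J : ℕ} (hJ1 : 1 ≤ J) (hJ : √x ≤ 2 ^ J)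
    (t : ℝ) : ‖trapezoidMellin x √x ((1 / 2 + 1 / Real.log x : ℝ) + t * I)‖ ≤
      216 * √x * ∑ j ∈ Finset.range J, (2 : ℝ) ^ (j + 1) / ((2 ^ (j + 1)) ^ 2 + t ^ 2) := by
  have hx0 : 0 < x := by linarith
  have hl := two_le_log hx
  have hδ : 0 < 1 / Real.log x := by positivity
  set s : ℂ := (1 / 2 + 1 / Real.log x : ℝ) + t * I with hs
  have hre : s.re = 1 / 2 + 1 / Real.log x := by simp [hs]
  have him : s.im = t := by simp [hs]
  obtain ⟨h1, h2⟩ := norm_trapezoidMellin_le hx hre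
  have hn1 : 1 / 2 ≤ ‖s‖ := by linarith [Complex.re_le_norm s]
  have hn2 : |t| ≤ ‖s‖ := him ▸ Complex.abs_im_le_norm s
  by_cases h : |t| ≤ 2 ^ J
  · have h3 := inv_max_le_sum_poisson hJ1 h
    have h4 : 1 / ‖s‖ ≤ 2 * (1 / max 1 |t|) := by
      rw [← mul_div_assoc, mul_one, div_le_div_iff₀ (by linarith) (by positivity), one_mul]
      exact max_le (by linarith) (by linarith)
    calc _ ≤ _ := h1
      _ = 27 * √x * (1 / ‖s‖) := by ring
      _ ≤ 27 * √x * (2 * (4 * ∑ j ∈ Finset.range J,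
          (2 : ℝ) ^ (j + 1) / ((2 ^ (j + 1)) ^ 2 + t ^ 2))) := by
        gcongr
        exact h4.trans (by gcongr)
      _ = _ := by ring
  · push Not at h
    obtain ⟨K, rfl⟩ : ∃ K, J = K + 1 := ⟨J - 1, by omega⟩
    set P : ℝ := 2 ^ (K + 1) with hP
    have hP0 : 0 < P := by positivity
    have ht0 : 0 < |t| := hP0.trans h
    have ht2 : 0 < t ^ 2 := by rw [← sq_abs]; positivity
    have h3 : P / (P ^ 2 + t ^ 2) ≤
        ∑ j ∈ Finset.range (K + 1), (2 : ℝ) ^ (j + 1) / ((2 ^ (j + 1)) ^ 2 + t ^ 2) :=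
      Finset.single_le_sum
        (f := fun j : ℕ => (2 : ℝ) ^ (j + 1) / ((2 ^ (j + 1)) ^ 2 + t ^ 2))
        (fun j _ => by positivity) (Finset.self_mem_range_succ K)
    have h4 : √x / ‖s‖ ^ 2 ≤ 2 * (P / (P ^ 2 + t ^ 2)) := by
      have h5 : t ^ 2 ≤ ‖s‖ ^ 2 := by rw [← sq_abs]; gcongr
      calc √x / ‖s‖ ^ 2 ≤ P / t ^ 2 := by gcongr
        _ ≤ _ := by
          rw [← mul_div_assoc, div_le_div_iff₀ ht2 (by positivity)]
          have h6 : P ^ 2 ≤ t ^ 2 := by rw [← sq_abs t]; gcongr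
          nlinarith
    calc _ ≤ _ := h2
      _ = 27 * √x * (√x / ‖s‖ ^ 2) := by
        rw [← mul_div_assoc, mul_assoc 27, Real.mul_self_sqrt hx0.le]
      _ ≤ 27 * √x * (2 * ∑ j ∈ Finset.range (K + 1),
          (2 : ℝ) ^ (j + 1) / ((2 ^ (j + 1)) ^ 2 + t ^ 2)) := by
        gcongr
        exact h4.trans (by gcongr)
      _ ≤ 27 * √x * (8 * ∑ j ∈ Finset.range (K + 1),
          (2 : ℝ) ^ (j + 1) / ((2 ^ (j + 1)) ^ 2 + t ^ 2)) := by
        gcongr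
        norm_num
      _ = _ := by ring

lemma exists_norm_integral_trapezoidMellin_le : ∃ C : ℝ, 0 < C ∧
    ∀ {N : ℕ} [NeZero N] {χ : DirichletCharacter ℂ N}, χ ≠ 1 → χ.IsPrimitive → χ⁻¹ = χ →
    (∀ s : ℂ, 1 / 2 < s.re → DirichletCharacter.LFunction χ s ≠ 0) → ∀ x : ℝ, 8 ≤ x →
    ‖∫ t : ℝ, trapezoidMellin x √x ((1 / 2 + 1 / Real.log x : ℝ) + t * I) *
      ((-logDeriv χ.LFunction ((1 / 2 + 1 / Real.log x : ℝ) + t * I)).re : ℂ)‖ ≤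
      C * √x * Real.log x * (Real.log N + Real.log x) := by
  obtain ⟨C, hC, hK⟩ := exists_integral_poisson_abs_le
  refine ⟨864 * C, by positivity, ?_⟩
  intro N _ χ hχ hp hinv hz x hx
  have hx0 : 0 < x := by linarith
  have hl := two_le_log hx
  have hδ : 0 < 1 / Real.log x := by positivity
  have hδ2 : 1 / Real.log x ≤ 1 / 2 := one_div_le_one_div_of_le two_pos hl
  have hN : 0 ≤ Real.log N := Real.log_natCast_nonneg N
  set σ : ℝ := 1 / 2 + 1 / Real.log x with hσ
  have hσ1 : 1 / 2 < σ := by linarith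
  have hσ2 : σ ≤ 1 := by linarith
  set J : ℕ := ⌊Real.log x⌋₊ + 1 with hJ
  have hJ1 : 1 ≤ J := by omega
  have hJl : Real.log x ≤ J := by rw [hJ]; push_cast; exact (Nat.lt_floor_add_one _).le
  have hJu : (J : ℝ) ≤ Real.log x + 1 := by
    rw [hJ]; push_cast; linarith [Nat.floor_le (show 0 ≤ Real.log x by linarith)]
  have hlog2 := Real.log_two_gt_d9
  have hlog2' := Real.log_two_lt_d9
  have hJx : √x ≤ 2 ^ J := by
    rw [← Real.log_le_log_iff (Real.sqrt_pos.mpr hx0) (by positivity), Real.log_sqrt hx0.le,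
      Real.log_pow]
    nlinarith
  have hP2 : ∀ j : ℕ, (2 : ℝ) ≤ 2 ^ (j + 1) := fun j => by
    rw [pow_succ]; nlinarith [one_le_pow₀ (one_le_two : (1 : ℝ) ≤ 2) (n := j)]
  set F : ℝ → ℝ := fun t => (-logDeriv χ.LFunction (σ + t * I)).re with hF
  have hI : ∀ j : ℕ, Integrable fun t : ℝ =>
      (2 : ℝ) ^ (j + 1) / ((2 ^ (j + 1)) ^ 2 + t ^ 2) * |F t| := by
    intro j
    refine (integrable_poisson_mul_re_logDeriv hχ hz hσ1 hσ2 (hP2 j)).abs.congr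
      (Eventually.of_forall fun t => ?_)
    show |_| = _
    rw [abs_mul, abs_of_nonneg (by positivity)]
  have hb : ∀ t : ℝ, ‖trapezoidMellin x √x (σ + t * I) * (F t : ℂ)‖ ≤ 216 * √x *
      ∑ j ∈ Finset.range J, (2 : ℝ) ^ (j + 1) / ((2 ^ (j + 1)) ^ 2 + t ^ 2) * |F t| := by
    intro t
    rw [norm_mul, norm_real, Real.norm_eq_abs, ← Finset.sum_mul, ← mul_assoc]
    gcongr
    exact norm_trapezoidMellin_le_sum hx hJ1 hJx t
  have hint : Integrable fun t : ℝ => 216 * √x *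
      ∑ j ∈ Finset.range J, (2 : ℝ) ^ (j + 1) / ((2 ^ (j + 1)) ^ 2 + t ^ 2) * |F t| :=
    (integrable_finsetSum _ fun j _ => hI j).const_mul _
  refine (norm_integral_le_of_norm_le hint (Eventually.of_forall hb)).trans ?_
  rw [integral_const_mul, integral_finsetSum _ fun j _ => hI j]
  have hj : ∀ j ∈ Finset.range J, ∫ t : ℝ, (2 : ℝ) ^ (j + 1) / ((2 ^ (j + 1)) ^ 2 + t ^ 2) * |F t|
      ≤ C * (2 * (Real.log N + Real.log x)) := by
    intro j hj
    refine (hK hχ hp hinv hz σ _ hσ1 hσ2 (hP2 j)).trans ?_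
    gcongr
    rw [Real.log_pow]
    have h1 : ((j + 1 : ℕ) : ℝ) ≤ J := by exact_mod_cast Finset.mem_range.mp hj
    have h2 : ((j + 1 : ℕ) : ℝ) * Real.log 2 ≤ Real.log x + 1 := by
      nlinarith [Nat.cast_nonneg (α := ℝ) (j + 1)]
    linarith
  calc 216 * √x * ∑ j ∈ Finset.range J, ∫ t : ℝ,
        (2 : ℝ) ^ (j + 1) / ((2 ^ (j + 1)) ^ 2 + t ^ 2) * |F t|
      ≤ 216 * √x * (J * (C * (2 * (Real.log N + Real.log x)))) := by
        gcongr
        refine (Finset.sum_le_sum hj).trans (le_of_eq ?_)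
        rw [Finset.sum_const, Finset.card_range, nsmul_eq_mul]
    _ ≤ 216 * √x * ((2 * Real.log x) * (C * (2 * (Real.log N + Real.log x)))) := by
        gcongr
        linarith
    _ = _ := by ring

section psi

variable {N : ℕ} [NeZero N] {χ : DirichletCharacter ℂ N}

lemma hasSum_trapezoid (hχ : χ ≠ 1) (hinv : χ⁻¹ = χ)
    (hz : ∀ s : ℂ, 1 / 2 < s.re → DirichletCharacter.LFunction χ s ≠ 0) {x h σ : ℝ} (hx : 1 ≤ x)
    (hh : 0 < h) (hσ : 1 / 2 < σ) (hσ1 : σ ≤ 1) :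
    HasSum (fun n : ℕ => χ (n : ZMod N) * (ArithmeticFunction.vonMangoldt n : ℂ) *
        trapezoid x h n)
      ((1 / Real.pi) • ∫ t : ℝ, trapezoidMellin x h (σ + t * I) *
        ((-logDeriv χ.LFunction (σ + t * I)).re : ℂ)) := by
  have hx0 : 0 < x := by linarith
  obtain ⟨C, hC⟩ := exists_norm_trapezoidMellin_le (b := σ + 1 / 2) hx hh
    (show 0 < σ - 1 / 2 by linarith)
  have hcpow : ContinuousOn (fun u : ℝ => (u : ℂ) ^ (-(2 * σ) : ℂ)) (Ioi 0) := fun u hu =>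
    (continuousAt_ofReal_cpow_const u _ (.inr (ne_of_gt hu))).continuousWithinAt
  have hV : ContinuousOn (fun u : ℝ => (u : ℂ) ^ (-(2 * σ) : ℂ) • trapezoid x h u⁻¹) (Ioi 0) :=
    hcpow.smul ((continuous_trapezoid x h).comp_continuousOn
      (continuousOn_inv₀.mono fun u hu => ne_of_gt hu))
  have key := hasSum_vonMangoldt_mul_symm (σ' := σ + 1 / 2) (C := C) hχ hinv hz hσ (by linarith)
    (by linarith) (by linarith) (continuous_trapezoid x h).continuousOn hV
    (fun s hs => hasMellin_trapezoid hx0 hh (by linarith))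
    (fun s hs => hasMellin_cpow_smul_trapezoid_inv hx0 hh (by linarith))
    (fun s h1 h2 => differentiableAt_trapezoidMellin hx0 hh (by linarith))
    (fun s h1 h2 => hC s (by linarith) h2)
  convert key using 2 with n
  rcases Nat.eq_zero_or_pos n with rfl | hn
  · simp
  · have hn1 : ((n : ℝ))⁻¹ ≤ 1 := inv_le_one_of_one_le₀ (Nat.one_le_cast.mpr hn)
    rw [trapezoid_eq_zero_of_le hx hh hn1, smul_zero, add_zero]

end psi

lemma norm_sum_vonMangoldt_sub_tsum_le {N : ℕ} {χ : DirichletCharacter ℂ N} {x : ℝ}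
    (hx : 8 ≤ x) {S : ℂ}
    (hS : HasSum (fun n : ℕ => χ (n : ZMod N) * (ArithmeticFunction.vonMangoldt n : ℂ) *
        trapezoid x √x n) S) :
    ‖(∑ n ∈ Finset.range (⌊x⌋₊ + 1), χ (n : ZMod N) * (ArithmeticFunction.vonMangoldt n : ℂ)) - S‖
      ≤ 4 * √x * Real.log x := by
  have hx0 : 0 < x := by linarith
  have hl := two_le_log hx
  have hq : 1 ≤ √x := Real.one_le_sqrt.mpr (by linarith)
  have hqx := sqrt_le_self (show 1 ≤ x by linarith)
  have hq0 : 0 < √x := by linarith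
  have hle : ⌊x⌋₊ + 1 ≤ ⌊x + √x⌋₊ + 1 := by gcongr; linarith
  have h1 : S = ∑ n ∈ Finset.range (⌊x + √x⌋₊ + 1),
      χ (n : ZMod N) * (ArithmeticFunction.vonMangoldt n : ℂ) * trapezoid x √x n := by
    refine hS.unique (hasSum_sum_of_ne_finset_zero fun n hn => ?_)
    rw [Finset.mem_range, not_lt, Nat.succ_le_iff, Nat.floor_lt (by linarith)] at hn
    rw [trapezoid_eq_zero_of_ge (by linarith) hq0 hn.le, mul_zero]
  have h2 : ∀ n ∈ Finset.range (⌊x⌋₊ + 1),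
      χ (n : ZMod N) * (ArithmeticFunction.vonMangoldt n : ℂ) * trapezoid x √x n =
      χ (n : ZMod N) * (ArithmeticFunction.vonMangoldt n : ℂ) := by
    intro n hn
    rw [Finset.mem_range, Nat.lt_succ_iff, Nat.le_floor_iff hx0.le] at hn
    rcases lt_or_ge n 2 with h | h
    · interval_cases n <;> simp
    · rw [trapezoid_eq_one hq0 (by exact_mod_cast h) hn, mul_one]
  rw [h1, ← Finset.sum_range_add_sum_Ico _ hle, Finset.sum_congr rfl h2, sub_add_cancel_left,
    norm_neg]
  have h3 : ∀ n ∈ Finset.Ico (⌊x⌋₊ + 1) (⌊x + √x⌋₊ + 1),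
      ‖χ (n : ZMod N) * (ArithmeticFunction.vonMangoldt n : ℂ) * trapezoid x √x n‖ ≤
        2 * Real.log x := by
    intro n hn
    rw [Finset.mem_Ico, Nat.succ_le_iff, Nat.lt_succ_iff, Nat.floor_lt hx0.le,
      Nat.le_floor_iff (by linarith)] at hn
    have h4 : ArithmeticFunction.vonMangoldt n ≤ 2 * Real.log x := by
      refine ArithmeticFunction.vonMangoldt_le_log.trans ?_
      calc Real.log n ≤ Real.log (x * x) := by
            apply Real.log_le_log (by linarith)
            nlinarith
        _ = _ := by rw [Real.log_mul hx0.ne' hx0.ne']; ring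
    have h5 : ‖(ArithmeticFunction.vonMangoldt n : ℂ)‖ ≤ 2 * Real.log x := by
      rwa [norm_real, Real.norm_of_nonneg ArithmeticFunction.vonMangoldt_nonneg]
    rw [norm_mul, norm_mul]
    calc _ ≤ 1 * (2 * Real.log x) * 1 := by
          gcongr
          · exact χ.norm_le_one _
          · exact norm_trapezoid_le (by linarith) hq0 hn.1.le
      _ = _ := by ring
  refine (norm_sum_le_of_le _ h3).trans ?_
  rw [Finset.sum_const, nsmul_eq_mul, Nat.card_Ico]
  have h6 : ((⌊x + √x⌋₊ + 1 - (⌊x⌋₊ + 1) : ℕ) : ℝ) ≤ 2 * √x := by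
    rw [Nat.cast_sub hle]
    push_cast
    linarith [Nat.floor_le (show 0 ≤ x + √x by linarith), Nat.lt_floor_add_one x]
  calc _ ≤ 2 * √x * (2 * Real.log x) := by gcongr
    _ = _ := by ring

/-- Under the Riemann hypothesis for `χ`, the twisted Chebyshev function is small. -/
lemma exists_norm_sum_vonMangoldt_le : ∃ C : ℝ, 0 < C ∧
    ∀ {N : ℕ} [NeZero N] {χ : DirichletCharacter ℂ N}, χ ≠ 1 → χ.IsPrimitive → χ⁻¹ = χ →
    (∀ s : ℂ, 1 / 2 < s.re → DirichletCharacter.LFunction χ s ≠ 0) → ∀ x : ℝ, 8 ≤ x →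
    ‖∑ n ∈ Finset.range (⌊x⌋₊ + 1), χ (n : ZMod N) * (ArithmeticFunction.vonMangoldt n : ℂ)‖ ≤
      C * √x * Real.log x * (Real.log N + Real.log x) := by
  obtain ⟨C, hC, h⟩ := exists_norm_integral_trapezoidMellin_le
  refine ⟨C + 4, by positivity, ?_⟩
  intro N _ χ hχ hp hinv hz x hx
  have hl := two_le_log hx
  have hN : 0 ≤ Real.log N := Real.log_natCast_nonneg N
  have hδ : 0 < 1 / Real.log x := by positivity
  have hδ2 : 1 / Real.log x ≤ 1 / 2 := one_div_le_one_div_of_le two_pos hl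
  have hq : 1 ≤ √x := Real.one_le_sqrt.mpr (by linarith)
  have hS := hasSum_trapezoid hχ hinv hz (x := x) (h := √x) (σ := 1 / 2 + 1 / Real.log x)
    (by linarith) (by linarith) (by linarith) (by linarith)
  have h1 := norm_sum_vonMangoldt_sub_tsum_le hx hS
  have h2 := h hχ hp hinv hz x hx
  have h3 : 1 / Real.pi ≤ 1 := by
    rw [div_le_one Real.pi_pos]; linarith [Real.pi_gt_three]
  have h4 := norm_le_norm_add_norm_sub' (∑ n ∈ Finset.range (⌊x⌋₊ + 1),
    χ (n : ZMod N) * (ArithmeticFunction.vonMangoldt n : ℂ)) _ |>.trans (add_le_add_right h1 _)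
  refine h4.trans ?_
  rw [norm_smul, Real.norm_of_nonneg (by positivity)]
  have h5 : 4 * √x * Real.log x ≤ 4 * √x * Real.log x * (Real.log N + Real.log x) :=
    le_mul_of_one_le_right (by positivity) (by linarith)
  have h6 := mul_le_mul h3 h2 (norm_nonneg _) zero_le_one
  calc _ ≤ _ := add_le_add h6 h5
    _ = _ := by ring

lemma deriv_ofReal_inv_log {t : ℝ} (ht : 1 < t) :
    HasDerivAt (fun u : ℝ ↦ (((Real.log u)⁻¹ : ℝ) : ℂ)) ((-(t * Real.log t ^ 2)⁻¹ : ℝ) : ℂ) t := by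
  have hl : 0 < Real.log t := Real.log_pos ht
  have h := ((Real.hasDerivAt_log (by linarith : t ≠ 0)).inv hl.ne').ofReal_comp
  refine HasDerivAt.congr_deriv h ?_
  congr 1
  field_simp

lemma norm_sum_prime_le_of_norm_sum_mul_log_le {a : ℕ → ℂ} {A x : ℝ} (hx : 2 ≤ x)
    (h : ∀ t ∈ Set.Icc 2 x, ‖∑ n ∈ Finset.range (⌊t⌋₊ + 1) with n.Prime, a n * Real.log n‖ ≤
      A * √t * Real.log t) :
    ‖∑ n ∈ Finset.range (⌊x⌋₊ + 1) with n.Prime, a n‖ ≤ 5 * A * √x := by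
  let c : ℕ → ℂ := fun n ↦ if n.Prime then a n * Real.log n else 0
  have hsum : ∀ t : ℝ, ∑ n ∈ Finset.range (⌊t⌋₊ + 1) with n.Prime, a n * Real.log n =
      ∑ n ∈ Finset.Icc 0 ⌊t⌋₊, c n := by
    intro t
    rw [Finset.sum_filter, Nat.range_succ_eq_Icc_zero]
  have hlog2 : (1 : ℝ) / 2 < Real.log 2 := by linarith [Real.log_two_gt_d9]
  have hlogt : ∀ t : ℝ, 2 ≤ t → (1 : ℝ) / 2 < Real.log t := fun t ht ↦
    hlog2.trans_le (Real.log_le_log two_pos ht)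
  have hA : 0 ≤ A := by
    have h2 := (norm_nonneg _).trans (h 2 ⟨le_rfl, hx⟩)
    have : (0 : ℝ) < √2 * Real.log 2 := by positivity
    rw [mul_assoc] at h2
    exact nonneg_of_mul_nonneg_left h2 this
  have habel := sum_mul_eq_sub_integral_mul₁ c (f := fun u : ℝ ↦ (((Real.log u)⁻¹ : ℝ) : ℂ))
    (by simp [c]) (by simp [c]) x
    (fun t ht ↦ (deriv_ofReal_inv_log (by linarith [ht.1])).differentiableAt)
    (by
      refine (ContinuousOn.integrableOn_Icc (f := fun t : ℝ ↦
        ((-(t * Real.log t ^ 2)⁻¹ : ℝ) : ℂ)) ?_).congr_fun ?_ measurableSet_Icc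
      · intro t ht
        have h1 : t ≠ 0 := by linarith [ht.1]
        have h2 : Real.log t ≠ 0 := by linarith [hlogt t ht.1]
        have h3 : t * Real.log t ^ 2 ≠ 0 := by positivity
        exact ContinuousAt.continuousWithinAt (by fun_prop)
      · intro t ht
        exact (deriv_ofReal_inv_log (by linarith [ht.1])).deriv.symm)
  have hleft : ∑ n ∈ Finset.range (⌊x⌋₊ + 1) with n.Prime, a n =
      ∑ k ∈ Finset.Icc 0 ⌊x⌋₊, (((Real.log k)⁻¹ : ℝ) : ℂ) * c k := by
    rw [Finset.sum_filter, Nat.range_succ_eq_Icc_zero]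
    refine Finset.sum_congr rfl fun n _ ↦ ?_
    by_cases hn : n.Prime
    · have h0 : (Real.log n : ℂ) ≠ 0 :=
        Complex.ofReal_ne_zero.mpr (Real.log_pos (by exact_mod_cast hn.one_lt)).ne'
      simp only [c, hn, if_true]
      rw [Complex.ofReal_inv, mul_comm, mul_assoc, mul_inv_cancel₀ h0, mul_one]
    · simp [c, hn]
  have hx0 : 0 < Real.log x := by linarith [hlogt x hx]
  have h1 : ‖(((Real.log x)⁻¹ : ℝ) : ℂ) * ∑ k ∈ Finset.Icc 0 ⌊x⌋₊, c k‖ ≤ A * √x := by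
    rw [norm_mul, Complex.norm_real, Real.norm_eq_abs, abs_of_pos (by positivity), ← hsum]
    calc (Real.log x)⁻¹ * _ ≤ (Real.log x)⁻¹ * (A * √x * Real.log x) := by
          gcongr; exact h x ⟨hx, le_rfl⟩
      _ = A * √x := by field_simp
  have hrp : IntervalIntegrable (fun t : ℝ ↦ 2 * A * t ^ (-1 / 2 : ℝ)) volume 2 x :=
    (intervalIntegral.intervalIntegrable_rpow' (by norm_num)).const_mul _
  have h2 : ‖∫ t in Set.Ioc 2 x, deriv (fun u : ℝ ↦ (((Real.log u)⁻¹ : ℝ) : ℂ)) t *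
      ∑ k ∈ Finset.Icc 0 ⌊t⌋₊, c k‖ ≤ ∫ t in Set.Ioc 2 x, 2 * A * t ^ (-1 / 2 : ℝ) := by
    refine norm_integral_le_of_norm_le
      ((intervalIntegrable_iff_integrableOn_Ioc_of_le hx).mp hrp) ?_
    refine (ae_restrict_iff' measurableSet_Ioc).mpr (Eventually.of_forall fun t ht ↦ ?_)
    have ht0 : 0 < t := by linarith [ht.1]
    have hlt := hlogt t ht.1.le
    have hl0 : 0 < Real.log t := by linarith
    rw [(deriv_ofReal_inv_log (by linarith [ht.1])).deriv, norm_mul, Complex.norm_real,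
      Real.norm_eq_abs, abs_neg, abs_of_pos (by positivity), ← hsum]
    calc (t * Real.log t ^ 2)⁻¹ * _ ≤ (t * Real.log t ^ 2)⁻¹ * (A * √t * Real.log t) := by
          gcongr; exact h t ⟨ht.1.le, ht.2⟩
      _ = A * (√t / t) * (1 / Real.log t) := by field_simp
      _ ≤ A * (√t / t) * 2 := by
          gcongr
          rw [div_le_iff₀ hl0]; linarith
      _ = 2 * A * t ^ (-1 / 2 : ℝ) := by
          rw [Real.sqrt_div_self', show (-1 / 2 : ℝ) = -(1 / 2) by norm_num, Real.rpow_neg ht0.le,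
            ← Real.sqrt_eq_rpow]
          ring
  have h3 : ∫ t in Set.Ioc 2 x, 2 * A * t ^ (-1 / 2 : ℝ) ≤ 4 * A * √x := by
    rw [← intervalIntegral.integral_of_le hx, intervalIntegral.integral_const_mul,
      integral_rpow (Or.inl (by norm_num)), show (-1 / 2 : ℝ) + 1 = 1 / 2 by norm_num,
      ← Real.sqrt_eq_rpow, ← Real.sqrt_eq_rpow]
    have : 0 ≤ A * √2 := by positivity
    linarith
  rw [hleft, habel]
  refine (norm_sub_le _ _).trans ?_
  linarith

lemma norm_sum_prime_mul_log_le {a : ℕ → ℂ} (ha : ∀ n, ‖a n‖ ≤ 1) {t : ℝ} (ht : 0 ≤ t) :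
    ‖∑ n ∈ Finset.range (⌊t⌋₊ + 1) with n.Prime, a n * Real.log n‖ ≤ Real.log 4 * t := by
  refine le_trans ?_ (Chebyshev.theta_le_log4_mul_x ht)
  rw [Chebyshev.theta_eq_sum_Icc, Nat.range_succ_eq_Icc_zero]
  refine (norm_sum_le _ _).trans (Finset.sum_le_sum fun n _ ↦ ?_)
  rw [norm_mul, Complex.norm_real, Real.norm_eq_abs, abs_of_nonneg (Real.log_natCast_nonneg n)]
  exact mul_le_of_le_one_left (Real.log_natCast_nonneg n) (ha n)

lemma norm_sum_vonMangoldt_sub_sum_prime_le {a : ℕ → ℂ} (ha : ∀ n, ‖a n‖ ≤ 1) {t : ℝ}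
    (ht : 1 ≤ t) :
    ‖∑ n ∈ Finset.range (⌊t⌋₊ + 1), a n * (ArithmeticFunction.vonMangoldt n : ℂ) -
      ∑ n ∈ Finset.range (⌊t⌋₊ + 1) with n.Prime, a n * Real.log n‖ ≤ 2 * √t * Real.log t := by
  refine le_trans ?_ ((le_abs_self _).trans (Chebyshev.abs_psi_sub_theta_le_sqrt_mul_log ht))
  rw [Chebyshev.psi_sub_theta_eq_sum_not_prime]
  have h1 : ∑ n ∈ Finset.range (⌊t⌋₊ + 1), a n * (ArithmeticFunction.vonMangoldt n : ℂ) -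
      ∑ n ∈ Finset.range (⌊t⌋₊ + 1) with n.Prime, a n * Real.log n =
      ∑ n ∈ Finset.Ioc 0 ⌊t⌋₊ with ¬ n.Prime, a n * (ArithmeticFunction.vonMangoldt n : ℂ) := by
    rw [sub_eq_iff_eq_add, Finset.sum_filter, Finset.sum_filter, Nat.range_succ_eq_Icc_zero,
      ← Finset.add_sum_Ioc_eq_sum_Icc (Nat.zero_le _),
      ← Finset.add_sum_Ioc_eq_sum_Icc (Nat.zero_le _)]
    simp only [Nat.not_prime_zero, if_false, ArithmeticFunction.map_zero, Complex.ofReal_zero,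
      mul_zero, zero_add]
    rw [← Finset.sum_add_distrib]
    refine Finset.sum_congr rfl fun n _ ↦ ?_
    by_cases hn : n.Prime
    · simp [hn, ArithmeticFunction.vonMangoldt_apply_prime hn]
    · simp [hn]
  rw [h1]
  refine (norm_sum_le _ _).trans (Finset.sum_le_sum fun n _ ↦ ?_)
  rw [norm_mul, Complex.norm_real, Real.norm_eq_abs,
    abs_of_nonneg ArithmeticFunction.vonMangoldt_nonneg]
  exact mul_le_of_le_one_left ArithmeticFunction.vonMangoldt_nonneg (ha n)

/-- Prime sums over a primitive quadratic character whose L-function does not vanish to the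
right of the critical line. -/
lemma exists_norm_sum_prime_le : ∃ C : ℝ, 0 < C ∧
    ∀ {N : ℕ} [NeZero N] {χ : DirichletCharacter ℂ N}, χ ≠ 1 → χ.IsPrimitive → χ⁻¹ = χ →
    (∀ s : ℂ, 1 / 2 < s.re → DirichletCharacter.LFunction χ s ≠ 0) → ∀ x : ℝ, 3 ≤ x →
    ‖∑ p ∈ Finset.range (⌊x⌋₊ + 1) with p.Prime, χ (p : ZMod N)‖ ≤
      C * √x * (Real.log N + Real.log x) := by
  obtain ⟨C, hC, hK⟩ := exists_norm_sum_vonMangoldt_le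
  refine ⟨5 * (C + 12), by positivity, ?_⟩
  intro N _ χ hχ hp hinv hz x hx
  have hN : 0 ≤ Real.log N := Real.log_natCast_nonneg N
  have hlx : 1 ≤ Real.log x := by
    rw [Real.le_log_iff_exp_le (by linarith)]
    linarith [Real.exp_one_lt_d9]
  have ha : ∀ n : ℕ, ‖χ (n : ZMod N)‖ ≤ 1 := fun n ↦ χ.norm_le_one _
  have key := norm_sum_prime_le_of_norm_sum_mul_log_le
    (a := fun n ↦ χ (n : ZMod N)) (A := (C + 12) * (Real.log N + Real.log x))
    (by linarith : 2 ≤ x) (fun t ht ↦ ?_)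
  · refine key.trans (le_of_eq (by ring))
  have hlog2 : (1 : ℝ) / 2 ≤ Real.log t := by
    linarith [Real.log_two_gt_d9, Real.log_le_log two_pos ht.1]
  have htx : Real.log t ≤ Real.log x := Real.log_le_log (by linarith [ht.1]) ht.2
  have hst : 0 ≤ √t * Real.log t := by positivity
  rcases le_or_gt 8 t with h8 | h8
  · have h1 := hK hχ hp hinv hz t h8
    have h2 := norm_sum_vonMangoldt_sub_sum_prime_le ha (by linarith : 1 ≤ t)
    have h3 := norm_sub_norm_le (∑ n ∈ Finset.range (⌊t⌋₊ + 1) with n.Prime,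
      χ (n : ZMod N) * Real.log n) (∑ n ∈ Finset.range (⌊t⌋₊ + 1), χ (n : ZMod N) *
        (ArithmeticFunction.vonMangoldt n : ℂ))
    rw [norm_sub_rev] at h3
    calc _ ≤ C * √t * Real.log t * (Real.log N + Real.log t) + 2 * √t * Real.log t := by
          linarith
      _ ≤ C * √t * Real.log t * (Real.log N + Real.log x) +
          12 * √t * Real.log t * (Real.log N + Real.log x) := by
          have h4 : C * √t * Real.log t * (Real.log N + Real.log t) ≤
            C * √t * Real.log t * (Real.log N + Real.log x) := by gcongr
          nlinarith
      _ = _ := by ring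
  · have h1 := norm_sum_prime_mul_log_le ha (by linarith [ht.1] : 0 ≤ t)
    have h4 : Real.log 4 ≤ 2 := by
      rw [show (4 : ℝ) = 2 ^ 2 by norm_num, Real.log_pow]
      push_cast
      linarith [Real.log_two_lt_d9]
    have h5 : √t ≤ 3 := by
      rw [Real.sqrt_le_left (by norm_num)]; linarith
    have h6 : √t * √t = t := Real.mul_self_sqrt (by linarith [ht.1])
    have h7 : 0 ≤ √t := Real.sqrt_nonneg t
    calc _ ≤ Real.log 4 * t := h1
      _ ≤ 2 * t := by gcongr; linarith [ht.1]
      _ ≤ 6 * √t := by nlinarith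
      _ ≤ 12 * (√t * Real.log t) := by nlinarith
      _ ≤ 12 * (√t * Real.log t) * (Real.log N + Real.log x) := by
          nlinarith
      _ ≤ (C + 12) * (√t * Real.log t) * (Real.log N + Real.log x) := by
          gcongr; linarith
      _ = _ := by ring

lemma exists_dirichletCharacter_eq_jacobiSym {d : ℕ} (hd : d ≠ 0) :
    ∃ χ : DirichletCharacter ℂ (4 * d), ∀ n : ℕ, n.Coprime (4 * d) →
      χ (n : ZMod (4 * d)) = (J(d | n) : ℂ) := by
  have : NeZero (4 * d) := ⟨by positivity⟩
  have hodd : ∀ n : ℕ, n.Coprime (4 * d) → Odd n := fun n hn ↦ by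
    rw [← Nat.not_even_iff_odd, even_iff_two_dvd]
    intro h
    have := Nat.dvd_gcd h (Dvd.dvd.mul_right (by norm_num : 2 ∣ 4) d)
    rw [hn] at this
    omega
  have hmod : ∀ n : ℕ, n.Coprime (4 * d) → J(d | n % (4 * d)) = J(d | n) := fun n hn ↦
    (jacobiSym.mod_right' d (hodd n hn)).symm
  let g : (ZMod (4 * d))ˣ →* ℂ :=
    { toFun := fun u ↦ (J(d | (u : ZMod (4 * d)).val) : ℂ)
      map_one' := by
        rw [Units.val_one, ZMod.val_one'' (by omega), jacobiSym.one_right, Int.cast_one]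
      map_mul' := fun u v ↦ by
        have hu := ZMod.val_coe_unit_coprime u
        have hv := ZMod.val_coe_unit_coprime v
        have : NeZero (u : ZMod (4 * d)).val := ⟨(hodd _ hu).pos.ne'⟩
        have : NeZero (v : ZMod (4 * d)).val := ⟨(hodd _ hv).pos.ne'⟩
        rw [Units.val_mul, ZMod.val_mul, hmod _ (hu.mul_left hv), jacobiSym.mul_right,
          Int.cast_mul] }
  refine ⟨MulChar.ofUnitHom g.toHomUnits, fun n hn ↦ ?_⟩
  have h := MulChar.ofUnitHom_coe g.toHomUnits (ZMod.unitOfCoprime n hn)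
  rw [ZMod.coe_unitOfCoprime] at h
  rw [h, MonoidHom.coe_toHomUnits]
  simp only [g, MonoidHom.coe_mk, OneHom.coe_mk, ZMod.coe_unitOfCoprime, ZMod.val_natCast]
  rw [hmod n hn]

/-- A squarefree `d > 1` is a quadratic nonresidue modulo some number. -/
lemma exists_jacobiSym_eq_neg_one {d : ℕ} (hd : Squarefree d) (h1 : d ≠ 1) :
    ∃ n : ℕ, n.Coprime (4 * d) ∧ J(d | n) = -1 := by
  by_cases hq : ∃ q, q.Prime ∧ q ≠ 2 ∧ q ∣ d
  · obtain ⟨q, hqp, hq2, m, rfl⟩ := hq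
    have : Fact q.Prime := ⟨hqp⟩
    have hm0 : m ≠ 0 := by rintro rfl; simp at hd
    have hqm : q.Coprime m := Nat.coprime_of_squarefree_mul hd
    have hq4 : q.Coprime (4 * m) :=
      Nat.Coprime.mul_right (((Nat.coprime_primes hqp Nat.prime_two).mpr hq2).pow_right 2) hqm
    obtain ⟨a, ha⟩ := quadraticChar_exists_neg_one (F := ZMod q) (by rwa [ZMod.ringChar_zmod_n])
    obtain ⟨n, hn1, hn2⟩ := Nat.chineseRemainder hq4 a.val 1
    have hqn : (n : ZMod q) = a := by
      rw [(ZMod.natCast_eq_natCast_iff n a.val q).mpr hn1, ZMod.natCast_zmod_val]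
    have hn4 : n % 4 = 1 := (hn2.of_mul_right m)
    have hodd : Odd n := Nat.odd_iff.mpr (by omega)
    have hqJ : J(n | q) = -1 := by
      rw [← jacobiSym.legendreSym.to_jacobiSym, legendreSym, Int.cast_natCast, hqn, ha]
    refine ⟨n, ?_, ?_⟩
    · have h1 : n.Coprime (4 * m) := by
        rw [Nat.coprime_iff_gcd_eq_one, hn2.gcd_eq, Nat.gcd_one_left]
      have h2 : n.Coprime q := by
        rw [Nat.coprime_comm, hqp.coprime_iff_not_dvd, ← ZMod.natCast_eq_zero_iff, hqn]
        rintro rfl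
        simp at ha
      rw [mul_left_comm]
      exact h2.mul_right h1
    · rw [Nat.cast_mul, jacobiSym.mul_left, jacobiSym.mod_right' m hodd,
        show n % (4 * m) = 1 from Eq.trans hn2 (Nat.mod_eq_of_lt (by omega)), jacobiSym.one_right,
        mul_one, ← jacobiSym.quadratic_reciprocity_one_mod_four hn4
          (hqp.odd_of_ne_two hq2), hqJ]
  · push Not at hq
    have hd2 : d = 2 := by
      have h2 : ∀ q, q.Prime → q ∣ d → q = 2 := fun q h h' ↦ by
        by_contra h3; exact hq q h h3 h'
      obtain ⟨q, hqp, hqd⟩ := Nat.exists_prime_and_dvd h1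
      obtain rfl := h2 q hqp hqd
      obtain ⟨m, rfl⟩ := hqd
      rcases eq_or_ne m 1 with rfl | hm
      · rfl
      obtain ⟨r, hr, hrm⟩ := Nat.exists_prime_and_dvd hm
      obtain rfl := h2 r hr (hrm.mul_left _)
      exact absurd (hd 2 (mul_dvd_mul_left _ hrm)) hr.not_isUnit
    subst hd2
    exact ⟨5, by norm_num, by norm_num⟩

lemma exists_primitive_quadratic {d : ℕ} (hd : Squarefree d) (h1 : d ≠ 1) :
    ∃ (N : ℕ) (_ : NeZero N) (χ : DirichletCharacter ℂ N), N ≤ 4 * d ∧ χ ≠ 1 ∧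
      χ.IsPrimitive ∧ χ⁻¹ = χ ∧ ∀ p : ℕ, p.Coprime (4 * d) → χ (p : ZMod N) = (J(d | p) : ℂ) := by
  have : NeZero (4 * d) := ⟨mul_ne_zero (by norm_num) hd.ne_zero⟩
  obtain ⟨ψ, hψ⟩ := exists_dirichletCharacter_eq_jacobiSym hd.ne_zero
  obtain ⟨n, hn, hnJ⟩ := exists_jacobiSym_eq_neg_one hd h1
  have hval : ∀ p : ℕ, p.Coprime (4 * d) →
      ψ.primitiveCharacter (p : ZMod ψ.conductor) = (J(d | p) : ℂ) := fun p hp ↦ by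
    have := ψ.primitiveCharacter_apply_of_isCoprime (Nat.isCoprime_iff_coprime.mpr hp)
    push_cast at this
    rw [this, hψ p hp]
  have hN : NeZero ψ.conductor := ⟨ψ.conductor_ne_zero⟩
  have hsq : ψ⁻¹ = ψ := by
    refine MulChar.IsQuadratic.inv fun a ↦ ?_
    by_cases ha : IsUnit a
    · right
      obtain ⟨u, rfl⟩ := ha
      have hu := ZMod.val_coe_unit_coprime u
      have h := hψ _ hu
      rw [ZMod.natCast_zmod_val] at h
      rw [h]
      have hg : (d : ℤ).gcd (u : ZMod (4 * d)).val = 1 := by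
        rw [Int.gcd_natCast_natCast]
        exact (hu.coprime_dvd_right (Dvd.intro_left _ rfl)).symm
      rcases jacobiSym.eq_one_or_neg_one hg with h | h <;> simp [h]
    · left; exact ψ.map_nonunit ha
  refine ⟨ψ.conductor, hN, ψ.primitiveCharacter, Nat.le_of_dvd (Nat.pos_of_neZero _)
    ψ.conductor_dvd_level, ?_, ψ.primitiveCharacter_isPrimitive, ?_, hval⟩
  · intro h
    have h2 := hval n hn
    have hu : IsUnit (n : ZMod ψ.conductor) :=
      (ZMod.isUnit_iff_coprime _ _).mpr (hn.coprime_dvd_right ψ.conductor_dvd_level)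
    rw [h, MulChar.one_apply hu, hnJ] at h2
    norm_num at h2
  · apply DirichletCharacter.changeLevel_injective ψ.conductor_dvd_level
    rw [map_inv, DirichletCharacter.changeLevel_primitiveCharacter, hsq]

lemma LFunction_ne_zero_of_GRH (h : GRH) {N : ℕ} [NeZero N] {χ : DirichletCharacter ℂ N}
    (hχ : χ ≠ 1) {s : ℂ} (hs : 1 / 2 < s.re) : DirichletCharacter.LFunction χ s ≠ 0 := by
  rcases lt_or_ge s.re 1 with h1 | h1
  · intro h0
    exact hs.ne' (h N χ s (by linarith) h1 h0)
  · exact DirichletCharacter.LFunction_ne_zero_of_one_le_re χ (Or.inl hχ) h1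

lemma exists_abs_sum_jacobiSym_le (h : GRH) : ∃ C : ℝ, 0 < C ∧ ∀ x y : ℝ, 3 ≤ y → y ≤ x →
    ∀ d : ℕ, Squarefree d → d ≠ 1 → d ≤ 4 ^ ⌊y⌋₊ → (∀ q, q.Prime → q ∣ d → (q : ℝ) ≤ y) →
    |∑ p ∈ Finset.Ioc ⌊y⌋₊ ⌊x⌋₊ with p.Prime, (J(d | p) : ℝ)| ≤ C * √x * (Real.log x + y) := by
  obtain ⟨C, hC, hK⟩ := exists_norm_sum_prime_le
  refine ⟨6 * C, by positivity, ?_⟩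
  intro x y hy hyx d hsq hd1 hd4 hdq
  obtain ⟨N, hN, χ, hNd, hχ, hp, hinv, hval⟩ := exists_primitive_quadratic hsq hd1
  have hz := fun s ↦ LFunction_ne_zero_of_GRH (χ := χ) h hχ (s := s)
  have h1 := hK hχ hp hinv hz x (hy.trans hyx)
  have h2 := hK hχ hp hinv hz y hy
  have hlogN : Real.log N ≤ 3 * y := by
    have hl4 : Real.log 4 ≤ 2 := by
      rw [show (4 : ℝ) = 2 ^ 2 by norm_num, Real.log_pow]
      push_cast
      linarith [Real.log_two_lt_d9]
    have hl40 : 0 ≤ Real.log 4 := Real.log_nonneg (by norm_num)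
    have h4 : (N : ℝ) ≤ 4 ^ (⌊y⌋₊ + 1) := by
      rw [pow_succ']
      exact_mod_cast hNd.trans (Nat.mul_le_mul_left 4 hd4)
    calc Real.log N ≤ Real.log (4 ^ (⌊y⌋₊ + 1)) :=
          Real.log_le_log (by exact_mod_cast Nat.pos_of_neZero N) h4
      _ = (⌊y⌋₊ + 1) * Real.log 4 := by rw [Real.log_pow]; push_cast; ring
      _ ≤ (y + 1) * 2 := by
          gcongr
          exact Nat.floor_le (by linarith)
      _ ≤ 3 * y := by linarith
  have hfl : ⌊y⌋₊ ≤ ⌊x⌋₊ := Nat.floor_le_floor hyx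
  have hsplit : ∑ p ∈ Finset.Ioc ⌊y⌋₊ ⌊x⌋₊ with p.Prime, χ (p : ZMod N) =
      ∑ p ∈ Finset.range (⌊x⌋₊ + 1) with p.Prime, χ (p : ZMod N) -
        ∑ p ∈ Finset.range (⌊y⌋₊ + 1) with p.Prime, χ (p : ZMod N) := by
    simp only [Finset.sum_filter]
    rw [← Finset.sum_Ico_eq_sub _ (by omega)]
    congr 1
    ext p
    simp only [Finset.mem_Ioc, Finset.mem_Ico]
    omega
  have hcast : ((∑ p ∈ Finset.Ioc ⌊y⌋₊ ⌊x⌋₊ with p.Prime, (J(d | p) : ℝ) : ℝ) : ℂ) =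
      ∑ p ∈ Finset.Ioc ⌊y⌋₊ ⌊x⌋₊ with p.Prime, χ (p : ZMod N) := by
    push_cast
    refine Finset.sum_congr rfl fun p hp ↦ ?_
    obtain ⟨hp1, hpp⟩ := Finset.mem_filter.mp hp
    have hyp : y < p := (Nat.floor_lt (by linarith)).mp (Finset.mem_Ioc.mp hp1).1
    rw [hval p]
    refine Nat.Coprime.mul_right (show p.Coprime (2 ^ 2) from Nat.Coprime.pow_right 2 ?_) ?_
    · refine (Nat.coprime_primes hpp Nat.prime_two).mpr ?_
      rintro rfl
      norm_num at hyp
      linarith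
    · rw [hpp.coprime_iff_not_dvd]
      intro hdvd
      linarith [hdq p hpp hdvd]
  have hlxy : Real.log y ≤ Real.log x := Real.log_le_log (by linarith) hyx
  have hly : 0 ≤ Real.log y := Real.log_nonneg (by linarith)
  have hsy : √y ≤ √x := Real.sqrt_le_sqrt hyx
  have h2' : C * √y * (Real.log N + Real.log y) ≤ C * √x * (3 * y + Real.log x) := by
    have := Real.log_natCast_nonneg N
    gcongr
  have h1' : C * √x * (Real.log N + Real.log x) ≤ C * √x * (3 * y + Real.log x) := by gcongr
  have hX : 0 ≤ C * √x * Real.log x := by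
    have : 0 ≤ Real.log x := hly.trans hlxy
    positivity
  rw [← Real.norm_eq_abs, ← Complex.norm_real, hcast, hsplit]
  refine (norm_sub_le _ _).trans ?_
  nlinarith

/-- Plancherel identity on the group `{-1, 1}^ι` for the distribution of sign patterns. -/
lemma sum_sq_count_sub_eq {α ι : Type*} [Fintype ι] [DecidableEq ι] (T : Finset α)
    (b : α → ι → Bool) :
    (2 : ℝ) ^ Fintype.card ι * ∑ σ : ι → Bool, ((∑ p ∈ T, if b p = σ then (1 : ℝ) else 0) -
      ((2 : ℝ) ^ Fintype.card ι)⁻¹ * T.card) ^ 2 =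
    ∑ S ∈ (Finset.univ : Finset ι).powerset.erase ∅,
      (∑ p ∈ T, ∏ i ∈ S, (signB (b p i) : ℝ)) ^ 2 := by
  have hk : (2 : ℝ) ^ Fintype.card ι ≠ 0 := by positivity
  have hN1 : ∑ σ : ι → Bool, (∑ p ∈ T, if b p = σ then (1 : ℝ) else 0) = T.card := by
    rw [Finset.sum_comm]
    simp
  have hN2 : ∑ σ : ι → Bool, (∑ p ∈ T, if b p = σ then (1 : ℝ) else 0) ^ 2 =
      ∑ p ∈ T, ∑ r ∈ T, if b p = b r then (1 : ℝ) else 0 := by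
    simp_rw [sq, Finset.sum_mul_sum]
    rw [Finset.sum_comm]
    refine Finset.sum_congr rfl fun p _ ↦ ?_
    rw [Finset.sum_comm]
    refine Finset.sum_congr rfl fun r _ ↦ ?_
    simp [eq_comm]
  have hcard : ∑ _σ : ι → Bool, (1 : ℝ) = 2 ^ Fintype.card ι := by simp
  have hS : ∑ S ∈ (Finset.univ : Finset ι).powerset,
      (∑ p ∈ T, ∏ i ∈ S, (signB (b p i) : ℝ)) ^ 2 =
      2 ^ Fintype.card ι * ∑ p ∈ T, ∑ r ∈ T, if b p = b r then (1 : ℝ) else 0 := by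
    simp_rw [sq, Finset.sum_mul_sum, ← Finset.prod_mul_distrib]
    rw [Finset.sum_comm, Finset.mul_sum]
    refine Finset.sum_congr rfl fun p _ ↦ ?_
    rw [Finset.sum_comm, Finset.mul_sum]
    refine Finset.sum_congr rfl fun r _ ↦ ?_
    rw [← Finset.prod_one_add]
    split_ifs with hpr
    · rw [hpr]
      have : ∀ i, 1 + (signB (b r i) : ℝ) * signB (b r i) = 2 := fun i ↦ by
        cases b r i <;> norm_num [signB]
      simp [this]
    · obtain ⟨i, hi⟩ := Function.ne_iff.mp hpr
      rw [mul_zero]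
      refine Finset.prod_eq_zero (Finset.mem_univ i) ?_
      revert hi
      cases b p i <;> cases b r i <;> norm_num [signB]
  rw [← Finset.sum_erase_add _ _ (Finset.empty_mem_powerset _)] at hS
  simp only [Finset.prod_empty, Finset.sum_const, nsmul_eq_mul, mul_one] at hS
  rw [eq_sub_of_add_eq hS, ← hN2]
  simp_rw [sub_sq]
  rw [Finset.sum_add_distrib, Finset.sum_sub_distrib, ← Finset.sum_mul, ← Finset.mul_sum, hN1,
    ← mul_one ((((2 : ℝ) ^ Fintype.card ι)⁻¹ * (T.card : ℝ)) ^ 2), ← Finset.mul_sum, hcard]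
  field_simp
  ring

lemma sum_sq_count_sub_le {α ι : Type*} [Fintype ι] [DecidableEq ι] (T : Finset α)
    (b : α → ι → Bool) {M : ℝ} (hM0 : 0 ≤ M)
    (hM : ∀ S : Finset ι, S.Nonempty → (∑ p ∈ T, ∏ i ∈ S, (signB (b p i) : ℝ)) ^ 2 ≤ M) :
    ∑ σ : ι → Bool, ((∑ p ∈ T, if b p = σ then (1 : ℝ) else 0) -
      ((2 : ℝ) ^ Fintype.card ι)⁻¹ * T.card) ^ 2 ≤ M := by
  have hk : (0 : ℝ) < 2 ^ Fintype.card ι := by positivity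
  refine le_of_mul_le_mul_left ?_ hk
  rw [sum_sq_count_sub_eq]
  calc _ ≤ ∑ S ∈ (Finset.univ : Finset ι).powerset.erase ∅, M :=
        Finset.sum_le_sum fun S hS ↦ hM S (Finset.nonempty_iff_ne_empty.mpr
          (Finset.ne_of_mem_erase hS))
    _ ≤ ∑ S ∈ (Finset.univ : Finset ι).powerset, M :=
        Finset.sum_le_sum_of_subset_of_nonneg (Finset.erase_subset _ _)
          fun _ _ _ ↦ hM0
    _ = _ := by simp

lemma jacobiSym_prod_left {ι : Type*} (S : Finset ι) (f : ι → ℕ) (p : ℕ) :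
    J(((∏ i ∈ S, f i : ℕ) : ℤ) | p) = ∏ i ∈ S, J(f i | p) := by
  classical
  induction S using Finset.induction_on with
  | empty => simp [jacobiSym.one_left]
  | insert i S hi ih =>
    rw [Finset.prod_insert hi, Finset.prod_insert hi, Nat.cast_mul, jacobiSym.mul_left, ih]

lemma legendreSym_eq_signB_decide {p : ℕ} [Fact p.Prime] {q : ℕ} (h : ¬ p ∣ q) :
    legendreSym p q = signB (decide (J(q | p) = 1)) := by
  have h0 : ((q : ℤ) : ZMod p) ≠ 0 := by
    rwa [Int.cast_natCast, Ne, ZMod.natCast_eq_zero_iff]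
  rw [← jacobiSym.legendreSym.to_jacobiSym]
  rcases legendreSym.eq_one_or_neg_one p h0 with h | h <;> simp [h, signB]

lemma signB_injective : Function.Injective signB := by
  intro a b
  cases a <;> cases b <;> simp [signB]

lemma prod_properties {y : ℝ} (hy : 0 ≤ y) {S : Finset ℕ} (hS : S.Nonempty)
    (hSy : S ⊆ (Finset.range (⌊y⌋₊ + 1)).filter Nat.Prime) :
    Squarefree (∏ q ∈ S, q) ∧ ∏ q ∈ S, q ≠ 1 ∧ ∏ q ∈ S, q ≤ 4 ^ ⌊y⌋₊ ∧
      ∀ q, q.Prime → q ∣ ∏ q ∈ S, q → (q : ℝ) ≤ y := by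
  have hp : ∀ q ∈ S, q.Prime := fun q hq ↦ (Finset.mem_filter.mp (hSy hq)).2
  refine ⟨?_, ?_, ?_, ?_⟩
  · refine Finset.squarefree_prod_of_pairwise_isCoprime (fun q hq r hr hqr ↦ ?_)
      fun q hq ↦ (hp q hq).squarefree
    exact Nat.coprime_iff_isRelPrime.mp ((Nat.coprime_primes (hp q hq) (hp r hr)).mpr hqr)
  · obtain ⟨q, hq⟩ := hS
    intro h
    exact (hp q hq).one_lt.ne' (Nat.dvd_one.mp (h ▸ Finset.dvd_prod_of_mem _ hq))
  · refine le_trans (Nat.le_of_dvd (primorial_pos _) ?_) (primorial_le_four_pow _)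
    exact Finset.prod_dvd_prod_of_subset _ _ _ hSy
  · intro q hq hdvd
    obtain ⟨r, hr, hqr⟩ := (hq.prime.dvd_finsetProd_iff _).mp hdvd
    rw [(Nat.prime_dvd_prime_iff_eq hq (hp r hr)).mp hqr]
    have := (Finset.mem_filter.mp (hSy hr)).1
    exact (Nat.le_floor_iff hy).mp (by simpa [Nat.lt_succ_iff] using this)

end QRVar

/-- Assuming GRH, there is an absolute constant `C` such that for all reals `x ≥ y ≥ 3`,
with `𝒬` the set of primes `q ≤ y`, `P` the number of primes `y < p ≤ x`, and
`N(σ)` the number of primes `y < p ≤ x` with `(q/p) = σ_q` for all `q ∈ 𝒬`, one has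
`2^{-π(y)} Σ_σ (N(σ) - 2^{-π(y)} P)² ≤ C · 2^{-π(y)} · x · ((log x)² + y²)` (log base 2). -/
theorem statement15 (hGRH : GRH) :
    ∃ C : ℝ, 0 < C ∧
      ∀ x y : ℝ, 3 ≤ y → y ≤ x →
        ∀ 𝒬 : Finset ℕ, 𝒬 = (Finset.range (⌊y⌋₊ + 1)).filter Nat.Prime →
          ∀ P : ℕ, P = Nat.card {p : ℕ // p.Prime ∧ y < (p : ℝ) ∧ (p : ℝ) ≤ x} →
            ((2 : ℝ) ^ 𝒬.card)⁻¹ *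
                ∑ σ : {q : ℕ // q ∈ 𝒬} → Bool,
                  ((Nat.card {p : ℕ // ∃ hp : p.Prime, y < (p : ℝ) ∧ (p : ℝ) ≤ x ∧
                      ∀ (q : ℕ) (hq : q ∈ 𝒬),
                        @legendreSym p ⟨hp⟩ (q : ℤ) = signB (σ ⟨q, hq⟩)} : ℝ) -
                    ((2 : ℝ) ^ 𝒬.card)⁻¹ * (P : ℝ)) ^ 2 ≤
              C * ((2 : ℝ) ^ 𝒬.card)⁻¹ * x * ((Real.logb 2 x) ^ 2 + y ^ 2) := by
  obtain ⟨C, hC, hK⟩ := QRVar.exists_abs_sum_jacobiSym_le hGRH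
  refine ⟨2 * C ^ 2, by positivity, ?_⟩
  intro x y hy hyx 𝒬 h𝒬 P hP
  have hy0 : 0 ≤ y := by linarith
  have hx0 : 0 ≤ x := by linarith
  let T := (Finset.Ioc ⌊y⌋₊ ⌊x⌋₊).filter Nat.Prime
  let b : ℕ → {q : ℕ // q ∈ 𝒬} → Bool := fun p q ↦ decide (jacobiSym (q : ℕ) p = 1)
  have hT : ∀ p, p ∈ T ↔ p.Prime ∧ y < (p : ℝ) ∧ (p : ℝ) ≤ x := fun p ↦ by
    simp only [T, Finset.mem_filter, Finset.mem_Ioc, Nat.floor_lt hy0, Nat.le_floor_iff hx0]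
    tauto
  have hndvd : ∀ p ∈ T, ∀ q ∈ 𝒬, ¬ p ∣ q := fun p hp q hq hdvd ↦ by
    rw [h𝒬, Finset.mem_filter, Finset.mem_range, Nat.lt_succ_iff, Nat.le_floor_iff hy0] at hq
    have h1 := ((hT p).mp hp).2.1
    have h2 : (p : ℝ) ≤ q := by exact_mod_cast Nat.le_of_dvd hq.2.pos hdvd
    linarith
  have hPT : (P : ℝ) = T.card := by
    rw [hP, Nat.subtype_card T hT]
  have hN : ∀ σ : {q : ℕ // q ∈ 𝒬} → Bool,
      (Nat.card {p : ℕ // ∃ hp : p.Prime, y < (p : ℝ) ∧ (p : ℝ) ≤ x ∧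
        ∀ (q : ℕ) (hq : q ∈ 𝒬), @legendreSym p ⟨hp⟩ (q : ℤ) = signB (σ ⟨q, hq⟩)} : ℝ) =
      ∑ p ∈ T, if b p = σ then (1 : ℝ) else 0 := fun σ ↦ by
    rw [Finset.sum_boole, Nat.subtype_card (T.filter fun p ↦ b p = σ)]
    intro p
    rw [Finset.mem_filter]
    constructor
    · rintro ⟨hpT, hb⟩
      obtain ⟨hp, h1, h2⟩ := (hT p).mp hpT
      have : Fact p.Prime := ⟨hp⟩
      refine ⟨hp, h1, h2, fun q hq ↦ ?_⟩
      rw [QRVar.legendreSym_eq_signB_decide (hndvd p hpT q hq), ← hb]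
    · rintro ⟨hp, h1, h2, h⟩
      have : Fact p.Prime := ⟨hp⟩
      have hpT := (hT p).mpr ⟨hp, h1, h2⟩
      refine ⟨hpT, funext fun q ↦ QRVar.signB_injective ?_⟩
      rw [← h q q.2, QRVar.legendreSym_eq_signB_decide (hndvd p hpT q q.2)]
  have hcard : 𝒬.card = Fintype.card {q : ℕ // q ∈ 𝒬} := (Fintype.card_coe 𝒬).symm
  have hlog0 : 0 ≤ Real.log x := Real.log_nonneg (by linarith)
  have hmain := QRVar.sum_sq_count_sub_le T b
    (M := (C * √x * (Real.log x + y)) ^ 2) (by positivity) (fun S hS ↦ ?_)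
  · have hlogb : Real.log x ≤ Real.logb 2 x := by
      rw [Real.logb, le_div_iff₀ (Real.log_pos one_lt_two)]
      nlinarith [Real.log_two_lt_d9]
    have hsq : (C * √x * (Real.log x + y)) ^ 2 ≤
        2 * C ^ 2 * x * ((Real.logb 2 x) ^ 2 + y ^ 2) := by
      rw [mul_pow, mul_pow, Real.sq_sqrt hx0]
      have h1 : (Real.log x + y) ^ 2 ≤ 2 * ((Real.logb 2 x) ^ 2 + y ^ 2) := by
        nlinarith [sq_nonneg (Real.log x - y)]
      calc _ ≤ C ^ 2 * x * (2 * ((Real.logb 2 x) ^ 2 + y ^ 2)) := by gcongr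
        _ = _ := by ring
    simp_rw [hN, hPT, hcard]
    calc _ ≤ ((2 : ℝ) ^ Fintype.card {q : ℕ // q ∈ 𝒬})⁻¹ *
          (2 * C ^ 2 * x * ((Real.logb 2 x) ^ 2 + y ^ 2)) := by
          gcongr
          exact hmain.trans hsq
      _ = _ := by ring
  · obtain ⟨h1, h2, h3, h4⟩ := QRVar.prod_properties hy0
      (S := S.map (Function.Embedding.subtype _)) (by simpa using hS) (fun q hq ↦ by
        obtain ⟨r, -, rfl⟩ := Finset.mem_map.mp hq
        rw [← h𝒬]
        exact r.2)
    have h5 := hK x y hy hyx _ h1 h2 h3 h4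
    rw [← sq_abs]
    refine pow_le_pow_left₀ (abs_nonneg _) (le_of_eq_of_le ?_ h5) 2
    congr 1
    refine Finset.sum_congr rfl fun p hp ↦ ?_
    have : Fact p.Prime := ⟨((hT p).mp hp).1⟩
    rw [Finset.prod_map, QRVar.jacobiSym_prod_left, Int.cast_prod]
    refine Finset.prod_congr rfl fun q _ ↦ ?_
    rw [← QRVar.legendreSym_eq_signB_decide (hndvd p hp q q.2),
      jacobiSym.legendreSym.to_jacobiSym]
    rfl
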